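/- Let β be an irrational real number and δ > 0. Let D and D_n (for n ∈ ℕ) be holomorphic functions from the open strip {z ∈ ℂ : |Im z| < δ} to M₂(ℂ), each 1-periodic (D(z+1) = D(z) and D_n(z+1) = D_n(z)). Suppose sup_{|Im z| ≤ δ/2} ‖D_n(z) − D(z)‖ → 0 as n → ∞, and let β_n be real numbers with β_n → β. Then L(β_n, D_n) → L(β, D) in ℝ ∪ {−∞}. (Joint continuity of the Lyapunov exponent on the space of analytic M₂(ℂ)-cocycles at irrational frequencies; singular cocycles, i.e. with det D vanishing somewhere, are allowed.) -/

import Mathlib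

open MeasureTheory Filter Complex
open scoped ENNReal Real NNReal

noncomputable section

attribute [local instance] Matrix.frobeniusNormedAddCommGroup

/-- The `n`-step cocycle iterate `D^{(n)}_β(x) = D(x+(n-1)β)⋯D(x)`. -/
def cocycleIter (D : ℝ → Matrix (Fin 2) (Fin 2) ℂ) (β : ℝ) : ℕ → ℝ → Matrix (Fin 2) (Fin 2) ℂ
  | 0, _ => 1
  | n + 1, x => cocycleIter D β n (x + β) * D x

/-- The extended-real-valued integral `∫₀¹ log (g x) dx`, with value `-∞` allowed
(the positive and negative parts are integrated separately; `log 0 = -∞`). -/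
def logIntegral (g : ℝ → ℝ) : EReal :=
  ((∫⁻ x in Set.Ioc (0 : ℝ) 1, ENNReal.ofReal (Real.log (g x))) : EReal) -
    ((∫⁻ x in Set.Ioc (0 : ℝ) 1,
        if g x = 0 then (⊤ : ℝ≥0∞) else ENNReal.ofReal (-Real.log (g x))) : EReal)

/-- The Lyapunov exponent `L(β, D) = inf_{n ≥ 1} (1/n) ∫₀¹ log ‖D^{(n)}_β(x)‖ dx ∈ ℝ ∪ {-∞}`. -/
def lyapunov (β : ℝ) (D : ℝ → Matrix (Fin 2) (Fin 2) ℂ) : EReal :=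
  ⨅ n : ℕ, ((((n : ℝ) + 1)⁻¹ : ℝ) : EReal) * logIntegral fun x => ‖cocycleIter D β (n + 1) x‖

attribute [local instance] Matrix.frobeniusNormedSpace

/-- A continuous `1`-periodic function satisfying the sub-mean value inequality on all discs
contained in the closed strip `a ≤ Im z ≤ b`. -/
structure SubStrip (a b : ℝ) (u : ℂ → ℝ) : Prop where
  cont : Continuous u
  per : ∀ z, u (z + 1) = u z
  sub : ∀ (z : ℂ) (ρ : ℝ), 0 < ρ → a ≤ z.im - ρ → z.im + ρ ≤ b → u z ≤ Real.circleAverage u z ρ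

lemma Continuous.circleIntegrable_of_real {u : ℂ → ℝ} (hu : Continuous u) (z : ℂ) (ρ : ℝ) :
    CircleIntegrable u z ρ :=
  hu.continuousOn.circleIntegrable'

lemma periodic_add_int {α : Type*} {u : ℂ → α} (hu : ∀ z, u (z + 1) = u z) (z : ℂ) (n : ℤ) :
    u (z + n) = u z := by
  have h : Function.Periodic u 1 := hu
  simpa using h.int_mul n z

lemma exists_re_mem_Icc {α : Type*} {u : ℂ → α} (hu : ∀ z, u (z + 1) = u z) (z : ℂ) :
    ∃ w : ℂ, w.re ∈ Set.Icc (0 : ℝ) 1 ∧ w.im = z.im ∧ u w = u z := by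
  refine ⟨z + ((-⌊z.re⌋ : ℤ) : ℂ), ?_, ?_, periodic_add_int hu z _⟩
  · have h1 := Int.floor_le z.re
    have h2 := Int.lt_floor_add_one z.re
    simp only [add_re, intCast_re, Set.mem_Icc]
    push_cast
    constructor <;> linarith
  · simp only [add_im, intCast_im, add_zero]

/-- Maximum principle on a periodic strip. -/
theorem SubStrip.le_zero {a b : ℝ} {V : ℂ → ℝ} (hV : SubStrip a b V)
    (ha : ∀ z : ℂ, z.im = a → V z ≤ 0) (hb : ∀ z : ℂ, z.im = b → V z ≤ 0)
    (z : ℂ) (hza : a ≤ z.im) (hzb : z.im ≤ b) : V z ≤ 0 := by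
  by_contra hcon
  push Not at hcon
  set K : Set ℂ := Set.Icc (0 : ℝ) 1 ×ℂ Set.Icc a b with hK
  have hKc : IsCompact K := isCompact_Icc.reProdIm isCompact_Icc
  have hmemK : ∀ w : ℂ, w ∈ K ↔ w.re ∈ Set.Icc (0 : ℝ) 1 ∧ w.im ∈ Set.Icc a b := fun w =>
    Complex.mem_reProdIm
  obtain ⟨w, hw1, hw2, hw3⟩ := exists_re_mem_Icc hV.per z
  have hwK : w ∈ K := (hmemK w).2 ⟨hw1, by rw [hw2]; exact ⟨hza, hzb⟩⟩
  obtain ⟨m, hmK, hmax⟩ := hKc.exists_isMaxOn ⟨w, hwK⟩ hV.cont.continuousOn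
  have hMpos : 0 < V m := lt_of_lt_of_le (by rw [hw3]; exact hcon) (hmax hwK)
  have hle : ∀ y : ℂ, a ≤ y.im → y.im ≤ b → V y ≤ V m := by
    intro y hy1 hy2
    obtain ⟨y', h1, h2, h3⟩ := exists_re_mem_Icc hV.per y
    rw [← h3]
    exact hmax ((hmemK y').2 ⟨h1, by rw [h2]; exact ⟨hy1, hy2⟩⟩)
  have hSc : IsCompact (K ∩ {y | V y = V m}) :=
    hKc.inter_right (isClosed_eq hV.cont continuous_const)
  obtain ⟨p, ⟨hpK, hpV⟩, hpmin⟩ := hSc.exists_isMinOn ⟨m, hmK, rfl⟩ Complex.continuous_im.continuousOn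
  have hp := (hmemK p).1 hpK
  have hpV' : V p = V m := hpV
  have hpa : a < p.im := by
    rcases hp.2.1.lt_or_eq with h | h
    · exact h
    · have := ha p h.symm; linarith
  have hpb : p.im < b := by
    rcases hp.2.2.lt_or_eq with h | h
    · exact h
    · have := hb p h; linarith
  set ρ := min (p.im - a) (b - p.im) with hρ
  have hρ0 : 0 < ρ := lt_min (by linarith) (by linarith)
  have hρ1 : ρ ≤ p.im - a := min_le_left _ _
  have hρ2 : ρ ≤ b - p.im := min_le_right _ _
  have hcirc : ∀ θ : ℝ, V (circleMap p ρ θ) ≤ V m := by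
    intro θ
    have him : (circleMap p ρ θ).im = p.im + ρ * Real.sin θ := by
      simp [circleMap, Complex.exp_mul_I, ← Complex.ofReal_cos, ← Complex.ofReal_sin]
    have h1 := Real.sin_le_one θ
    have h2 := Real.neg_one_le_sin θ
    apply hle <;> rw [him] <;> nlinarith
  have hlow : V (p - ρ * I) < V m := by
    refine lt_of_le_of_ne (hle _ (by simp; linarith) (by simp; linarith)) ?_
    intro heq
    have hin : p - ρ * I ∈ K ∩ {y | V y = V m} := by
      refine ⟨(hmemK _).2 ⟨by simpa using hp.1, ?_⟩, heq⟩
      simp only [sub_im, mul_im, ofReal_re, I_im, mul_one, ofReal_im, I_re, mul_zero, add_zero]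
      constructor <;> linarith
    have := hpmin hin
    simp at this
    linarith
  have hsub := hV.sub p ρ hρ0 (by linarith) (by linarith)
  rw [Real.circleAverage_def, smul_eq_mul] at hsub
  have hlt : ∫ θ in (0:ℝ)..2 * π, V (circleMap p ρ θ) < ∫ _θ in (0:ℝ)..2 * π, V m := by
    refine intervalIntegral.integral_lt_integral_of_continuousOn_of_le_of_exists_lt
      Real.two_pi_pos (hV.cont.comp (continuous_circleMap p ρ)).continuousOn continuousOn_const
      (fun θ _ => hcirc θ) ⟨3 * π / 2, ?_, ?_⟩
    · constructor <;> nlinarith [Real.pi_pos]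
    · have : circleMap p ρ (3 * π / 2) = p - ρ * I := by
        have h1 : Real.cos (3 * π / 2) = 0 := by
          rw [show 3 * π / 2 = π / 2 + π by ring, Real.cos_add_pi, Real.cos_pi_div_two, neg_zero]
        have h2 : Real.sin (3 * π / 2) = -1 := by
          rw [show 3 * π / 2 = π / 2 + π by ring, Real.sin_add_pi, Real.sin_pi_div_two]
        rw [circleMap, Complex.exp_mul_I, ← Complex.ofReal_cos, ← Complex.ofReal_sin, h1, h2]
        push_cast; ring
      rw [this]; exact hlow
  rw [intervalIntegral.integral_const, smul_eq_mul] at hlt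
  have h2π := Real.two_pi_pos
  have : (2 * π)⁻¹ * ∫ θ in (0:ℝ)..2 * π, V (circleMap p ρ θ) < (2 * π)⁻¹ * ((2 * π - 0) * V m) :=
    mul_lt_mul_of_pos_left hlt (inv_pos.2 h2π)
  rw [sub_zero, ← mul_assoc, inv_mul_cancel₀ h2π.ne', one_mul] at this
  linarith

lemma SubStrip.add {a b : ℝ} {u v : ℂ → ℝ} (hu : SubStrip a b u) (hv : SubStrip a b v) :
    SubStrip a b (fun z => u z + v z) where
  cont := hu.cont.add hv.cont
  per z := by rw [hu.per, hv.per]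
  sub z ρ h1 h2 h3 := by
    rw [Real.circleAverage_fun_add (hu.cont.circleIntegrable_of_real z ρ)
      (hv.cont.circleIntegrable_of_real z ρ)]
    exact add_le_add (hu.sub z ρ h1 h2 h3) (hv.sub z ρ h1 h2 h3)

/-- The real part of a periodic entire function. -/
lemma subStrip_re {f : ℂ → ℂ} (hf : Differentiable ℂ f) (hper : ∀ z, (f (z + 1)).re = (f z).re)
    (a b : ℝ) : SubStrip a b (fun z => (f z).re) where
  cont := Complex.continuous_re.comp hf.continuous
  per := hper
  sub z ρ _ _ _ := by
    have h := (hf.diffContOnCl (s := Metric.ball z |ρ|)).circleAverage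
    have h2 := Complex.reCLM.circleAverage_comp_comm (f := f) (c := z) (R := ρ)
      (hf.continuous.continuousOn.circleIntegrable')
    have h3 : Real.circleAverage (fun z => (f z).re) z ρ = (Real.circleAverage f z ρ).re := h2
    rw [h3, h]

lemma intervalIntegral_swap_of_continuous {f : ℝ → ℝ → ℝ} (hf : Continuous (Function.uncurry f))
    (a b c d : ℝ) :
    ∫ x in a..b, ∫ y in c..d, f x y = ∫ y in c..d, ∫ x in a..b, f x y := by
  refine intervalIntegral_intervalIntegral_swap ?_
  exact (hf.continuousOn.integrableOn_compact (isCompact_uIcc.prod isCompact_uIcc)).mono_set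
    (Set.prod_mono Set.uIoc_subset_uIcc Set.uIoc_subset_uIcc)

/-- Averaging horizontal translates with a nonnegative weight. -/
lemma SubStrip.average {a b : ℝ} {u : ℂ → ℝ} (hu : SubStrip a b u) {w : ℝ → ℝ}
    (hw : Continuous w) (hw0 : ∀ t, 0 ≤ w t) :
    SubStrip a b (fun z => ∫ t in (0:ℝ)..1, u (z + t) * w t) where
  cont := by
    refine intervalIntegral.continuous_parametric_intervalIntegral_of_continuous' ?_ 0 1
    have := hu.cont
    simp only [Function.uncurry_def]
    fun_prop
  per z := by
    congr 1
    ext t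
    rw [show z + 1 + t = (z + t) + 1 by ring, hu.per]
  sub z ρ h1 h2 h3 := by
    have hc := hu.cont
    have hswap : ∫ θ in (0:ℝ)..2 * π, ∫ t in (0:ℝ)..1, u (circleMap z ρ θ + t) * w t =
        ∫ t in (0:ℝ)..1, ∫ θ in (0:ℝ)..2 * π, u (circleMap z ρ θ + t) * w t := by
      refine intervalIntegral_swap_of_continuous ?_ _ _ _ _
      simp only [Function.uncurry_def]
      have := continuous_circleMap z ρ
      fun_prop
    rw [Real.circleAverage_def, hswap, smul_eq_mul, ← intervalIntegral.integral_const_mul]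
    refine intervalIntegral.integral_mono_on zero_le_one ?_ ?_ ?_
    · exact Continuous.intervalIntegrable (by fun_prop) _ _
    · refine Continuous.intervalIntegrable (Continuous.mul continuous_const ?_) _ _
      refine intervalIntegral.continuous_parametric_intervalIntegral_of_continuous' ?_ _ _
      simp only [Function.uncurry_def]
      have := continuous_circleMap z ρ
      fun_prop
    · intro t _
      have h := hu.sub (z + t) ρ h1 (by simpa using h2) (by simpa using h3)
      rw [Real.circleAverage_def, smul_eq_mul] at h
      have e : ∀ θ, circleMap (z + t) ρ θ = circleMap z ρ θ + t := by
        intro θ; simp only [circleMap]; ring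
      simp only [e] at h
      rw [intervalIntegral.integral_mul_const, ← mul_assoc]
      exact mul_le_mul_of_nonneg_right h (hw0 t)

lemma SubStrip.mono {a b a' b' : ℝ} {u : ℂ → ℝ} (hu : SubStrip a b u) (ha : a ≤ a') (hb : b' ≤ b) :
    SubStrip a' b' u where
  cont := hu.cont
  per := hu.per
  sub z ρ h1 h2 h3 := hu.sub z ρ h1 (by linarith) (by linarith)

lemma circleAverage_translate (u : ℂ → ℝ) (z w : ℂ) (ρ : ℝ) :
    Real.circleAverage (fun z => u (z + w)) z ρ = Real.circleAverage u (z + w) ρ := by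
  simp only [Real.circleAverage_def]
  congr 3
  ext θ
  congr 1
  simp only [circleMap]; ring

lemma SubStrip.translate {a b : ℝ} {u : ℂ → ℝ} (hu : SubStrip a b u) (e : ℝ) :
    SubStrip (a - e) (b - e) (fun z => u (z + e * I)) where
  cont := hu.cont.comp (by fun_prop)
  per z := by rw [show z + 1 + e * I = (z + e * I) + 1 by ring, hu.per]
  sub z ρ h1 h2 h3 := by
    rw [circleAverage_translate]
    exact hu.sub _ ρ h1 (by simp; linarith) (by simp; linarith)

/-- The mean of `u` over one period of the horizontal line at height `ε`. -/
def lineAvg (u : ℂ → ℝ) (ε : ℝ) : ℝ := ∫ x in (0:ℝ)..1, u (x + ε * I)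

/-- The Fourier integral of `u` along the horizontal line at height `ε`. -/
def lineFourier (u : ℂ → ℝ) (k : ℕ) (ε : ℝ) : ℂ :=
  ∫ x in (0:ℝ)..1, (u (x + ε * I) : ℂ) * cexp (2 * π * k * x * I)

lemma integral_translate_eq {E : Type*} [NormedAddCommGroup E] [NormedSpace ℝ E]
    {g : ℝ → E} (hg : Function.Periodic g 1) (x : ℝ) :
    ∫ t in (0:ℝ)..1, g (t + x) = ∫ t in (0:ℝ)..1, g t := by
  rw [intervalIntegral.integral_comp_add_right]
  have := hg.intervalIntegral_add_eq x 0
  simpa [add_comm] using this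

lemma lineAvg_eq {u : ℂ → ℝ} (hu : ∀ z, u (z + 1) = u z) (z : ℂ) :
    ∫ t in (0:ℝ)..1, u (z + t) = lineAvg u z.im := by
  have hp : Function.Periodic (fun t : ℝ => u (t + z.im * I)) 1 := by
    intro t
    simp only [ofReal_add, ofReal_one]
    rw [show (t:ℂ) + 1 + z.im * I = t + z.im * I + 1 by ring, hu]
  rw [lineAvg, ← integral_translate_eq hp z.re]
  congr 1; ext t; congr 1
  conv_lhs => rw [← Complex.re_add_im z]
  push_cast; ring

lemma exp_two_pi_nat (k : ℕ) (x : ℂ) :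
    cexp (2 * π * k * (x + 1) * I) = cexp (2 * π * k * x * I) := by
  rw [show 2 * π * k * (x + 1) * I = 2 * π * k * x * I + k * (2 * π * I) by ring,
    Complex.exp_add, Complex.exp_nat_mul_two_pi_mul_I, mul_one]

lemma lineFourier_eq {u : ℂ → ℝ} (hu : ∀ z, u (z + 1) = u z) (k : ℕ) (z : ℂ) :
    ∫ t in (0:ℝ)..1, (u (z + t) : ℂ) * cexp (2 * π * k * t * I) =
      cexp (-(2 * π * k * z.re * I)) * lineFourier u k z.im := by
  have hp : Function.Periodic
      (fun t : ℝ => (u (t + z.im * I) : ℂ) * cexp (2 * π * k * t * I)) 1 := by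
    intro t
    simp only [ofReal_add, ofReal_one]
    rw [exp_two_pi_nat, show (t:ℂ) + 1 + z.im * I = t + z.im * I + 1 by ring, hu]
  rw [lineFourier, ← integral_translate_eq hp z.re, ← intervalIntegral.integral_const_mul]
  congr 1; ext t
  rw [mul_left_comm, ← Complex.exp_add]
  congr 2
  · congr 1
    conv_lhs => rw [← Complex.re_add_im z]
    push_cast; ring
  · push_cast; ring

lemma SubStrip.lineAvg_le_chord {τ : ℝ} (hτ : 0 < τ) {u : ℂ → ℝ} (hu : SubStrip (-τ) τ u)
    (y : ℝ) (h1 : -τ ≤ y) (h2 : y ≤ τ) :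
    lineAvg u y ≤ (lineAvg u τ + lineAvg u (-τ)) / 2 +
      y * ((lineAvg u τ - lineAvg u (-τ)) / (2 * τ)) := by
  set s := (lineAvg u τ - lineAvg u (-τ)) / (2 * τ) with hs
  set m := (lineAvg u τ + lineAvg u (-τ)) / 2 with hm
  have hU := hu.average (w := fun _ => 1) continuous_const (fun _ => zero_le_one)
  have hH := subStrip_re (f := fun z => I * z * s - m) (by fun_prop)
    (by intro z; simp) (-τ) τ
  have hst : s * τ = (lineAvg u τ - lineAvg u (-τ)) / 2 := by rw [hs]; field_simp
  have key := (hU.add hH).le_zero (fun z hz => ?_) (fun z hz => ?_) (y * I) (by simpa) (by simpa)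
  · simp only [mul_one, lineAvg_eq hu.per] at key
    simp at key
    linarith
  · simp only [mul_one, lineAvg_eq hu.per, hz]
    simp [hz]
    rw [mul_comm] at hst
    linarith
  · simp only [mul_one, lineAvg_eq hu.per, hz]
    simp [hz]
    rw [mul_comm] at hst
    linarith

/-- The interpolation inequality for Fourier integrals of sub-mean functions. -/
lemma SubStrip.norm_lineFourier_le {τ : ℝ} (hτ : 0 < τ) {u : ℂ → ℝ} (hu : SubStrip (-τ) τ u)
    {k : ℕ} (hk : 0 < k) :
    ‖lineFourier u k 0‖ ≤ (lineAvg u τ + lineAvg u (-τ)) / 2 - lineAvg u 0 +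
      (‖lineFourier u k τ‖ + ‖lineFourier u k (-τ)‖) / (2 * Real.cosh (2 * π * k * τ)) := by
  set G := lineFourier u k with hG
  obtain ⟨c, hc1, hc2⟩ : ∃ c : ℂ, ‖c‖ = 1 ∧ (c * G 0).re = ‖G 0‖ := by
    by_cases h : G 0 = 0
    · exact ⟨1, by simp, by simp [h]⟩
    · refine ⟨(starRingEnd ℂ) (G 0) / ‖G 0‖, ?_, ?_⟩
      · simp [h]
      · rw [div_mul_eq_mul_div, mul_comm ((starRingEnd ℂ) (G 0)), Complex.mul_conj,
          Complex.normSq_eq_norm_sq]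
        have : (‖G 0‖ : ℂ) ≠ 0 := by simpa using h
        rw [ofReal_pow, pow_two, mul_div_assoc, div_self this, mul_one, ofReal_re]
  set σ : ℝ := 2 * π * k * τ with hσ
  have hσ0 : 0 < σ := by positivity
  set p : ℝ := Real.exp σ with hp
  set q : ℝ := Real.exp (-σ) with hq
  have hpq : q < p := Real.exp_lt_exp.2 (by linarith)
  have hq0 : 0 < q := Real.exp_pos _
  have hdet : ((p:ℂ) ^ 2 - (q:ℂ) ^ 2) ≠ 0 := by
    have : p ^ 2 - q ^ 2 ≠ 0 := by nlinarith
    exact_mod_cast this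
  set A : ℂ := (G τ * p - G (-τ) * q) / ((p:ℂ) ^ 2 - (q:ℂ) ^ 2) with hA
  set B : ℂ := (G (-τ) * p - G τ * q) / ((p:ℂ) ^ 2 - (q:ℂ) ^ 2) with hB
  have e1 : A * p + B * q = G τ := by rw [hA, hB]; field_simp; ring
  have e2 : A * q + B * p = G (-τ) := by rw [hA, hB]; field_simp; ring
  have e3 : (A + B) * (p + q) = G τ + G (-τ) := by rw [← e1, ← e2]; ring
  set s := (lineAvg u τ - lineAvg u (-τ)) / (2 * τ) with hs
  set m := (lineAvg u τ + lineAvg u (-τ)) / 2 with hm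
  have hst : τ * s = (lineAvg u τ - lineAvg u (-τ)) / 2 := by rw [hs]; field_simp
  have hw : Continuous (fun t : ℝ => 1 + (c * cexp (2 * π * k * t * I)).re) := by fun_prop
  have hw0 : ∀ t : ℝ, 0 ≤ 1 + (c * cexp (2 * π * k * t * I)).re := by
    intro t
    have h1 : ‖c * cexp (2 * π * k * t * I)‖ = 1 := by
      rw [norm_mul, hc1, one_mul, show (2 * π * k * t * I : ℂ) = ((2 * π * k * t : ℝ) : ℂ) * I by
        push_cast; ring, Complex.norm_exp_ofReal_mul_I]
    have := Complex.abs_re_le_norm (c * cexp (2 * π * k * t * I))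
    rw [h1] at this
    linarith [(abs_le.1 this).1]
  have hU := hu.average hw hw0
  have hUeq : ∀ z : ℂ, ∫ t in (0:ℝ)..1, u (z + t) * (1 + (c * cexp (2 * π * k * t * I)).re) =
      lineAvg u z.im + (c * (cexp (-(2 * π * k * z.re * I)) * G z.im)).re := by
    intro z
    rw [← lineAvg_eq hu.per, hG, ← lineFourier_eq hu.per, ← intervalIntegral.integral_const_mul]
    have hc := hu.cont
    have hcomm : (∫ t in (0:ℝ)..1, c * ((u (z + t) : ℂ) * cexp (2 * π * k * t * I))).re =
        ∫ t in (0:ℝ)..1, (c * ((u (z + t) : ℂ) * cexp (2 * π * k * t * I))).re := by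
      refine (Complex.reCLM.intervalIntegral_comp_comm ?_).symm
      exact Continuous.intervalIntegrable (by fun_prop) _ _
    rw [hcomm, ← intervalIntegral.integral_add
      (Continuous.intervalIntegrable (by fun_prop) _ _)
      (Continuous.intervalIntegrable (by fun_prop) _ _)]
    congr 1; ext t
    rw [mul_left_comm c, Complex.re_ofReal_mul]
    ring
  have hH := subStrip_re (f := fun z => I * z * s - m - c * A * cexp (-(2 * π * k * z * I))
    - (starRingEnd ℂ) (c * B) * cexp (2 * π * k * z * I)) (by fun_prop)
    (by
      intro z
      have h1 := exp_two_pi_nat k z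
      have h2 : cexp (-(2 * π * k * (z + 1) * I)) = cexp (-(2 * π * k * z * I)) := by
        rw [Complex.exp_neg, Complex.exp_neg, h1]
      rw [h1, h2]; simp) (-τ) τ
  have hHeq : ∀ z : ℂ, (I * z * s - m - c * A * cexp (-(2 * π * k * z * I))
      - (starRingEnd ℂ) (c * B) * cexp (2 * π * k * z * I)).re = - z.im * s - m -
        (c * (cexp (-(2 * π * k * z.re * I)) * (A * Real.exp (2 * π * k * z.im) +
          B * Real.exp (-(2 * π * k * z.im))))).re := by
    intro z
    have h1 : cexp (-(2 * π * k * z * I)) =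
        cexp (-(2 * π * k * z.re * I)) * Real.exp (2 * π * k * z.im) := by
      rw [ofReal_exp, ← Complex.exp_add]
      congr 1
      conv_lhs => rw [← Complex.re_add_im z]
      push_cast
      linear_combination (-2 * π * k * z.im : ℂ) * I_mul_I
    have h2 : cexp (2 * π * k * z * I) = (starRingEnd ℂ)
        (cexp (-(2 * π * k * z.re * I)) * Real.exp (-(2 * π * k * z.im))) := by
      rw [ofReal_exp, ← Complex.exp_add, ← Complex.exp_conj]
      congr 1
      have hz := Complex.re_add_im z
      have h2c : (starRingEnd ℂ) 2 = 2 := Complex.conj_ofNat 2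
      simp [h2c]
      linear_combination (-2 * π * k * I : ℂ) * hz + (2 * π * k * z.im : ℂ) * I_mul_I
    rw [h1, h2, ← map_mul, Complex.sub_re, Complex.conj_re, sub_re, sub_re]
    have : (I * z * s).re = - z.im * s := by simp
    rw [this, ofReal_re, sub_sub _ (c * A * _).re, ← Complex.add_re]
    congr 2; ring
  have key := (hU.add hH).le_zero (fun z hz => ?_) (fun z hz => ?_) 0 (by simp; linarith)
    (by simp; linarith)
  · rw [hUeq, hHeq] at key
    simp only [zero_re, zero_im, ofReal_zero, mul_zero, zero_mul, neg_zero, Complex.exp_zero,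
      one_mul, Real.exp_zero, ofReal_one, mul_one] at key
    rw [hc2] at key
    have h4 : (c * (A + B)).re ≤ ‖A + B‖ := by
      calc _ ≤ ‖c * (A + B)‖ := Complex.re_le_norm _
        _ = _ := by rw [norm_mul, hc1, one_mul]
    have h5 : ‖A + B‖ ≤ (‖G τ‖ + ‖G (-τ)‖) / (2 * Real.cosh σ) := by
      have hch : 2 * Real.cosh σ = p + q := by rw [Real.cosh_eq]; ring
      rw [hch, le_div_iff₀ (by positivity)]
      have := congrArg norm e3
      rw [norm_mul, ← ofReal_add, Complex.norm_of_nonneg (by positivity)] at this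
      rw [this]
      exact norm_add_le _ _
    linarith
  · rw [hUeq, hHeq, hz]
    have : A * Real.exp (2 * π * k * (-τ)) + B * Real.exp (-(2 * π * k * (-τ))) = G (-τ) := by
      rw [← e2, hp, hq, hσ]; congr 4 <;> ring
    rw [this]
    linarith
  · rw [hUeq, hHeq, hz]
    have : A * Real.exp (2 * π * k * τ) + B * Real.exp (-(2 * π * k * τ)) = G τ := by
      rw [← e1, hp, hq, hσ]
    rw [this]
    linarith

lemma SubStrip.lineAvg_convex {a b : ℝ} {u : ℂ → ℝ} (hu : SubStrip a b u) :
    ConvexOn ℝ (Set.Icc a b) (lineAvg u) := by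
  have hmid : ∀ x z y : ℝ, a ≤ x → z ≤ b → x < y → y < z →
      (z - x) * lineAvg u y ≤ (z - y) * lineAvg u x + (y - x) * lineAvg u z := by
    intro x z y hx hz hxy hyz
    set e := (x + z) / 2 with he
    set τ := (z - x) / 2 with hτ
    have hτ0 : 0 < τ := by rw [hτ]; linarith
    have h := ((hu.translate e).mono (a' := -τ) (b' := τ)
      (by rw [he, hτ]; linarith) (by rw [he, hτ]; linarith)).lineAvg_le_chord hτ0 (y - e)
      (by rw [he, hτ]; linarith) (by rw [he, hτ]; linarith)
    have hs : ∀ y, lineAvg (fun z => u (z + e * I)) y = lineAvg u (y + e) := by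
      intro y
      simp only [lineAvg]
      congr 1; ext t; congr 1; push_cast; ring
    simp only [hs] at h
    rw [sub_add_cancel, show τ + e = z by rw [he, hτ]; ring, show -τ + e = x by rw [he, hτ]; ring] at h
    have h2 := mul_le_mul_of_nonneg_left h (by linarith : 0 ≤ 2 * τ)
    have h3 : 2 * τ * ((lineAvg u z + lineAvg u x) / 2 + (y - e) * ((lineAvg u z - lineAvg u x) / (2 * τ)))
        = τ * (lineAvg u z + lineAvg u x) + (y - e) * (lineAvg u z - lineAvg u x) := by
      field_simp
    rw [h3] at h2
    have h4 : 2 * τ = z - x := by rw [hτ]; ring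
    rw [h4] at h2
    refine h2.trans (le_of_eq ?_)
    rw [he, hτ]; ring
  refine convexOn_of_slope_mono_adjacent (convex_Icc a b) ?_
  intro x y z hx hz hxy hyz
  rw [div_le_div_iff₀ (by linarith) (by linarith)]
  have := hmid x z y hx.1 hz.2 hxy hyz
  nlinarith

lemma abs_lineAvg_le {u : ℂ → ℝ} {C : ℝ} (hC : ∀ z, |u z| ≤ C) (y : ℝ) : |lineAvg u y| ≤ C := by
  have h := intervalIntegral.norm_integral_le_of_norm_le_const (a := (0:ℝ)) (b := 1)
    (f := fun x : ℝ => u (x + y * I)) (C := C) (fun x _ => hC _)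
  simpa [lineAvg] using h

lemma norm_exp_two_pi (k : ℕ) (x : ℝ) : ‖cexp (2 * π * k * x * I)‖ = 1 := by
  rw [show (2 * π * k * x * I : ℂ) = ((2 * π * k * x : ℝ) : ℂ) * I by push_cast; ring,
    Complex.norm_exp_ofReal_mul_I]

lemma norm_lineFourier_le_const {u : ℂ → ℝ} {C : ℝ} (hC : ∀ z, |u z| ≤ C) (k : ℕ) (y : ℝ) :
    ‖lineFourier u k y‖ ≤ C := by
  have h := intervalIntegral.norm_integral_le_of_norm_le_const (a := (0:ℝ)) (b := 1)
    (f := fun x : ℝ => (u (x + y * I) : ℂ) * cexp (2 * π * k * x * I)) (C := C) (fun x _ => by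
      rw [norm_mul, norm_exp_two_pi, mul_one, Complex.norm_real]; exact hC _)
  simpa [lineFourier] using h

/-- Fourier coefficients of a bounded sub-mean function decay like `1 / k`. -/
theorem SubStrip.lineFourier_decay {η C : ℝ} (hη : 0 < η) {u : ℂ → ℝ} (hu : SubStrip (-η) η u)
    (hC : ∀ z, |u z| ≤ C) {k : ℕ} (hk : 0 < k) :
    ‖lineFourier u k 0‖ ≤ 10 * C / (η * k) := by
  have hC0 : 0 ≤ C := (abs_nonneg _).trans (hC 0)
  have hk' : (0:ℝ) < k := by exact_mod_cast hk
  set τ : ℝ := 1 / k with hτ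
  have hτ0 : 0 < τ := by positivity
  rcases lt_or_ge (η / 2) τ with hlt | hle
  · refine (norm_lineFourier_le_const hC k 0).trans ?_
    rw [le_div_iff₀ (by positivity)]
    have : η * k < 2 := by
      rw [hτ, lt_div_iff₀ hk'] at hlt
      linarith
    nlinarith
  have hconv := hu.lineAvg_convex
  set h := lineAvg u with hh
  have hsl : ∀ x y w : ℝ, -η ≤ x → w ≤ η → x < y → y < w →
      (h y - h x) / (y - x) ≤ (h w - h y) / (w - y) := fun x y w hx hw hxy hyw =>
    hconv.slope_mono_adjacent ⟨hx, by linarith⟩ ⟨by linarith, hw⟩ hxy hyw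
  have hb : ∀ y, |h y| ≤ C := fun y => abs_lineAvg_le hC y
  have second : ∀ ε : ℝ, |ε| ≤ η / 2 - τ → (h (ε + τ) + h (ε - τ)) / 2 - h ε ≤ 4 * C * τ / η := by
    intro ε hε
    obtain ⟨h1, h2⟩ := abs_le.1 hε
    have a1 := hsl ε (ε + τ) η (by linarith) le_rfl (by linarith) (by linarith)
    have a2 := hsl (-η) (ε - τ) ε le_rfl (by linarith) (by linarith) (by linarith)
    have b1 : (h η - h (ε + τ)) / (η - (ε + τ)) ≤ 2 * C / (η / 2) := by
      have := abs_le.1 (hb η); have := abs_le.1 (hb (ε + τ))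
      exact div_le_div₀ (by positivity) (by linarith) (by positivity) (by linarith)
    have b2 : (h (-η) - h (ε - τ)) / ((ε - τ) - (-η)) ≤ 2 * C / (η / 2) := by
      have := abs_le.1 (hb (-η)); have := abs_le.1 (hb (ε - τ))
      exact div_le_div₀ (by positivity) (by linarith) (by positivity) (by linarith)
    have b3 : (h (ε - τ) - h (-η)) / ((ε - τ) - (-η)) = - ((h (-η) - h (ε - τ)) / ((ε - τ) - (-η))) := by
      rw [← neg_div]; congr 1; ring
    rw [b3] at a2
    rw [add_sub_cancel_left] at a1
    rw [sub_sub_cancel] at a2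
    have c1 : h (ε + τ) - h ε ≤ 2 * C / (η / 2) * τ := by
      rw [← div_le_iff₀ hτ0]; exact a1.trans b1
    have c2 : -(2 * C / (η / 2) * τ) ≤ h ε - h (ε - τ) := by
      have : -(2 * C / (η / 2)) ≤ (h ε - h (ε - τ)) / τ := by linarith
      rw [le_div_iff₀ hτ0] at this; linarith
    have e : 2 * C / (η / 2) * τ = 4 * C * τ / η := by field_simp; ring
    rw [e] at c1 c2
    linarith
  have hcosh : 2 ≤ Real.cosh (2 * π * k * τ) := by
    have : 2 * π * k * τ = 2 * π := by rw [hτ]; field_simp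
    rw [this, Real.cosh_eq]
    have h1 := Real.add_one_le_exp (2 * π)
    have h2 := Real.exp_pos (-(2 * π))
    linarith [Real.pi_gt_three]
  have step : ∀ ε M : ℝ, |ε| ≤ η / 2 - τ → ‖lineFourier u k (ε + τ)‖ ≤ M →
      ‖lineFourier u k (ε - τ)‖ ≤ M → ‖lineFourier u k ε‖ ≤ 4 * C * τ / η + M / 2 := by
    intro ε M hε h1 h2
    have hε' := abs_le.1 hε
    have hM : 0 ≤ M := (norm_nonneg _).trans h1
    have hs : ∀ y, lineAvg (fun z => u (z + ε * I)) y = h (y + ε) := by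
      intro y
      simp only [hh, lineAvg]
      congr 1; ext t; congr 1; push_cast; ring
    have hs' : ∀ y, lineFourier (fun z => u (z + ε * I)) k y = lineFourier u k (y + ε) := by
      intro y
      simp only [lineFourier]
      congr 1; ext t; congr 3; push_cast; ring
    have := ((hu.translate ε).mono (a' := -τ) (b' := τ)
      (by linarith) (by linarith)).norm_lineFourier_le hτ0 hk
    simp only [hs, hs'] at this
    rw [zero_add, add_comm τ, neg_add_eq_sub] at this
    have h3 := second ε hε
    have h4 : (‖lineFourier u k (ε + τ)‖ + ‖lineFourier u k (ε - τ)‖) /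
        (2 * Real.cosh (2 * π * k * τ)) ≤ (2 * M) / (2 * 2) :=
      div_le_div₀ (by positivity) (by linarith) (by norm_num) (by linarith)
    linarith
  have iter : ∀ (j : ℕ) (ε : ℝ), |ε| ≤ η / 2 - j * τ →
      ‖lineFourier u k ε‖ ≤ 8 * C * τ / η + C * (1 / 2) ^ j := by
    intro j
    induction j with
    | zero =>
      intro ε _
      have h1 := norm_lineFourier_le_const hC k ε
      have h2 : 0 ≤ 8 * C * τ / η := by positivity
      simp; linarith
    | succ j ih =>
      intro ε hε
      push_cast at hε
      have hε' := abs_le.1 hε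
      have hj : 0 ≤ j * τ := by positivity
      have h1 := ih (ε + τ) (abs_le.2 ⟨by linarith, by linarith⟩)
      have h2 := ih (ε - τ) (abs_le.2 ⟨by linarith, by linarith⟩)
      have := step ε _ (hε.trans (by linarith)) h1 h2
      rw [pow_succ]
      have e : 4 * C * τ / η + (8 * C * τ / η + C * (1 / 2) ^ j) / 2 =
        8 * C * τ / η + C * ((1 / 2) ^ j * (1 / 2)) := by ring
      linarith
  have hfl := Nat.floor_le (show 0 ≤ η * k / 2 by positivity)
  have hfl2 := Nat.lt_floor_add_one (η * k / 2)
  set j := ⌊η * k / 2⌋₊ with hj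
  have hfin := iter j 0 (by
    rw [abs_zero, hτ]
    have : (j:ℝ) * (1 / k) ≤ η * k / 2 * (1 / k) := by gcongr
    have e : η * k / 2 * (1 / k) = η / 2 := by field_simp
    linarith)
  have hpow : (1 / 2 : ℝ) ^ j ≤ 2 / (η * k) := by
    have h1 : (j:ℝ) + 1 ≤ 2 ^ j := by
      exact_mod_cast Nat.lt_two_pow_self
    have h2 : η * k / 2 ≤ 2 ^ j := by linarith
    rw [one_div, inv_pow, inv_eq_one_div, div_le_div_iff₀ (by positivity) (by positivity)]
    linarith
  have hpow2 := mul_le_mul_of_nonneg_left hpow hC0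
  have e : 8 * C * τ / η + C * (2 / (η * k)) = 10 * C / (η * k) := by
    rw [hτ]; field_simp; norm_num
  linarith

/-- The `k`-th Fourier integral of a real function over `[0, 1]`. -/
def fourierInt (g : ℝ → ℝ) (k : ℕ) : ℂ := ∫ x in (0:ℝ)..1, (g x : ℂ) * cexp (2 * π * k * x * I)

lemma norm_fourierCoeffOn_eq (g : ℝ → ℝ) (n : ℤ) :
    ‖fourierCoeffOn (zero_lt_one : (0:ℝ) < 1) (fun x => (g x : ℂ)) n‖ = ‖fourierInt g n.natAbs‖ := by
  have hneg : ∀ k : ℕ, fourierCoeffOn (zero_lt_one : (0:ℝ) < 1) (fun x => (g x : ℂ)) (-k) =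
      fourierInt g k := by
    intro k
    rw [fourierCoeffOn_eq_integral, fourierInt]
    simp only [sub_zero, div_one, one_smul]
    congr 1; ext x
    rw [fourier_coe_apply, smul_eq_mul, mul_comm]
    congr 2; push_cast; ring
  have hpos : ∀ k : ℕ, fourierCoeffOn (zero_lt_one : (0:ℝ) < 1) (fun x => (g x : ℂ)) k =
      (starRingEnd ℂ) (fourierInt g k) := by
    intro k
    rw [fourierCoeffOn_eq_integral, fourierInt]
    simp only [sub_zero, div_one, one_smul]
    rw [intervalIntegral.integral_of_le zero_le_one, intervalIntegral.integral_of_le zero_le_one,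
      ← integral_conj]
    congr 1; ext x
    rw [fourier_coe_apply, smul_eq_mul, mul_comm, map_mul, Complex.conj_ofReal, ← Complex.exp_conj]
    congr 2
    have h2c : (starRingEnd ℂ) 2 = 2 := Complex.conj_ofNat 2
    simp [h2c]; ring
  rcases Int.natAbs_eq n with h | h
  · generalize n.natAbs = k at h ⊢
    rw [h, hpos, RCLike.norm_conj]
  · generalize n.natAbs = k at h ⊢
    rw [h, hneg]

lemma integral_sq_le_of_fourierInt {g : ℝ → ℝ} (hg : Continuous g) (h0 : ∫ x in (0:ℝ)..1, g x = 0)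
    {B : ℕ → ℝ} (hB : ∀ k : ℕ, ‖fourierInt g (k + 1)‖ ^ 2 ≤ B k) (hs : Summable B) :
    ∫ x in (0:ℝ)..1, g x ^ 2 ≤ 2 * ∑' k, B k := by
  have hL2 : MemLp (fun x => (g x : ℂ)) 2 (volume.restrict (Set.Ioc (0:ℝ) 1)) := by
    have hc : Continuous (fun x => (g x : ℂ)) := by fun_prop
    refine (MeasureTheory.memLp_two_iff_integrable_sq_norm
      hc.aestronglyMeasurable).2 ?_
    have h2 : Continuous (fun x => ‖(g x : ℂ)‖ ^ 2) := by fun_prop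
    exact (h2.integrableOn_Icc (a := 0) (b := 1)).mono_set Set.Ioc_subset_Icc_self
  have hsum := hasSum_sq_fourierCoeffOn zero_lt_one hL2
  simp only [norm_fourierCoeffOn_eq, sub_zero, inv_one, one_smul, Complex.norm_real,
    Real.norm_eq_abs, sq_abs] at hsum
  have hz : fourierInt g 0 = 0 := by
    simp only [fourierInt, Nat.cast_zero, mul_zero, zero_mul, Complex.exp_zero, mul_one]
    rw [intervalIntegral.integral_ofReal, h0, ofReal_zero]
  set b : ℤ → ℝ := fun n => if n = 0 then 0 else B (n.natAbs - 1) with hb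
  have hb1 : HasSum (fun n : ℕ => b n) (∑' k, B k) := by
    rw [← hasSum_nat_add_iff' 1]
    have e : ∀ n : ℕ, b ((n + 1 : ℕ) : ℤ) = B n := by
      intro n
      have h1 : ((n + 1 : ℕ) : ℤ) ≠ 0 := by omega
      simp only [hb, if_neg h1, Int.natAbs_natCast, Nat.add_sub_cancel]
    have e0 : b 0 = 0 := by simp [hb]
    simp only [e, Finset.sum_range_one, Nat.cast_zero, e0, sub_zero]
    exact hs.hasSum
  have hb2 : HasSum (fun n : ℕ => b (-(n + 1 : ℤ))) (∑' k, B k) := by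
    convert hs.hasSum using 2 with n
    have h1 : (-(n + 1 : ℤ)) ≠ 0 := by omega
    have h2 : (-(n + 1 : ℤ)).natAbs - 1 = n := by omega
    simp only [hb, if_neg h1, h2]
  have hbs := HasSum.of_nat_of_neg_add_one hb1 hb2
  rw [two_mul]
  refine hasSum_le (fun n => ?_) hsum hbs
  by_cases hn : n = 0
  · simp [hn, hb, hz]
  · obtain ⟨k, hk⟩ : ∃ k, n.natAbs = k + 1 := ⟨n.natAbs - 1, by omega⟩
    simp only [hb, if_neg hn, hk, Nat.add_sub_cancel]
    exact hB k

/-- Distance to the nearest integer. -/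
def dn (x : ℝ) : ℝ := |x - round x|

lemma dn_nonneg (x : ℝ) : 0 ≤ dn x := abs_nonneg _

lemma dn_le_abs_sub (x : ℝ) (n : ℤ) : dn x ≤ |x - n| := round_le x n

lemma four_mul_dn_le (x : ℝ) : 4 * dn x ≤ ‖cexp (2 * π * x * I) - 1‖ := by
  set y := x - round x with hy
  have hyb : |y| ≤ 1 / 2 := abs_sub_round x
  have h1 : cexp (2 * π * x * I) = cexp (I * ((2 * π * y : ℝ) : ℂ)) := by
    rw [show (2 * π * x * I : ℂ) = I * ((2 * π * y : ℝ) : ℂ) + (round x : ℤ) * (2 * π * I) by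
      rw [hy]; push_cast; ring, Complex.exp_add, Complex.exp_int_mul_two_pi_mul_I, mul_one]
  rw [h1, Complex.norm_exp_I_mul_ofReal_sub_one, norm_mul, Real.norm_eq_abs, Real.norm_eq_abs,
    show 2 * π * y / 2 = π * y by ring]
  have h2 := Real.mul_abs_le_abs_sin (x := π * y) (by
    rw [abs_mul, abs_of_pos Real.pi_pos]; nlinarith [Real.pi_pos])
  rw [abs_mul, abs_of_pos Real.pi_pos] at h2
  have h3 : 2 / π * (π * |y|) = 2 * |y| := by field_simp
  rw [h3] at h2
  have : dn x = |y| := rfl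
  rw [this, abs_of_pos (by norm_num : (0:ℝ) < 2)]
  linarith

lemma norm_geom_avg_le {w : ℂ} (hw : ‖w‖ = 1) {d : ℝ} (hd : 4 * d ≤ ‖w - 1‖) {R : ℕ} (hR : 0 < R) :
    ‖(R : ℂ)⁻¹ * ∑ j ∈ Finset.range R, w ^ j‖ ≤ (max 1 (R * d))⁻¹ := by
  have hR' : (0:ℝ) < R := by exact_mod_cast hR
  have h1 : ‖∑ j ∈ Finset.range R, w ^ j‖ ≤ R := by
    refine (norm_sum_le _ _).trans ?_
    simp [norm_pow, hw]
  have h2 : ‖∑ j ∈ Finset.range R, w ^ j‖ * ‖w - 1‖ ≤ 2 := by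
    rw [← norm_mul, geom_sum_mul]
    refine (norm_sub_le _ _).trans ?_
    rw [norm_pow, hw]; norm_num
  have h0 := norm_nonneg (∑ j ∈ Finset.range R, w ^ j)
  rw [norm_mul, norm_inv, Complex.norm_natCast]
  have hM : 0 < max 1 (R * d) := lt_of_lt_of_le one_pos (le_max_left _ _)
  rw [inv_eq_one_div (max _ _), le_div_iff₀ hM, mul_assoc, inv_mul_le_iff₀ hR', mul_one]
  rcases le_total 1 ((R:ℝ) * d) with h | h
  · rw [max_eq_right h]
    nlinarith [mul_le_mul_of_nonneg_left hd h0]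
  · rw [max_eq_left h, mul_one]; exact h1

/-- Birkhoff average of `f` along a rotation by `r`. -/
def birkAvg (f : ℂ → ℝ) (r : ℝ) (R : ℕ) (x : ℝ) : ℝ :=
  (R : ℝ)⁻¹ * ∑ j ∈ Finset.range R, f ((x + j * r : ℝ) : ℂ)

/-- The small-divisor sum controlling the variance of Birkhoff averages of length `M`. -/
def cost (r M : ℝ) : ℝ :=
  ∑' k : ℕ, ((k : ℝ) + 1)⁻¹ ^ 2 * (max 1 (M * dn ((k + 1 : ℕ) * r)))⁻¹ ^ 2

lemma summable_inv_succ_sq : Summable (fun k : ℕ => ((k : ℝ) + 1)⁻¹ ^ 2) := by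
  have := (summable_nat_add_iff 1).2 (Real.summable_nat_pow_inv.2 (by norm_num : 1 < 2))
  simpa [inv_pow] using this

lemma inv_max_one_sq_le_one (x : ℝ) : (max 1 x)⁻¹ ^ 2 ≤ 1 :=
  pow_le_one₀ (by positivity) (inv_le_one_of_one_le₀ (le_max_left _ _))

lemma summable_cost (r M : ℝ) :
    Summable (fun k : ℕ => ((k : ℝ) + 1)⁻¹ ^ 2 * (max 1 (M * dn ((k + 1 : ℕ) * r)))⁻¹ ^ 2) :=
  Summable.of_nonneg_of_le (fun k => by positivity)
    (fun k => mul_le_of_le_one_right (by positivity) (inv_max_one_sq_le_one _))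
    summable_inv_succ_sq

lemma real_line_periodic {α : Type*} {u : ℂ → α} (hu : ∀ z, u (z + 1) = u z) :
    Function.Periodic (fun x : ℝ => u x) 1 := by
  intro x; simp [hu]

lemma continuous_birkAvg {f : ℂ → ℝ} (hf : Continuous f) (r : ℝ) (R : ℕ) :
    Continuous (birkAvg f r R) := by
  unfold birkAvg; fun_prop

lemma integral_birkAvg {f : ℂ → ℝ} (hf : Continuous f) (hp : ∀ z, f (z + 1) = f z) (r : ℝ) {R : ℕ}
    (hR : 0 < R) : ∫ x in (0:ℝ)..1, birkAvg f r R x = lineAvg f 0 := by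
  unfold birkAvg
  rw [intervalIntegral.integral_const_mul, intervalIntegral.integral_finsetSum
    (fun j _ => Continuous.intervalIntegrable (by fun_prop) _ _)]
  have h : ∀ j : ℕ, ∫ x in (0:ℝ)..1, f ((x + j * r : ℝ) : ℂ) = lineAvg f 0 := by
    intro j
    rw [integral_translate_eq (real_line_periodic hp)]
    simp [lineAvg]
  simp only [h, Finset.sum_const, Finset.card_range, nsmul_eq_mul]
  rw [← mul_assoc, inv_mul_cancel₀ (by positivity), one_mul]

/-- Variance bound for Birkhoff averages of a bounded sub-mean function. -/
theorem variance_birkAvg_le {η C : ℝ} (hη : 0 < η) {f : ℂ → ℝ} (hf : SubStrip (-η) η f)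
    (hC : ∀ z, |f z| ≤ C) (r : ℝ) {R : ℕ} (hR : 0 < R) :
    ∫ x in (0:ℝ)..1, (birkAvg f r R x - lineAvg f 0) ^ 2 ≤ 200 * C ^ 2 / η ^ 2 * cost r R := by
  have hc := hf.cont
  have hba := continuous_birkAvg hc r R
  have hR' : (0:ℝ) < R := by exact_mod_cast hR
  set g : ℝ → ℝ := fun x => birkAvg f r R x - lineAvg f 0 with hg
  have hgc : Continuous g := hba.sub continuous_const
  have h0 : ∫ x in (0:ℝ)..1, g x = 0 := by
    rw [hg, intervalIntegral.integral_sub (hba.intervalIntegrable _ _)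
      (continuous_const.intervalIntegrable _ _), integral_birkAvg hc hf.per r hR]
    simp
  have hexp0 : ∀ k : ℕ, ∫ x in (0:ℝ)..1, cexp (2 * π * (k + 1 : ℕ) * x * I) = 0 := by
    intro k
    have hne : (2 * π * (k + 1 : ℕ) * I : ℂ) ≠ 0 := by
      have : ((k + 1 : ℕ) : ℂ) ≠ 0 := Nat.cast_ne_zero.2 (by omega)
      simp [Real.pi_ne_zero, I_ne_zero]
      exact_mod_cast this
    have := integral_exp_mul_complex (a := 0) (b := 1) hne
    have e : ∀ x : ℝ, (2 * π * (k + 1 : ℕ) * x * I : ℂ) = 2 * π * (k + 1 : ℕ) * I * x := by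
      intro x; ring
    simp only [e]
    rw [this]
    have e2 : cexp (2 * π * (k + 1 : ℕ) * I * (1:ℝ)) = 1 := by
      rw [show (2 * π * (k + 1 : ℕ) * I * (1:ℝ) : ℂ) = (k + 1 : ℕ) * (2 * π * I) by push_cast; ring,
        Complex.exp_nat_mul_two_pi_mul_I]
    rw [e2]; simp
  have hco : ∀ k : ℕ, fourierInt g (k + 1) = ((R : ℂ)⁻¹ * ∑ j ∈ Finset.range R,
      cexp (-(2 * π * (((k + 1 : ℕ) * r : ℝ)) * I)) ^ j) * lineFourier f (k + 1) 0 := by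
    intro k
    set χ : ℝ → ℂ := fun x => cexp (2 * π * (k + 1 : ℕ) * x * I) with hχ
    have hχc : Continuous χ := by rw [hχ]; fun_prop
    have e1 : fourierInt g (k + 1) = ∫ x in (0:ℝ)..1, (((R : ℂ)⁻¹ * ∑ j ∈ Finset.range R,
        (f ((x + j * r : ℝ) : ℂ) : ℂ) * χ x) - lineAvg f 0 * χ x) := by
      simp only [fourierInt, hg, birkAvg]
      congr 1; ext x
      push_cast
      rw [sub_mul, mul_assoc, Finset.sum_mul, hχ]
      push_cast
      rfl
    rw [e1, intervalIntegral.integral_sub (Continuous.intervalIntegrable (by fun_prop) _ _)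
      (Continuous.intervalIntegrable (by fun_prop) _ _), intervalIntegral.integral_const_mul,
      intervalIntegral.integral_const_mul, hexp0, mul_zero, sub_zero,
      intervalIntegral.integral_finsetSum
        (fun j _ => Continuous.intervalIntegrable (by fun_prop) _ _), mul_assoc, Finset.sum_mul]
    congr 1
    refine Finset.sum_congr rfl fun j _ => ?_
    have hz := lineFourier_eq hf.per (k + 1) ((j * r : ℝ) : ℂ)
    simp only [ofReal_re, ofReal_im] at hz
    rw [← Complex.exp_nat_mul, show (j : ℂ) * -(2 * π * (((k + 1 : ℕ) * r : ℝ)) * I) =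
      -(2 * π * (k + 1 : ℕ) * ((j * r : ℝ) : ℂ) * I) by push_cast; ring, ← hz]
    congr 1; ext x
    simp only [hχ]
    congr 3
    push_cast; ring
  have hB : ∀ k : ℕ, ‖fourierInt g (k + 1)‖ ^ 2 ≤ 100 * C ^ 2 / η ^ 2 *
      (((k : ℝ) + 1)⁻¹ ^ 2 * (max 1 (R * dn ((k + 1 : ℕ) * r)))⁻¹ ^ 2) := by
    intro k
    rw [hco, norm_mul]
    have h1 := norm_geom_avg_le (w := cexp (-(2 * π * (((k + 1 : ℕ) * r : ℝ)) * I)))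
      (d := dn ((k + 1 : ℕ) * r)) (by
        rw [Complex.norm_exp]; simp) (by
        have h := four_mul_dn_le ((k + 1 : ℕ) * r)
        refine h.trans (le_of_eq ?_)
        rw [← RCLike.norm_conj, map_sub, ← Complex.exp_conj, map_one]
        have h2c : (starRingEnd ℂ) 2 = 2 := Complex.conj_ofNat 2
        congr 3
        simp [h2c]) hR
    have h2 := hf.lineFourier_decay hη hC (k := k + 1) (Nat.succ_pos k)
    have h3 := mul_le_mul h1 h2 (norm_nonneg _) (by positivity)
    have h4 := pow_le_pow_left₀ (by positivity) h3 2
    refine h4.trans (le_of_eq ?_)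
    have hk : ((k:ℝ) + 1) ≠ 0 := by positivity
    push_cast
    field_simp
    ring
  have := integral_sq_le_of_fourierInt hgc h0 hB ((summable_cost r R).mul_left _)
  rw [tsum_mul_left] at this
  refine this.trans (le_of_eq ?_)
  rw [cost]; ring

/-- `2 × 2` complex matrices. -/
abbrev M2 := Matrix (Fin 2) (Fin 2) ℂ

lemma frob_sq (A : M2) : ‖A‖ ^ 2 =
    ‖A 0 0‖ ^ 2 + ‖A 0 1‖ ^ 2 + ‖A 1 0‖ ^ 2 + ‖A 1 1‖ ^ 2 := by
  rw [Matrix.frobenius_norm_def, ← Real.sqrt_eq_rpow, Real.sq_sqrt (by positivity)]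
  simp [Fin.sum_univ_two]; ring

lemma frob_mul_le (A B : M2) : ‖A * B‖ ≤ ‖A‖ * ‖B‖ := Matrix.frobenius_norm_mul A B

lemma norm_entry_le (A : M2) (i j : Fin 2) : ‖A i j‖ ≤ ‖A‖ := by
  refine le_of_sq_le_sq ?_ (norm_nonneg _)
  rw [frob_sq]
  have := sq_nonneg ‖A 0 0‖; have := sq_nonneg ‖A 0 1‖
  have := sq_nonneg ‖A 1 0‖; have := sq_nonneg ‖A 1 1‖
  fin_cases i <;> fin_cases j <;> simp <;> linarith

lemma two_mul_norm_det_le (A : M2) : 2 * ‖A.det‖ ≤ ‖A‖ ^ 2 := by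
  rw [Matrix.det_fin_two, frob_sq]
  have h := norm_sub_le (A 0 0 * A 1 1) (A 0 1 * A 1 0)
  rw [norm_mul, norm_mul] at h
  nlinarith [sq_nonneg (‖A 0 0‖ - ‖A 1 1‖), sq_nonneg (‖A 0 1‖ - ‖A 1 0‖)]

lemma frob_adjugate (A : M2) : ‖A.adjugate‖ = ‖A‖ := by
  have h : ‖A.adjugate‖ ^ 2 = ‖A‖ ^ 2 := by
    rw [frob_sq, frob_sq, Matrix.adjugate_fin_two]; simp; ring
  nlinarith [norm_nonneg A, norm_nonneg A.adjugate, sq_nonneg (‖A‖ - ‖A.adjugate‖)]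

lemma norm_det_mul_le (A B : M2) : ‖A.det‖ * ‖B‖ ≤ ‖A‖ * ‖A * B‖ := by
  have h : A.adjugate * (A * B) = A.det • B := by
    rw [← Matrix.mul_assoc, Matrix.adjugate_mul, Matrix.smul_mul, Matrix.one_mul]
  calc ‖A.det‖ * ‖B‖ = ‖A.adjugate * (A * B)‖ := by rw [h, norm_smul]
    _ ≤ _ := by rw [← frob_adjugate A]; exact frob_mul_le _ _

lemma norm_det_mul_le' (A B : M2) : ‖A.det‖ * ‖B‖ ≤ ‖A‖ * ‖B * A‖ := by
  have h : (B * A) * A.adjugate = A.det • B := by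
    rw [Matrix.mul_assoc, Matrix.mul_adjugate, Matrix.mul_smul, Matrix.mul_one]
  calc ‖A.det‖ * ‖B‖ = ‖(B * A) * A.adjugate‖ := by rw [h, norm_smul]
    _ ≤ ‖B * A‖ * ‖A.adjugate‖ := frob_mul_le _ _
    _ = _ := by rw [frob_adjugate, mul_comm]

/-- Continuous periodic functions, holomorphic in the strip `|Im z| < η`. -/
structure HolS (η : ℝ) (g : ℂ → ℂ) : Prop where
  cont : Continuous g
  per : ∀ z, g (z + 1) = g z
  diff : DifferentiableOn ℂ g {z | |z.im| < η}

lemma HolS.mul {η : ℝ} {f g : ℂ → ℂ} (hf : HolS η f) (hg : HolS η g) :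
    HolS η (fun z => f z * g z) :=
  ⟨hf.cont.mul hg.cont, fun z => by rw [hf.per, hg.per], hf.diff.mul hg.diff⟩

lemma HolS.add {η : ℝ} {f g : ℂ → ℂ} (hf : HolS η f) (hg : HolS η g) :
    HolS η (fun z => f z + g z) :=
  ⟨hf.cont.add hg.cont, fun z => by rw [hf.per, hg.per], hf.diff.add hg.diff⟩

lemma HolS.sub {η : ℝ} {f g : ℂ → ℂ} (hf : HolS η f) (hg : HolS η g) :
    HolS η (fun z => f z - g z) :=
  ⟨hf.cont.sub hg.cont, fun z => by rw [hf.per, hg.per], hf.diff.sub hg.diff⟩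

lemma holS_const (η : ℝ) (c : ℂ) : HolS η (fun _ => c) :=
  ⟨continuous_const, fun _ => rfl, differentiableOn_const _⟩

lemma HolS.translate {η : ℝ} {f : ℂ → ℂ} (hf : HolS η f) (r : ℝ) :
    HolS η (fun z => f (z + r)) := by
  refine ⟨hf.cont.comp (by fun_prop), fun z => ?_, ?_⟩
  · rw [show z + 1 + r = z + r + 1 by ring, hf.per]
  · refine hf.diff.comp (by fun_prop) ?_
    intro z hz
    simpa using hz

lemma HolS.congr {η : ℝ} {f g : ℂ → ℂ} (hf : HolS η f) (h : ∀ z, g z = f z) : HolS η g := by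
  rw [show g = f from funext h]; exact hf

/-- Matrix-valued version of `HolS`. -/
def Hol (η : ℝ) (A : ℂ → M2) : Prop := ∀ i j, HolS η (fun z => A z i j)

lemma Hol.mul {η : ℝ} {A B : ℂ → M2} (hA : Hol η A) (hB : Hol η B) :
    Hol η (fun z => A z * B z) := by
  intro i j
  refine (((hA i 0).mul (hB 0 j)).add ((hA i 1).mul (hB 1 j))).congr fun z => ?_
  simp [Matrix.mul_apply, Fin.sum_univ_two]

lemma Hol.translate {η : ℝ} {A : ℂ → M2} (hA : Hol η A) (r : ℝ) :
    Hol η (fun z => A (z + r)) := fun i j => (hA i j).translate r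

lemma Hol.det {η : ℝ} {A : ℂ → M2} (hA : Hol η A) : HolS η (fun z => (A z).det) :=
  (((hA 0 0).mul (hA 1 1)).sub ((hA 0 1).mul (hA 1 0))).congr fun _ => Matrix.det_fin_two _

lemma Hol.per {η : ℝ} {A : ℂ → M2} (hA : Hol η A) (z : ℂ) : A (z + 1) = A z := by
  ext i j; exact (hA i j).per z

lemma Hol.continuous_norm {η : ℝ} {A : ℂ → M2} (hA : Hol η A) : Continuous (fun z => ‖A z‖) := by
  have h : (fun z => ‖A z‖) = fun z => Real.sqrt (‖A z 0 0‖ ^ 2 + ‖A z 0 1‖ ^ 2 +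
      ‖A z 1 0‖ ^ 2 + ‖A z 1 1‖ ^ 2) := by
    ext z; rw [← frob_sq, Real.sqrt_sq (norm_nonneg _)]
  rw [h]
  have h00 := (hA 0 0).cont; have h01 := (hA 0 1).cont
  have h10 := (hA 1 0).cont; have h11 := (hA 1 1).cont
  fun_prop

lemma log_norm_le_circleAverage {g : ℂ → ℂ} {z : ℂ} {ρ : ℝ} (hρ : 0 < ρ)
    (hg : AnalyticOnNhd ℂ g (Metric.closedBall z |ρ|)) (h0 : g z ≠ 0) :
    Real.log ‖g z‖ ≤ Real.circleAverage (fun w => Real.log ‖g w‖) z ρ := by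
  rw [hg.circleAverage_log_norm hρ.ne' h0]
  refine le_add_of_nonneg_left (finsum_nonneg fun w => ?_)
  by_cases hw : w ∈ Metric.closedBall z |ρ|
  · have hd := MeromorphicOn.AnalyticOnNhd.divisor_nonneg hg w
    refine mul_nonneg (by exact_mod_cast hd) ?_
    by_cases hzw : ‖z - w‖ = 0
    · simp [hzw]
    · refine Real.log_nonneg ?_
      rw [← div_eq_mul_inv, one_le_div (lt_of_le_of_ne (norm_nonneg _) (Ne.symm hzw))]
      rw [Metric.mem_closedBall, dist_comm, dist_eq_norm, abs_of_pos hρ] at hw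
      exact hw
  · rw [Function.locallyFinsuppWithin.apply_eq_zero_of_notMem _ hw]; simp

lemma log_max_eq {x c : ℝ} (hx : 0 ≤ x) (hc : 0 < c) :
    Real.log (max x c) = Real.log c + max 0 (Real.log (x / c)) := by
  rcases le_or_gt x c with h | h
  · rw [max_eq_right h, max_eq_left, add_zero]
    exact Real.log_nonpos (by positivity) ((div_le_one hc).2 h)
  · have hx' : 0 < x := hc.trans h
    rw [max_eq_left h.le, max_eq_right, Real.log_div hx'.ne' hc.ne']
    · ring
    · exact Real.log_nonneg ((one_le_div hc).2 h.le)

lemma log_max_norm_le_circleAverage {g : ℂ → ℂ} (hgc : Continuous g) {z : ℂ} {ρ : ℝ} (hρ : 0 < ρ)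
    (hg : AnalyticOnNhd ℂ g (Metric.closedBall z |ρ|)) {c : ℝ} (hc : 0 < c) :
    Real.log (max ‖g z‖ c) ≤ Real.circleAverage (fun w => Real.log (max ‖g w‖ c)) z ρ := by
  have hcont : Continuous (fun w => Real.log (max ‖g w‖ c)) :=
    Continuous.log (by fun_prop) (fun w => (lt_of_lt_of_le hc (le_max_right _ _)).ne')
  have hint := hcont.circleIntegrable_of_real z ρ
  rcases le_or_gt ‖g z‖ c with h | h
  · rw [max_eq_right h]
    have h1 := Real.circleAverage_mono (c := z) (R := ρ) (f₁ := fun _ => Real.log c)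
      (circleIntegrable_const _ _ _) hint
      (fun w _ => Real.log_le_log hc (le_max_right _ _))
    rwa [Real.circleAverage_const] at h1
  · rw [max_eq_left h.le]
    set G : ℂ → ℂ := fun w => g w / c with hG
    have hGa : AnalyticOnNhd ℂ G (Metric.closedBall z |ρ|) := fun w hw => (hg w hw).div_const
    have hgz : g z ≠ 0 := fun h0 => by rw [h0, norm_zero] at h; linarith
    have hcc : (c : ℂ) ≠ 0 := by exact_mod_cast hc.ne'
    have h1 := log_norm_le_circleAverage hρ hGa (by simp [hG, hgz, hcc])
    have hGn : ∀ w, ‖G w‖ = ‖g w‖ / c := fun w => by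
      simp [hG, abs_of_pos hc]
    have hGi : CircleIntegrable (fun w => Real.log ‖G w‖) z ρ :=
      MeromorphicOn.circleIntegrable_log_norm
        (fun w hw => (hGa w (Metric.sphere_subset_closedBall hw)).meromorphicAt)
    have h2 : Real.circleAverage (fun w => Real.log ‖G w‖) z ρ ≤
        Real.circleAverage (fun w => Real.log (max ‖g w‖ c) - Real.log c) z ρ := by
      refine Real.circleAverage_mono hGi (hint.sub (circleIntegrable_const _ _ _)) fun w _ => ?_
      rw [log_max_eq (norm_nonneg _) hc, hGn]
      have := le_max_right 0 (Real.log (‖g w‖ / c))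
      linarith
    rw [Real.circleAverage_fun_sub hint (circleIntegrable_const _ _ _),
      Real.circleAverage_const] at h2
    have h3 := h1.trans h2
    rw [hGn, Real.log_div (norm_ne_zero_iff.2 hgz) hc.ne'] at h3
    linarith

lemma HolS.analyticOnNhd {η : ℝ} {g : ℂ → ℂ} (hg : HolS η g) {z : ℂ} {ρ : ℝ} (hρ : 0 < ρ)
    (h1 : -η < z.im - ρ) (h2 : z.im + ρ < η) : AnalyticOnNhd ℂ g (Metric.closedBall z |ρ|) := by
  have ho : IsOpen {w : ℂ | |w.im| < η} :=
    isOpen_lt (continuous_abs.comp Complex.continuous_im) continuous_const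
  have ha := hg.diff.analyticOnNhd ho
  intro w hw
  refine ha w ?_
  rw [Metric.mem_closedBall, dist_eq_norm, abs_of_pos hρ] at hw
  have := (Complex.abs_im_le_norm (w - z)).trans hw
  rw [sub_im] at this
  obtain ⟨h3, h4⟩ := abs_le.1 this
  have h5 : |w.im| < η := abs_lt.2 ⟨by linarith, by linarith⟩
  exact h5

lemma HolS.subStrip_log_max {η η' : ℝ} (h : η' < η) {g : ℂ → ℂ} (hg : HolS η g) {c : ℝ}
    (hc : 0 < c) : SubStrip (-η') η' (fun z => Real.log (max ‖g z‖ c)) where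
  cont := Continuous.log (hg.cont.norm.max continuous_const)
    (fun w => (lt_of_lt_of_le hc (le_max_right _ _)).ne')
  per z := by rw [hg.per]
  sub z ρ h1 h2 h3 := log_max_norm_le_circleAverage hg.cont h1
    (hg.analyticOnNhd h1 (by linarith) (by linarith)) hc

lemma norm_inner_entries_le (A B : M2) :
    ‖A 0 0 * B 0 0 + A 0 1 * B 0 1 + A 1 0 * B 1 0 + A 1 1 * B 1 1‖ ≤ ‖A‖ * ‖B‖ := by
  refine le_of_sq_le_sq ?_ (by positivity)
  rw [mul_pow, frob_sq, frob_sq]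
  have h1 : ‖A 0 0 * B 0 0 + A 0 1 * B 0 1 + A 1 0 * B 1 0 + A 1 1 * B 1 1‖ ≤
      ‖A 0 0‖ * ‖B 0 0‖ + ‖A 0 1‖ * ‖B 0 1‖ + ‖A 1 0‖ * ‖B 1 0‖ + ‖A 1 1‖ * ‖B 1 1‖ := by
    simp only [← norm_mul]
    exact (norm_add_le _ _).trans (add_le_add ((norm_add_le _ _).trans
      (add_le_add (norm_add_le _ _) le_rfl)) le_rfl)
  refine (pow_le_pow_left₀ (norm_nonneg _) h1 2).trans ?_
  generalize ‖A 0 0‖ = a; generalize ‖A 0 1‖ = b; generalize ‖A 1 0‖ = c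
  generalize ‖A 1 1‖ = d; generalize ‖B 0 0‖ = p; generalize ‖B 0 1‖ = q
  generalize ‖B 1 0‖ = r; generalize ‖B 1 1‖ = s
  nlinarith [sq_nonneg (a * q - b * p), sq_nonneg (a * r - c * p), sq_nonneg (a * s - d * p),
    sq_nonneg (b * r - c * q), sq_nonneg (b * s - d * q), sq_nonneg (c * s - d * r)]

lemma Hol.subStrip_log_max {η η' : ℝ} (h : η' < η) {A : ℂ → M2} (hA : Hol η A) {c : ℝ}
    (hc : 0 < c) : SubStrip (-η') η' (fun z => Real.log (max ‖A z‖ c)) where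
  cont := Continuous.log (hA.continuous_norm.max continuous_const)
    (fun w => (lt_of_lt_of_le hc (le_max_right _ _)).ne')
  per z := by rw [hA.per]
  sub z ρ h1 h2 h3 := by
    have hcont : Continuous (fun w => Real.log (max ‖A w‖ c)) :=
      Continuous.log (hA.continuous_norm.max continuous_const)
        (fun w => (lt_of_lt_of_le hc (le_max_right _ _)).ne')
    set B : M2 := fun i j => (starRingEnd ℂ) (A z i j) / ‖A z‖ with hB
    set g : ℂ → ℂ := fun w => B 0 0 * A w 0 0 + B 0 1 * A w 0 1 + B 1 0 * A w 1 0 +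
      B 1 1 * A w 1 1 with hg
    have hgH : HolS η g := (((((holS_const η (B 0 0)).mul (hA 0 0)).add
      ((holS_const η (B 0 1)).mul (hA 0 1))).add ((holS_const η (B 1 0)).mul (hA 1 0))).add
      ((holS_const η (B 1 1)).mul (hA 1 1)))
    have hBn : ‖B‖ ≤ 1 := by
      refine le_of_sq_le_sq ?_ (by norm_num)
      rw [frob_sq]
      simp only [hB, norm_div, RCLike.norm_conj, norm_real, norm_norm, div_pow, ← add_div]
      rw [← frob_sq, one_pow]
      exact div_self_le_one _
    have hgz : ‖g z‖ = ‖A z‖ := by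
      by_cases h0 : ‖A z‖ = 0
      · have : ∀ i j, A z i j = 0 := fun i j =>
          norm_le_zero_iff.1 ((norm_entry_le (A z) i j).trans h0.le)
        simp [hg, this, h0]
      · have : g z = (‖A z‖ : ℂ) := by
          have hne : (‖A z‖ : ℂ) ≠ 0 := by exact_mod_cast h0
          have e : ∀ i j, B i j * A z i j = ((‖A z i j‖ ^ 2 : ℝ) : ℂ) / ‖A z‖ := by
            intro i j
            simp only [hB]
            rw [div_mul_eq_mul_div, mul_comm, Complex.mul_conj, Complex.normSq_eq_norm_sq]
          simp only [hg, e, ← add_div, ← ofReal_add, ← frob_sq]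
          rw [ofReal_pow]; field_simp
        rw [this, norm_real, norm_norm]
    have hgle : ∀ w, ‖g w‖ ≤ ‖A w‖ := fun w =>
      (norm_inner_entries_le B (A w)).trans (mul_le_of_le_one_left (norm_nonneg _) hBn)
    have key := (hgH.subStrip_log_max h hc).sub z ρ h1 h2 h3
    simp only [hgz] at key
    refine key.trans (Real.circleAverage_mono
      ((hgH.subStrip_log_max h hc).cont.circleIntegrable_of_real z ρ)
      (hcont.circleIntegrable_of_real z ρ) fun w _ => ?_)
    exact Real.log_le_log (lt_of_lt_of_le hc (le_max_right _ _)) (max_le_max_right _ (hgle w))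

/-- Complexified cocycle iterates. -/
def cIter (E : ℂ → M2) (r : ℝ) : ℕ → ℂ → M2
  | 0, _ => 1
  | n + 1, z => cIter E r n (z + r) * E z

lemma cIter_succ (E : ℂ → M2) (r : ℝ) (n : ℕ) (z : ℂ) :
    cIter E r (n + 1) z = cIter E r n (z + r) * E z := rfl

lemma cIter_one (E : ℂ → M2) (r : ℝ) (z : ℂ) : cIter E r 1 z = E z := by
  simp [cIter]

lemma cIter_add (E : ℂ → M2) (r : ℝ) (m n : ℕ) (z : ℂ) :
    cIter E r (m + n) z = cIter E r m (z + n * r) * cIter E r n z := by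
  induction n generalizing z with
  | zero => simp [cIter]
  | succ n ih =>
    rw [← Nat.add_assoc, cIter_succ, ih, cIter_succ, Matrix.mul_assoc]
    congr 2; push_cast; ring

lemma cocycleIter_eq_cIter (E : ℂ → M2) (r ε : ℝ) (n : ℕ) (x : ℝ) :
    cocycleIter (fun x : ℝ => E (x + ε * I)) r n x = cIter E r n (x + ε * I) := by
  induction n generalizing x with
  | zero => rfl
  | succ n ih =>
    rw [cocycleIter, ih, cIter_succ]
    congr 2; push_cast; ring

lemma hol_one (η : ℝ) : Hol η (fun _ => (1 : M2)) := fun _ _ => holS_const _ _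

lemma Hol.cIter {η : ℝ} {E : ℂ → M2} (hE : Hol η E) (r : ℝ) (n : ℕ) : Hol η (cIter E r n) := by
  induction n with
  | zero => exact hol_one η
  | succ n ih => exact (ih.translate r).mul hE

lemma norm_cIter_le {E : ℂ → M2} {Λ : ℝ} (hE : ∀ z, ‖E z‖ ≤ Real.exp Λ) (r : ℝ) (n : ℕ) (z : ℂ) :
    ‖cIter E r (n + 1) z‖ ≤ Real.exp (Λ * (n + 1 : ℕ)) := by
  induction n generalizing z with
  | zero => simpa [cIter_one] using hE z
  | succ n ih =>
    rw [cIter_succ]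
    refine (frob_mul_le _ _).trans ((mul_le_mul (ih _) (hE z) (norm_nonneg _)
      (Real.exp_pos _).le).trans (le_of_eq ?_))
    rw [← Real.exp_add]; push_cast; ring_nf

lemma HolS.lipschitz {η M : ℝ} (hη : 0 < η) {g : ℂ → ℂ} (hg : HolS η g) (hM : ∀ z, ‖g z‖ ≤ M)
    (x y : ℝ) : ‖g x - g y‖ ≤ 2 * M / η * |x - y| := by
  have ho : IsOpen {w : ℂ | |w.im| < η} :=
    isOpen_lt (continuous_abs.comp Complex.continuous_im) continuous_const
  have hs : Convex ℝ {w : ℂ | w.im = 0} := by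
    intro a ha b hb s t _ _ _
    simp only [Set.mem_ofPred_eq] at ha hb ⊢
    simp [ha, hb]
  have key := hs.norm_image_sub_le_of_norm_deriv_le (f := g) (C := 2 * M / η)
    (x := (y : ℂ)) (y := (x : ℂ)) (fun w hw => ?_) (fun w hw => ?_) (by simp) (by simp)
  · rw [← ofReal_sub, norm_real] at key
    exact key
  · refine hg.diff.differentiableAt (ho.mem_nhds ?_)
    simp only [Set.mem_ofPred_eq] at hw ⊢
    simpa [hw] using hη
  · have h := Complex.norm_deriv_le_of_forall_mem_sphere_norm_le (c := w) (R := η / 2) (f := g)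
      (C := M) (by positivity) ?_ (fun z _ => hM z)
    · refine h.trans (le_of_eq ?_); field_simp
    · refine (hg.diff.mono ?_).diffContOnCl
      intro z hz
      have := closure_minimal Metric.ball_subset_closedBall Metric.isClosed_closedBall hz
      rw [Metric.mem_closedBall, dist_eq_norm] at this
      have h2 := (Complex.abs_im_le_norm (z - w)).trans this
      simp only [Set.mem_ofPred_eq] at hw
      rw [sub_im, hw, sub_zero] at h2
      simp only [Set.mem_ofPred_eq]
      linarith

lemma Hol.lipschitz {η M : ℝ} (hη : 0 < η) {A : ℂ → M2} (hA : Hol η A) (hM : ∀ z, ‖A z‖ ≤ M)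
    (x y : ℝ) : ‖A x - A y‖ ≤ 4 * M / η * |x - y| := by
  have hM0 : 0 ≤ M := (norm_nonneg _).trans (hM 0)
  have h : ∀ i j, ‖(A x - A y) i j‖ ≤ 2 * M / η * |x - y| := fun i j =>
    (hA i j).lipschitz hη (fun z => (norm_entry_le _ _ _).trans (hM z)) x y
  refine le_of_sq_le_sq ?_ (by positivity)
  rw [frob_sq, show 4 * M / η * |x - y| = 2 * (2 * M / η * |x - y|) by ring]
  have h2 := fun i j => pow_le_pow_left₀ (norm_nonneg _) (h i j) 2
  linarith [h2 0 0, h2 0 1, h2 1 0, h2 1 1]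

lemma abs_log_sub_log_le {a b m : ℝ} (hm : 0 < m) (ha : m ≤ a) (hb : m ≤ b) :
    |Real.log a - Real.log b| ≤ |a - b| / m := by
  have key : ∀ a b : ℝ, m ≤ a → m ≤ b → Real.log a - Real.log b ≤ |a - b| / m := by
    intro a b ha hb
    have ha0 := hm.trans_le ha
    have hb0 := hm.trans_le hb
    rw [← Real.log_div ha0.ne' hb0.ne']
    refine (Real.log_le_sub_one_of_pos (by positivity)).trans ?_
    calc a / b - 1 = (a - b) / b := by field_simp
      _ ≤ |a - b| / b := by gcongr; exact le_abs_self _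
      _ ≤ |a - b| / m := by gcongr
  rw [abs_le]
  have h1 := key a b ha hb
  have h2 := key b a hb ha
  rw [abs_sub_comm] at h2
  constructor <;> linarith

/-- Cocycle maps on a strip with two-sided bounds. -/
structure Win (η Λ : ℝ) (E : ℂ → M2) : Prop where
  hol : Hol η E
  up : ∀ z, ‖E z‖ ≤ Real.exp Λ
  low : ∀ z, Real.exp (-(2 * Λ)) ≤ ‖(E z).det‖

/-- `log ‖A_N‖`. -/
def logN (E : ℂ → M2) (r : ℝ) (N : ℕ) (z : ℂ) : ℝ := Real.log ‖cIter E r N z‖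

/-- `log |det A_N|`. -/
def logDet (E : ℂ → M2) (r : ℝ) (N : ℕ) (z : ℂ) : ℝ := Real.log ‖(cIter E r N z).det‖

namespace Win

variable {η Λ : ℝ} {E : ℂ → M2}

lemma low_det (hE : Win η Λ E) (r : ℝ) (N : ℕ) (z : ℂ) :
    Real.exp (-(2 * Λ * N)) ≤ ‖(cIter E r N z).det‖ := by
  induction N generalizing z with
  | zero => simp [cIter]
  | succ n ih =>
    rw [cIter_succ, Matrix.det_mul, norm_mul]
    refine le_trans (le_of_eq ?_) (mul_le_mul (ih (z + r)) (hE.low z) (Real.exp_pos _).le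
      (norm_nonneg _))
    rw [← Real.exp_add]; push_cast; ring_nf

lemma low_norm (hE : Win η Λ E) (r : ℝ) (N : ℕ) (z : ℂ) :
    Real.exp (-(Λ * N)) ≤ ‖cIter E r N z‖ := by
  refine le_of_sq_le_sq ?_ (norm_nonneg _)
  have h1 := hE.low_det r N z
  have h2 := two_mul_norm_det_le (cIter E r N z)
  rw [← Real.exp_nat_mul]
  have h3 : Real.exp ((2:ℕ) * -(Λ * N)) = Real.exp (-(2 * Λ * N)) := by congr 1; push_cast; ring
  rw [h3]
  linarith [norm_nonneg (cIter E r N z).det]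

lemma up_norm (hE : Win η Λ E) (r : ℝ) {N : ℕ} (hN : 0 < N) (z : ℂ) :
    ‖cIter E r N z‖ ≤ Real.exp (Λ * N) := by
  obtain ⟨n, rfl⟩ := Nat.exists_eq_succ_of_ne_zero hN.ne'
  exact norm_cIter_le hE.up r n z

lemma up_det (hE : Win η Λ E) (r : ℝ) {N : ℕ} (hN : 0 < N) (z : ℂ) :
    ‖(cIter E r N z).det‖ ≤ Real.exp (2 * Λ * N) := by
  have h1 := hE.up_norm r hN z
  have h2 := two_mul_norm_det_le (cIter E r N z)
  have h3 := pow_le_pow_left₀ (norm_nonneg _) h1 2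
  rw [← Real.exp_nat_mul, show ((2:ℕ) * (Λ * N) : ℝ) = 2 * Λ * N by push_cast; ring] at h3
  linarith [norm_nonneg (cIter E r N z).det]

lemma norm_pos (hE : Win η Λ E) (r : ℝ) (N : ℕ) (z : ℂ) : 0 < ‖cIter E r N z‖ :=
  (Real.exp_pos _).trans_le (hE.low_norm r N z)

lemma det_pos (hE : Win η Λ E) (r : ℝ) (N : ℕ) (z : ℂ) : 0 < ‖(cIter E r N z).det‖ :=
  (Real.exp_pos _).trans_le (hE.low_det r N z)

lemma abs_logN_le (hE : Win η Λ E) (r : ℝ) {N : ℕ} (hN : 0 < N) (z : ℂ) :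
    |logN E r N z| ≤ Λ * N := by
  have h1 := Real.log_le_log (Real.exp_pos _) (hE.low_norm r N z)
  have h2 := Real.log_le_log (hE.norm_pos r N z) (hE.up_norm r hN z)
  rw [Real.log_exp] at h1 h2
  exact abs_le.2 ⟨h1, h2⟩

lemma abs_logDet_le (hE : Win η Λ E) (r : ℝ) {N : ℕ} (hN : 0 < N) (z : ℂ) :
    |logDet E r N z| ≤ 2 * Λ * N := by
  have h1 := Real.log_le_log (Real.exp_pos _) (hE.low_det r N z)
  have h2 := Real.log_le_log (hE.det_pos r N z) (hE.up_det r hN z)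
  rw [Real.log_exp] at h1 h2
  exact abs_le.2 ⟨h1, h2⟩

lemma logDet_shift (hE : Win η Λ E) (r : ℝ) (N : ℕ) (z : ℂ) :
    |logDet E r N (z + r) - logDet E r N z| ≤ 4 * Λ := by
  have h : cIter E r N (z + r) * E z = E (z + N * r) * cIter E r N z := by
    rw [← cIter_succ, Nat.add_comm N 1, cIter_add, cIter_one]
  have h1 := congrArg (fun A : M2 => Real.log ‖A.det‖) h
  have hp : ∀ w, 0 < ‖(E w).det‖ := fun w => (Real.exp_pos _).trans_le (hE.low w)
  simp only [Matrix.det_mul, norm_mul] at h1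
  rw [Real.log_mul (hE.det_pos r N _).ne' (hp z).ne', Real.log_mul (hp _).ne'
    (hE.det_pos r N _).ne'] at h1
  have h2 := fun w => hE.abs_logDet_le r (N := 1) one_pos w
  simp only [logDet, cIter_one] at h2
  have h3 := abs_le.1 (h2 z)
  have h4 := abs_le.1 (h2 (z + N * r))
  push_cast at h3 h4
  unfold logDet
  rw [abs_le]
  constructor <;> linarith [h3.1, h3.2, h4.1, h4.2]

lemma logN_shift (hE : Win η Λ E) (r : ℝ) (N : ℕ) (z : ℂ) :
    |logN E r N (z + r) - logN E r N z| ≤ 4 * Λ := by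
  have h : cIter E r N (z + r) * E z = E (z + N * r) * cIter E r N z := by
    rw [← cIter_succ, Nat.add_comm N 1, cIter_add, cIter_one]
  have hp : ∀ w, 0 < ‖(E w).det‖ := fun w => (Real.exp_pos _).trans_le (hE.low w)
  have hn : ∀ w, 0 < ‖E w‖ := fun w => by simpa [cIter_one] using hE.norm_pos r 1 w
  have lup : ∀ w, Real.log ‖E w‖ ≤ Λ := fun w => by
    simpa using Real.log_le_log (hn w) (hE.up w)
  have llow : ∀ w, -(2 * Λ) ≤ Real.log ‖(E w).det‖ := fun w => by
    simpa using Real.log_le_log (Real.exp_pos _) (hE.low w)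
  have a1 := frob_mul_le (E (z + N * r)) (cIter E r N z)
  have a2 := norm_det_mul_le' (E z) (cIter E r N (z + r))
  have a3 := norm_det_mul_le (E (z + N * r)) (cIter E r N z)
  have a4 := frob_mul_le (cIter E r N (z + r)) (E z)
  have p0 : 0 < ‖cIter E r N (z + r) * E z‖ := by
    rw [← cIter_succ]; exact hE.norm_pos r _ _
  have pz := hE.norm_pos r N z
  have pz' := hE.norm_pos r N (z + r)
  rw [← h] at a1 a3
  have b1 := Real.log_le_log p0 a1
  have b2 := Real.log_le_log (mul_pos (hp z) pz') a2
  have b3 := Real.log_le_log (mul_pos (hp _) pz) a3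
  have b4 := Real.log_le_log p0 a4
  rw [Real.log_mul (hn _).ne' pz.ne'] at b1
  rw [Real.log_mul (hp _).ne' pz'.ne', Real.log_mul (hn _).ne' p0.ne'] at b2
  rw [Real.log_mul (hp _).ne' pz.ne', Real.log_mul (hn _).ne' p0.ne'] at b3
  rw [Real.log_mul pz'.ne' (hn _).ne'] at b4
  unfold logN
  rw [abs_le]
  constructor <;> linarith [lup z, lup (z + N * r), llow z, llow (z + N * r)]

lemma subStrip_logN (hE : Win η Λ E) (r : ℝ) (N : ℕ) {η' : ℝ} (h : η' < η) :
    SubStrip (-η') η' (logN E r N) := by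
  have := (hE.hol.cIter r N).subStrip_log_max h (Real.exp_pos (-(Λ * N)))
  have e : (fun z => Real.log (max ‖cIter E r N z‖ (Real.exp (-(Λ * N))))) = logN E r N := by
    ext z; rw [max_eq_left (hE.low_norm r N z)]; rfl
  rwa [e] at this

lemma subStrip_logDet (hE : Win η Λ E) (r : ℝ) (N : ℕ) {η' : ℝ} (h : η' < η) :
    SubStrip (-η') η' (logDet E r N) := by
  have := (hE.hol.cIter r N).det.subStrip_log_max h (Real.exp_pos (-(2 * Λ * N)))
  have e : (fun z => Real.log (max ‖(cIter E r N z).det‖ (Real.exp (-(2 * Λ * N))))) =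
      logDet E r N := by
    ext z; rw [max_eq_left (hE.low_det r N z)]; rfl
  rwa [e] at this

lemma logN_lipschitz (hη : 0 < η) (hE : Win η Λ E) (r : ℝ) {N : ℕ} (hN : 0 < N) (x y : ℝ) :
    |logN E r N x - logN E r N y| ≤ 4 / η * Real.exp (2 * Λ * N) * |x - y| := by
  have h1 := (hE.hol.cIter r N).lipschitz hη (hE.up_norm r hN) x y
  refine (abs_log_sub_log_le (Real.exp_pos _) (hE.low_norm r N _) (hE.low_norm r N _)).trans ?_
  rw [div_le_iff₀ (Real.exp_pos _)]
  refine (abs_norm_sub_norm_le _ _).trans (h1.trans (le_of_eq ?_))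
  have : Real.exp (2 * Λ * N) * Real.exp (-(Λ * N)) = Real.exp (Λ * N) := by
    rw [← Real.exp_add]; ring_nf
  rw [← this]; ring

lemma logDet_lipschitz (hη : 0 < η) (hE : Win η Λ E) (r : ℝ) {N : ℕ} (hN : 0 < N) (x y : ℝ) :
    |logDet E r N x - logDet E r N y| ≤ 4 / η * Real.exp (4 * Λ * N) * |x - y| := by
  have h1 := (hE.hol.cIter r N).det.lipschitz hη (hE.up_det r hN) x y
  refine (abs_log_sub_log_le (Real.exp_pos _) (hE.low_det r N _) (hE.low_det r N _)).trans ?_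
  rw [div_le_iff₀ (Real.exp_pos _)]
  refine (abs_norm_sub_norm_le _ _).trans (h1.trans ?_)
  have : Real.exp (4 * Λ * N) * Real.exp (-(2 * Λ * N)) = Real.exp (2 * Λ * N) := by
    rw [← Real.exp_add]; ring_nf
  calc 2 * Real.exp (2 * Λ * N) / η * |x - y| ≤ 4 * Real.exp (2 * Λ * N) / η * |x - y| := by
        gcongr; norm_num
    _ = _ := by rw [← this]; ring

end Win

lemma abs_norm_mul_sub_le (X A Y : M2) :
    |‖X * A * Y‖ * ‖A‖ - ‖X * A‖ * ‖A * Y‖| ≤ ‖A.det‖ * ‖X‖ * ‖Y‖ := by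
  let ι := (Fin 2 × Fin 2) × (Fin 2 × Fin 2)
  let s : Fin 2 → Fin 2 → ℂ := fun i j => if i = j then 0 else if i = 0 then 1 else -1
  let v : EuclideanSpace ℂ ι := WithLp.toLp 2 fun p => (X * A * Y) p.1.1 p.1.2 * A p.2.1 p.2.2
  let w : EuclideanSpace ℂ ι := WithLp.toLp 2 fun p => (X * A) p.1.1 p.2.2 * (A * Y) p.2.1 p.1.2
  obtain ⟨X', eX⟩ : ∃ X' : M2, ∀ i k, X' i k = X i 0 * s 0 k + X i 1 * s 1 k := ⟨_, fun _ _ => rfl⟩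
  obtain ⟨Y', eY⟩ : ∃ Y' : M2, ∀ l j, Y' l j = s 0 l * Y 0 j + s 1 l * Y 1 j := ⟨_, fun _ _ => rfl⟩
  have hX' : ‖X'‖ = ‖X‖ := by
    refine (sq_eq_sq₀ (norm_nonneg _) (norm_nonneg _)).1 ?_
    rw [frob_sq, frob_sq]; simp [eX, s]; ring
  have hY' : ‖Y'‖ = ‖Y‖ := by
    refine (sq_eq_sq₀ (norm_nonneg _) (norm_nonneg _)).1 ?_
    rw [frob_sq, frob_sq]; simp [eY, s]; ring
  let u : EuclideanSpace ℂ ι := WithLp.toLp 2 fun p => A.det * X' p.1.1 p.2.1 * Y' p.2.2 p.1.2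
  have hv : ‖v‖ = ‖X * A * Y‖ * ‖A‖ := by
    refine (sq_eq_sq₀ (norm_nonneg _) (by positivity)).1 ?_
    rw [mul_pow, frob_sq, frob_sq, EuclideanSpace.norm_sq_eq]
    simp only [v, ι, Fintype.sum_prod_type, Fin.sum_univ_two, norm_mul, mul_pow]
    ring
  have hw : ‖w‖ = ‖X * A‖ * ‖A * Y‖ := by
    refine (sq_eq_sq₀ (norm_nonneg _) (by positivity)).1 ?_
    rw [mul_pow, frob_sq, frob_sq, EuclideanSpace.norm_sq_eq]
    simp only [w, ι, Fintype.sum_prod_type, Fin.sum_univ_two, norm_mul, mul_pow]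
    ring
  have hu : ‖u‖ = ‖A.det‖ * ‖X'‖ * ‖Y'‖ := by
    refine (sq_eq_sq₀ (norm_nonneg _) (by positivity)).1 ?_
    rw [mul_pow, mul_pow, frob_sq, frob_sq, EuclideanSpace.norm_sq_eq]
    simp only [u, ι, Fintype.sum_prod_type, Fin.sum_univ_two, norm_mul, mul_pow]
    ring
  have huvw : v - w = u := by
    have key : ∀ i j k l, (X * A * Y) i j * A k l - (X * A) i l * (A * Y) k j =
        A.det * X' i k * Y' l j := by
      intro i j
      simp only [Matrix.mul_apply, Fin.sum_univ_two, Matrix.det_fin_two, eX, eY, s,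
        Fin.forall_fin_two]
      norm_num
      refine ⟨⟨?_, ?_⟩, ?_, ?_⟩ <;> ring
    exact PiLp.ext fun p => key p.1.1 p.1.2 p.2.1 p.2.2
  rw [← hv, ← hw, ← hX', ← hY', ← hu, ← huvw]
  exact abs_norm_sub_norm_le v w

/-- Avalanche principle for `2 × 2` matrices. -/
theorem avalanche {B P : ℕ → M2} {M : ℕ} {c τ : ℝ} (hc : 0 < c) (hτ0 : 0 ≤ τ)
    (hτc : 4 * τ ≤ c ^ 2) (hP1 : P 1 = B 0) (hP : ∀ i, P (i + 1) = B i * P i)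
    (hB : ∀ i, 0 < ‖B i‖) (hτ : ∀ i < M, ‖(B i).det‖ ≤ τ * ‖B i‖ ^ 2)
    (hcB : ∀ i, i + 1 < M → c * ‖B (i + 1)‖ * ‖B i‖ ≤ ‖B (i + 1) * B i‖) (n : ℕ)
    (hn : n + 2 ≤ M) :
    (0 < ‖P (n + 1)‖ ∧ 0 < ‖P (n + 2)‖ ∧ c / 2 * ‖B (n + 1)‖ * ‖P (n + 1)‖ ≤ ‖P (n + 2)‖) ∧
    |Real.log ‖P (n + 2)‖ - (∑ i ∈ Finset.range (n + 1), Real.log ‖B (i + 1) * B i‖ -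
      ∑ i ∈ Finset.range n, Real.log ‖B (i + 1)‖)| ≤ n * (4 * τ / c ^ 2) := by
  induction n with
  | zero =>
    have h2 : P 2 = B 1 * B 0 := by rw [hP 1, hP1]
    have h3 := hcB 0 (by omega)
    have h4 : 0 < c * ‖B 1‖ * ‖B 0‖ := mul_pos (mul_pos hc (hB 1)) (hB 0)
    simp only [Nat.zero_add] at h3 ⊢
    refine ⟨⟨by rw [hP1]; exact hB 0, by rw [h2]; linarith, ?_⟩, ?_⟩
    · rw [h2, hP1]; linarith
    · simp [h2]
  | succ n ih =>
    obtain ⟨⟨p1, p2, h1⟩, h2⟩ := ih (by omega)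
    set X := B (n + 2) with hX
    set A := B (n + 1) with hA
    set Y := P (n + 1) with hY
    have hAY : P (n + 2) = A * Y := hP (n + 1)
    have hXAY : P (n + 3) = X * A * Y := by rw [hP (n + 2), hAY, Matrix.mul_assoc]
    have k1 := abs_norm_mul_sub_le X A Y
    rw [← hXAY, ← hAY] at k1
    have hXp := hB (n + 2)
    have hAp := hB (n + 1)
    rw [← hX] at hXp; rw [← hA] at hAp
    have hXA : c * ‖X‖ * ‖A‖ ≤ ‖X * A‖ := hcB (n + 1) (by omega)
    have hdet : ‖A.det‖ ≤ τ * ‖A‖ ^ 2 := hτ (n + 1) (by omega)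
    have hXAp : 0 < ‖X * A‖ := (mul_pos (mul_pos hc hXp) hAp).trans_le hXA
    have k2 : ‖A.det‖ * ‖X‖ * ‖Y‖ ≤ 2 * τ / c ^ 2 * (‖X * A‖ * ‖P (n + 2)‖) := by
      calc ‖A.det‖ * ‖X‖ * ‖Y‖ ≤ τ * ‖A‖ ^ 2 * ‖X‖ * ‖Y‖ := by gcongr
        _ = 2 * τ / c ^ 2 * ((c * ‖X‖ * ‖A‖) * (c / 2 * ‖A‖ * ‖Y‖)) := by field_simp
        _ ≤ _ := by gcongr
    have k3 : 2 * τ / c ^ 2 ≤ 1 / 2 := by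
      rw [div_le_iff₀ (by positivity)]; linarith
    have k4 : 0 < ‖X * A‖ * ‖P (n + 2)‖ := by positivity
    have k5 := abs_le.1 (k1.trans k2)
    have k6 : ‖X * A‖ * ‖P (n + 2)‖ / 2 ≤ ‖P (n + 3)‖ * ‖A‖ := by
      have := mul_le_mul_of_nonneg_right k3 k4.le
      linarith [k5.1]
    have hP3 : 0 < ‖P (n + 3)‖ := by
      by_contra h
      have : ‖P (n + 3)‖ = 0 := le_antisymm (not_lt.1 h) (norm_nonneg _)
      rw [this] at k6; linarith
    refine ⟨⟨p2, hP3, ?_⟩, ?_⟩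
    · refine le_of_mul_le_mul_right (le_trans ?_ k6) hAp
      have := mul_le_mul_of_nonneg_right hXA p2.le
      show c / 2 * ‖X‖ * ‖P (n + 2)‖ * ‖A‖ ≤ _
      linarith
    · have k7 := abs_log_sub_log_le (by positivity) k6 (show ‖X * A‖ * ‖P (n + 2)‖ / 2 ≤
        ‖X * A‖ * ‖P (n + 2)‖ by linarith)
      have k8 : |‖P (n + 3)‖ * ‖A‖ - ‖X * A‖ * ‖P (n + 2)‖| / (‖X * A‖ * ‖P (n + 2)‖ / 2) ≤
          4 * τ / c ^ 2 := by
        rw [div_le_iff₀ (by positivity)]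
        refine (k1.trans k2).trans (le_of_eq (by ring))
      rw [Real.log_mul hP3.ne' hAp.ne', Real.log_mul hXAp.ne' p2.ne'] at k7
      have k9 := abs_le.1 (k7.trans k8)
      have k10 := abs_le.1 h2
      have e1 : ∑ i ∈ Finset.range (n + 1 + 1), Real.log ‖B (i + 1) * B i‖ =
          ∑ i ∈ Finset.range (n + 1), Real.log ‖B (i + 1) * B i‖ + Real.log ‖X * A‖ :=
        Finset.sum_range_succ _ _
      have e2 : ∑ i ∈ Finset.range (n + 1), Real.log ‖B (i + 1)‖ =
          ∑ i ∈ Finset.range n, Real.log ‖B (i + 1)‖ + Real.log ‖A‖ :=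
        Finset.sum_range_succ _ _
      have e3 : n + 1 + 2 = n + 3 := rfl
      rw [e1, e2, e3, abs_le]
      push_cast
      obtain ⟨k9a, k9b⟩ := k9
      obtain ⟨k10a, k10b⟩ := k10
      clear ih h1 h2 hP1 hP hB hτ hcB k1 k2 k3 k4 k5 k6 k7 k8
      constructor <;> linarith

lemma abs_shift_nat_le {f : ℂ → ℝ} {r K : ℝ} (hK : ∀ z, |f (z + r) - f z| ≤ K) (j : ℕ) (z : ℂ) :
    |f (z + j * r) - f z| ≤ K * j := by
  induction j with
  | zero => simp
  | succ j ih =>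
    have h := hK (z + j * r)
    rw [show z + j * r + r = z + (j + 1 : ℕ) * r by push_cast; ring] at h
    have := abs_add_le (f (z + (j + 1 : ℕ) * r) - f (z + j * r)) (f (z + j * r) - f z)
    rw [sub_add_sub_cancel] at this
    push_cast at *
    linarith

lemma abs_birkAvg_sub_le {f : ℂ → ℝ} {r K : ℝ} (hK : ∀ z, |f (z + r) - f z| ≤ K) {R : ℕ}
    (hR : 0 < R) (x : ℝ) : |birkAvg f r R x - f x| ≤ K * R := by
  have hK0 : 0 ≤ K := (abs_nonneg _).trans (hK 0)
  have hR' : (0:ℝ) < R := by exact_mod_cast hR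
  have e : birkAvg f r R x - f x =
      (R : ℝ)⁻¹ * ∑ j ∈ Finset.range R, (f ((x + j * r : ℝ) : ℂ) - f x) := by
    rw [Finset.sum_sub_distrib, Finset.sum_const, Finset.card_range, nsmul_eq_mul, mul_sub,
      ← mul_assoc, inv_mul_cancel₀ hR'.ne', one_mul]; rfl
  rw [e, abs_mul, abs_of_pos (inv_pos.2 hR'), inv_mul_le_iff₀ hR']
  refine (Finset.abs_sum_le_sum_abs _ _).trans ?_
  refine (Finset.sum_le_card_nsmul _ _ (K * R) fun j hj => ?_).trans (by simp)
  have hj' : (j : ℝ) ≤ R := by exact_mod_cast (Finset.mem_range.1 hj).le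
  have := abs_shift_nat_le hK j x
  push_cast
  exact this.trans (by gcongr)

lemma abs_shift_near_period_le {f : ℂ → ℝ} (hp : ∀ z, f (z + 1) = f z) {r K L : ℝ}
    (hK : ∀ z, |f (z + r) - f z| ≤ K) (hL : ∀ x y : ℝ, |f x - f y| ≤ L * |x - y|)
    {q : ℕ} (hq : 0 < q) (n : ℕ) (x : ℝ) :
    |f ((x + n * r : ℝ) : ℂ) - f x| ≤ K * q + L * (n * dn (q * r)) := by
  have hK0 : 0 ≤ K := (abs_nonneg _).trans (hK 0)
  have hL0 : 0 ≤ L := by simpa using (abs_nonneg _).trans (hL 1 0)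
  set s := n / q
  set t := n % q
  have hn : q * s + t = n := Nat.div_add_mod n q
  have hsn : s ≤ n := Nat.div_le_self _ _
  have ht : (t : ℝ) ≤ q := by exact_mod_cast (Nat.mod_lt n hq).le
  have h1 := abs_shift_nat_le hK t x
  have h2 := hL (x + t * r + s * (q * r - round (q * r))) (x + t * r)
  have e1 : f ((x + n * r : ℝ) : ℂ) =
      f ((x + t * r + s * (q * r - round (q * r)) : ℝ) : ℂ) := by
    have := periodic_add_int hp ((x + t * r + s * (q * r - round (q * r)) : ℝ) : ℂ)
      (s * round (q * r))
    rw [← this]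
    congr 1
    rw [← hn]; push_cast; ring
  rw [add_sub_cancel_left, abs_mul, Nat.abs_cast] at h2
  rw [e1]
  have h3 : (s : ℝ) * |q * r - round (q * r)| ≤ n * dn (q * r) := by
    unfold dn; gcongr
  have h4 := abs_add_le (f ((x + t * r + s * (q * r - round (q * r)) : ℝ) : ℂ) -
    f ((x + t * r : ℝ) : ℂ)) (f ((x + t * r : ℝ) : ℂ) - f x)
  rw [sub_add_sub_cancel] at h4
  have h5 : |f ((x + t * r : ℝ) : ℂ) - f x| ≤ K * t := by push_cast; exact h1
  have h6 : K * t ≤ K * q := by gcongr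
  have h7 := mul_le_mul_of_nonneg_left h3 hL0
  linarith

/-- The mean of `log ‖A_N‖` over the real line. -/
def meanN (E : ℂ → M2) (r : ℝ) (N : ℕ) : ℝ := lineAvg (logN E r N) 0

/-- The mean of `log |det A_N|` over the real line. -/
def meanDet (E : ℂ → M2) (r : ℝ) (N : ℕ) : ℝ := lineAvg (logDet E r N) 0

/-- The phases at which the scale-`N` quantities are within `κ N` of their means. -/
def Good (E : ℂ → M2) (r κ : ℝ) (N : ℕ) (x : ℝ) : Prop :=
  |logN E r N x - meanN E r N| ≤ κ * N ∧ |logN E r (2 * N) x - meanN E r (2 * N)| ≤ κ * N ∧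
    |logDet E r N x - meanDet E r N| ≤ κ * N

/-- Normalised square deviation of the Birkhoff averages of length `R`. -/
def devSq (E : ℂ → M2) (r κ : ℝ) (N R : ℕ) (x : ℝ) : ℝ :=
  (4 / (κ * N)) ^ 2 * ((birkAvg (logN E r N) r R x - meanN E r N) ^ 2 +
    (birkAvg (logN E r (2 * N)) r R x - meanN E r (2 * N)) ^ 2 +
    (birkAvg (logDet E r N) r R x - meanDet E r N) ^ 2)

lemma devSq_nonneg (E : ℂ → M2) (r κ : ℝ) (N R : ℕ) (x : ℝ) : 0 ≤ devSq E r κ N R x := by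
  unfold devSq; positivity

lemma abs_le_of_scaled_sq {s X A B : ℝ} (hs : 0 < s) (hB : 0 ≤ B)
    (h : (4 / s) ^ 2 * X < 1) (hX : A + B ≤ X) (y : ℝ) (hy : y ^ 2 ≤ A) : |y| ≤ s / 4 := by
  refine abs_le_of_sq_le_sq ?_ (by positivity)
  have h1 : X ≤ (s / 4) ^ 2 := by
    have : (4 / s) ^ 2 * (s / 4) ^ 2 = 1 := by field_simp
    refine le_of_mul_le_mul_left ?_ (by positivity : 0 < (4 / s) ^ 2)
    linarith
  linarith

namespace Win

variable {η Λ : ℝ} {E : ℂ → M2}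

lemma good_of_devSq_lt (hE : Win η Λ E) {r κ : ℝ} {N R : ℕ} (hκ : 0 < κ) (hN : 0 < N)
    (hR : 0 < R) (hRN : 4 * Λ * R ≤ κ * N / 4) {x : ℝ} (hx : devSq E r κ N R x < 1) :
    Good E r (κ / 2) N x := by
  have hN' : (0:ℝ) < N := by exact_mod_cast hN
  have hs : 0 < κ * N := by positivity
  have h1 := abs_birkAvg_sub_le (hE.logN_shift r N) hR x
  have h2 := abs_birkAvg_sub_le (hE.logN_shift r (2 * N)) hR x
  have h3 := abs_birkAvg_sub_le (hE.logDet_shift r N) hR x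
  unfold devSq at hx
  set y1 := birkAvg (logN E r N) r R x - meanN E r N with hy1
  set y2 := birkAvg (logN E r (2 * N)) r R x - meanN E r (2 * N) with hy2
  set y3 := birkAvg (logDet E r N) r R x - meanDet E r N with hy3
  have k1 := abs_le_of_scaled_sq hs (add_nonneg (sq_nonneg y2) (sq_nonneg y3))
    hx (by linarith) y1 le_rfl
  have k2 := abs_le_of_scaled_sq hs (add_nonneg (sq_nonneg y1) (sq_nonneg y3))
    hx (by linarith) y2 le_rfl
  have k3 := abs_le_of_scaled_sq hs (add_nonneg (sq_nonneg y1) (sq_nonneg y2))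
    hx (by linarith) y3 le_rfl
  rw [abs_le] at h1 h2 h3 k1 k2 k3
  refine ⟨abs_le.2 ?_, abs_le.2 ?_, abs_le.2 ?_⟩ <;> constructor <;>
    linarith [h1.1, h1.2, h2.1, h2.2, h3.1, h3.2, k1.1, k1.2, k2.1, k2.2, k3.1, k3.2]

lemma good_mono {r κ κ' : ℝ} {N : ℕ} {x : ℝ} (h : Good E r κ N x) (hκ : κ ≤ κ') :
    Good E r κ' N x := by
  have : κ * N ≤ κ' * N := by gcongr
  exact ⟨h.1.trans this, h.2.1.trans this, h.2.2.trans this⟩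

lemma continuous_logN (hE : Win η Λ E) (r : ℝ) (N : ℕ) : Continuous (logN E r N) :=
  (hE.subStrip_logN r N (sub_one_lt η)).cont

lemma continuous_logDet (hE : Win η Λ E) (r : ℝ) (N : ℕ) : Continuous (logDet E r N) :=
  (hE.subStrip_logDet r N (sub_one_lt η)).cont

lemma logN_per (hE : Win η Λ E) (r : ℝ) (N : ℕ) (z : ℂ) : logN E r N (z + 1) = logN E r N z :=
  (hE.subStrip_logN r N (sub_one_lt η)).per z

lemma logDet_per (hE : Win η Λ E) (r : ℝ) (N : ℕ) (z : ℂ) :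
    logDet E r N (z + 1) = logDet E r N z :=
  (hE.subStrip_logDet r N (sub_one_lt η)).per z

lemma continuous_devSq (hE : Win η Λ E) (r κ : ℝ) (N R : ℕ) :
    Continuous (devSq E r κ N R) := by
  have h1 := continuous_birkAvg (hE.continuous_logN r N) r R
  have h2 := continuous_birkAvg (hE.continuous_logN r (2 * N)) r R
  have h3 := continuous_birkAvg (hE.continuous_logDet r N) r R
  unfold devSq
  fun_prop

lemma integral_devSq_le (hη : 0 < η) (hE : Win η Λ E) {r κ : ℝ} {N R : ℕ} (hκ : 0 < κ)
    (hN : 0 < N) (hR : 0 < R) :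
    ∫ x in (0:ℝ)..1, devSq E r κ N R x ≤ 153600 * Λ ^ 2 / (κ ^ 2 * η ^ 2) * cost r R := by
  have hN' : (0:ℝ) < N := by exact_mod_cast hN
  have c1 := continuous_birkAvg (hE.continuous_logN r N) r R
  have c2 := continuous_birkAvg (hE.continuous_logN r (2 * N)) r R
  have c3 := continuous_birkAvg (hE.continuous_logDet r N) r R
  have hl : η / 2 < η := by linarith
  have hΛ : 0 ≤ Λ * N := (abs_nonneg _).trans (hE.abs_logN_le r hN 0)
  have v1 := variance_birkAvg_le (half_pos hη) (hE.subStrip_logN r N hl) (C := 2 * Λ * N)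
    (fun z => (hE.abs_logN_le r hN z).trans (by linarith)) r hR
  have v2 := variance_birkAvg_le (half_pos hη) (hE.subStrip_logN r (2 * N) hl) (C := 2 * Λ * N)
    (fun z => (hE.abs_logN_le r (by omega) z).trans (by push_cast; linarith)) r hR
  have v3 := variance_birkAvg_le (half_pos hη) (hE.subStrip_logDet r N hl) (C := 2 * Λ * N)
    (fun z => hE.abs_logDet_le r hN z) r hR
  unfold devSq
  have i1 : Continuous fun x => (birkAvg (logN E r N) r R x - meanN E r N) ^ 2 := by fun_prop
  have i2 : Continuous fun x => (birkAvg (logN E r (2 * N)) r R x - meanN E r (2 * N)) ^ 2 := by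
    fun_prop
  have i3 : Continuous fun x => (birkAvg (logDet E r N) r R x - meanDet E r N) ^ 2 := by fun_prop
  have i12 : Continuous fun x => (birkAvg (logN E r N) r R x - meanN E r N) ^ 2 +
      (birkAvg (logN E r (2 * N)) r R x - meanN E r (2 * N)) ^ 2 := i1.add i2
  rw [intervalIntegral.integral_const_mul, intervalIntegral.integral_add
    (i12.intervalIntegrable _ _) (i3.intervalIntegrable _ _),
    intervalIntegral.integral_add (i1.intervalIntegrable _ _) (i2.intervalIntegrable _ _)]
  refine (mul_le_mul_of_nonneg_left (add_le_add (add_le_add v1 v2) v3) (by positivity)).trans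
    (le_of_eq ?_)
  field_simp
  ring

lemma good_of_near_period (hη : 0 < η) (hΛ : 0 ≤ Λ) (hE : Win η Λ E) {r κ : ℝ} {N : ℕ}
    (hN : 0 < N) {q M : ℕ} (hq : 0 < q) (hqN : 4 * Λ * q ≤ κ * N / 4)
    (hM : M * dn (q * r) ≤ Real.exp (-(5 * Λ * N)))
    (hNl : 4 / η * Real.exp (-(Λ * N)) ≤ κ * N / 4) {x : ℝ} (hx : Good E r (κ / 2) N x) {n : ℕ}
    (hn : n ≤ M) : Good E r κ N (x + n * r) := by
  have hL : 4 / η * Real.exp (4 * Λ * N) * (n * dn (q * r)) ≤ κ * N / 4 := by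
    have hnM : (n : ℝ) * dn (q * r) ≤ M * dn (q * r) := by
      have := dn_nonneg (q * r)
      have : (n : ℝ) ≤ M := by exact_mod_cast hn
      gcongr
    refine le_trans ?_ hNl
    calc 4 / η * Real.exp (4 * Λ * N) * (n * dn (q * r))
        ≤ 4 / η * Real.exp (4 * Λ * N) * Real.exp (-(5 * Λ * N)) := by
          gcongr; exact hnM.trans hM
      _ = _ := by rw [mul_assoc, ← Real.exp_add]; ring_nf
  have l1 : ∀ x y : ℝ, |logN E r N x - logN E r N y| ≤
      4 / η * Real.exp (4 * Λ * N) * |x - y| := fun x y =>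
    (hE.logN_lipschitz hη r hN x y).trans (by gcongr; norm_num)
  have l2 : ∀ x y : ℝ, |logN E r (2 * N) x - logN E r (2 * N) y| ≤
      4 / η * Real.exp (4 * Λ * N) * |x - y| := fun x y =>
    (hE.logN_lipschitz hη r (by omega) x y).trans (le_of_eq (by push_cast; ring_nf))
  have k1 := abs_shift_near_period_le (hE.logN_per r N) (hE.logN_shift r N) l1 hq n x
  have k2 := abs_shift_near_period_le (hE.logN_per r (2 * N)) (hE.logN_shift r (2 * N)) l2 hq n x
  have k3 := abs_shift_near_period_le (hE.logDet_per r N) (hE.logDet_shift r N)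
    (hE.logDet_lipschitz hη r hN) hq n x
  obtain ⟨g1, g2, g3⟩ := hx
  rw [abs_le] at k1 k2 k3 g1 g2 g3
  refine ⟨abs_le.2 ?_, abs_le.2 ?_, abs_le.2 ?_⟩ <;> constructor <;>
    linarith [k1.1, k1.2, k2.1, k2.2, k3.1, k3.2, g1.1, g1.2, g2.1, g2.2, g3.1, g3.2]

end Win

namespace Win

variable {η Λ : ℝ} {E : ℂ → M2}

lemma integral_logN_shift (hE : Win η Λ E) (r : ℝ) (N : ℕ) (t : ℝ) :
    ∫ x in (0:ℝ)..1, logN E r N ((x + t : ℝ) : ℂ) = meanN E r N := by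
  rw [integral_translate_eq (real_line_periodic (hE.logN_per r N))]
  simp [meanN, lineAvg]

lemma avalanche_good (hE : Win η Λ E) {r κ : ℝ} {N : ℕ} (hκN : 1 ≤ κ * N)
    (hab : 2 * meanN E r N - meanN E r (2 * N) ≤ 2 * κ * N)
    (had : 40 * κ * N ≤ 2 * meanN E r N - meanDet E r N) (n : ℕ) {x : ℝ}
    (hg : ∀ i < n + 2, Good E r κ N (x + i * (N * r))) :
    |logN E r ((n + 2) * N) x -
      (∑ i ∈ Finset.range (n + 1), logN E r (2 * N) ((x + i * (N * r) : ℝ) : ℂ) -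
        ∑ i ∈ Finset.range n, logN E r N ((x + (i + 1 : ℕ) * (N * r) : ℝ) : ℂ))| ≤ n := by
  set B : ℕ → M2 := fun i => cIter E r N ((x + i * (N * r) : ℝ) : ℂ) with hB
  set P : ℕ → M2 := fun i => cIter E r (i * N) x with hP
  have hBp : ∀ i, 0 < ‖B i‖ := fun i => hE.norm_pos r N _
  have hBB : ∀ i, B (i + 1) * B i = cIter E r (2 * N) ((x + i * (N * r) : ℝ) : ℂ) := by
    intro i
    rw [two_mul, cIter_add]
    simp only [hB]
    congr 2; push_cast; ring
  have hlogB : ∀ i, Real.log ‖B i‖ = logN E r N ((x + i * (N * r) : ℝ) : ℂ) := fun i => rfl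
  have hlogBB : ∀ i, Real.log ‖B (i + 1) * B i‖ =
      logN E r (2 * N) ((x + i * (N * r) : ℝ) : ℂ) := fun i => by rw [hBB]; rfl
  have key := avalanche (B := B) (P := P) (M := n + 2) (c := Real.exp (-(5 * κ * N)))
    (τ := Real.exp (-(37 * κ * N))) (Real.exp_pos _) (Real.exp_pos _).le ?_ ?_ ?_ hBp ?_ ?_ n le_rfl
  · have k2 := key.2
    simp only [hlogB, hlogBB] at k2
    refine k2.trans (mul_le_of_le_one_right (Nat.cast_nonneg n) ?_)
    rw [div_le_one (by positivity), ← Real.exp_nat_mul]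
    have h4 : (4:ℝ) ≤ Real.exp 27 := by
      have := Real.add_one_le_exp (27:ℝ); linarith
    calc 4 * Real.exp (-(37 * κ * N)) ≤ Real.exp 27 * Real.exp (-(37 * κ * N)) := by gcongr
      _ ≤ _ := by rw [← Real.exp_add]; apply Real.exp_le_exp.2; push_cast; linarith
  · rw [← Real.exp_nat_mul]
    have h4 : (4:ℝ) ≤ Real.exp 27 := by
      have := Real.add_one_le_exp (27:ℝ); linarith
    calc 4 * Real.exp (-(37 * κ * N)) ≤ Real.exp 27 * Real.exp (-(37 * κ * N)) := by gcongr
      _ ≤ _ := by rw [← Real.exp_add]; apply Real.exp_le_exp.2; push_cast; linarith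
  · simp [hB, hP]
  · intro i
    simp only [hB, hP]
    rw [show (i + 1) * N = N + i * N by ring, cIter_add]
    congr 2; push_cast; ring
  · intro i hi
    obtain ⟨g1, -, g3⟩ := hg i hi
    rw [abs_le] at g1 g3
    have hd := hE.det_pos r N ((x + i * (N * r) : ℝ) : ℂ)
    rw [← Real.exp_log hd, ← Real.exp_log (hBp i), hlogB, ← Real.exp_nat_mul, ← Real.exp_add]
    apply Real.exp_le_exp.2
    have : Real.log ‖(cIter E r N ((x + i * (N * r) : ℝ) : ℂ)).det‖ =
      logDet E r N ((x + i * (N * r) : ℝ) : ℂ) := rfl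
    rw [this]
    push_cast at *
    linarith [g1.1, g3.2]
  · intro i hi
    obtain ⟨g1, g2, -⟩ := hg i (by omega)
    obtain ⟨g1', -, -⟩ := hg (i + 1) (by omega)
    rw [abs_le] at g1 g2 g1'
    have hd := hE.norm_pos r (2 * N) ((x + i * (N * r) : ℝ) : ℂ)
    rw [← hBB] at hd
    rw [← Real.exp_log hd, ← Real.exp_log (hBp i), ← Real.exp_log (hBp (i + 1)), hlogB, hlogB,
      hlogBB, ← Real.exp_add, ← Real.exp_add]
    apply Real.exp_le_exp.2
    linarith [g1.2, g2.1, g1'.2]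

theorem mean_avalanche (hΛ : 0 ≤ Λ) (hE : Win η Λ E) {r κ : ℝ} {N : ℕ} (hN : 0 < N)
    (hκN : 1 ≤ κ * N)
    (hab : 2 * meanN E r N - meanN E r (2 * N) ≤ 2 * κ * N)
    (had : 40 * κ * N ≤ 2 * meanN E r N - meanDet E r N) (n : ℕ) {W : ℝ → ℝ} (hW : Continuous W)
    (hW0 : ∀ x, 0 ≤ W x)
    (hg : ∀ x, W x < 1 → ∀ i < n + 2, Good E r κ N (x + i * (N * r))) :
    |meanN E r ((n + 2) * N) - ((n + 1) * meanN E r (2 * N) - n * meanN E r N)| ≤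
      n + 4 * Λ * (n + 2) * N * ∫ x in (0:ℝ)..1, W x := by
  set S1 : ℝ → ℝ := fun x =>
    ∑ i ∈ Finset.range (n + 1), logN E r (2 * N) ((x + i * (N * r) : ℝ) : ℂ) with hS1
  set S2 : ℝ → ℝ := fun x =>
    ∑ i ∈ Finset.range n, logN E r N ((x + (i + 1 : ℕ) * (N * r) : ℝ) : ℂ) with hS2
  have c0 := hE.continuous_logN r ((n + 2) * N)
  have c1 := hE.continuous_logN r (2 * N)
  have c2 := hE.continuous_logN r N
  have cS1 : Continuous S1 := by fun_prop
  have cS2 : Continuous S2 := by fun_prop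
  have cl : Continuous fun x : ℝ => logN E r ((n + 2) * N) x := by fun_prop
  have e0 : ∫ x in (0:ℝ)..1, logN E r ((n + 2) * N) x = meanN E r ((n + 2) * N) := by
    simpa using hE.integral_logN_shift r ((n + 2) * N) 0
  have e1 : ∫ x in (0:ℝ)..1, S1 x = (n + 1) * meanN E r (2 * N) := by
    rw [hS1, intervalIntegral.integral_finsetSum
      (fun j _ => Continuous.intervalIntegrable (by fun_prop) _ _)]
    simp only [hE.integral_logN_shift]
    simp
  have e2 : ∫ x in (0:ℝ)..1, S2 x = n * meanN E r N := by
    rw [hS2, intervalIntegral.integral_finsetSum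
      (fun j _ => Continuous.intervalIntegrable (by fun_prop) _ _)]
    simp only [hE.integral_logN_shift]
    simp
  have cd : Continuous fun x => S1 x - S2 x := cS1.sub cS2
  rw [← e0, ← e1, ← e2, ← intervalIntegral.integral_sub (cS1.intervalIntegrable _ _)
    (cS2.intervalIntegrable _ _), ← intervalIntegral.integral_sub (cl.intervalIntegrable _ _)
    (cd.intervalIntegrable _ _), ← intervalIntegral.integral_const_mul]
  have e3 : (n : ℝ) + ∫ x in (0:ℝ)..1, 4 * Λ * (n + 2) * N * W x =
      ∫ x in (0:ℝ)..1, (n + 4 * Λ * (n + 2) * N * W x) := by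
    rw [intervalIntegral.integral_add (continuous_const.intervalIntegrable _ _)
      (Continuous.intervalIntegrable (by fun_prop) _ _)]
    simp
  rw [e3, ← Real.norm_eq_abs]
  refine intervalIntegral.norm_integral_le_of_norm_le zero_le_one
    (ae_of_all _ fun x _ => ?_) (Continuous.intervalIntegrable (by fun_prop) _ _)
  rw [Real.norm_eq_abs]
  have hn0 : (0:ℝ) ≤ n := Nat.cast_nonneg n
  have hN0 : (0:ℝ) ≤ N := Nat.cast_nonneg N
  rcases lt_or_ge (W x) 1 with h | h
  · refine (hE.avalanche_good hκN hab had n (hg x h)).trans ?_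
    have := hW0 x
    have : 0 ≤ 4 * Λ * (n + 2) * N * W x := by positivity
    linarith
  · have b0 := hE.abs_logN_le r (N := (n + 2) * N) (by positivity) x
    have b1 : |S1 x| ≤ (n + 1) * (Λ * (2 * N)) := by
      refine (Finset.abs_sum_le_sum_abs _ _).trans ?_
      refine (Finset.sum_le_card_nsmul _ _ (Λ * (2 * N)) fun j _ => ?_).trans (by simp)
      have := hE.abs_logN_le r (N := 2 * N) (by positivity) ((x + j * (N * r) : ℝ) : ℂ)
      push_cast at this ⊢
      exact this
    have b2 : |S2 x| ≤ n * (Λ * N) := by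
      refine (Finset.abs_sum_le_sum_abs _ _).trans ?_
      refine (Finset.sum_le_card_nsmul _ _ (Λ * N) fun j _ => ?_).trans (by simp)
      exact hE.abs_logN_le r hN _
    have hΛN : 0 ≤ Λ * N := by positivity
    have b3 : 4 * Λ * (n + 2) * N * 1 ≤ 4 * Λ * (n + 2) * N * W x := by gcongr
    push_cast at b0
    rw [abs_le] at b0 b1 b2 ⊢
    constructor <;> nlinarith [b0.1, b0.2, b1.1, b1.2, b2.1, b2.2]

end Win

lemma cost_nonneg (r M : ℝ) : 0 ≤ cost r M := tsum_nonneg fun _ => by positivity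

lemma cost_mul_le {r M M' s : ℝ} (hs : 0 < s) (hs1 : s ≤ 1) (hM : s * M ≤ M') :
    cost r M' ≤ s⁻¹ ^ 2 * cost r M := by
  unfold cost
  rw [← tsum_mul_left]
  refine (summable_cost r M').tsum_le_tsum (fun k => ?_) ((summable_cost r M).mul_left _)
  rw [mul_left_comm, ← mul_pow s⁻¹, ← mul_inv]
  refine mul_le_mul_of_nonneg_left ?_ (by positivity)
  refine pow_le_pow_left₀ (by positivity) (inv_anti₀ (by positivity) ?_) 2
  have hd := dn_nonneg ((k + 1 : ℕ) * r)
  rw [mul_max_of_nonneg _ _ hs.le]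
  refine max_le_max (by linarith) ?_
  rw [← mul_assoc]
  exact mul_le_mul_of_nonneg_right hM hd

/-- Normalised mean of `log ‖A_N‖`. -/
def uN (E : ℂ → M2) (r : ℝ) (N : ℕ) : ℝ := meanN E r N / N

/-- Admissible multipliers: either `4`, or a jump allowed by a strong near-period. -/
def Jump (C σ r : ℝ) (N m : ℕ) : Prop :=
  4 ≤ m ∧ (m = 4 ∨ ∃ q : ℕ, 0 < q ∧ q ≤ σ * N ∧ 2 * m * N * dn (q * r) ≤ Real.exp (-(C * N)))

namespace Win

variable {η Λ : ℝ} {E : ℂ → M2}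

lemma meanN_add_le (hE : Win η Λ E) (r : ℝ) (m n : ℕ) :
    meanN E r (m + n) ≤ meanN E r m + meanN E r n := by
  have c0 := hE.continuous_logN r (m + n)
  have c1 := hE.continuous_logN r m
  have c2 := hE.continuous_logN r n
  have e0 : ∫ x in (0:ℝ)..1, logN E r (m + n) x = meanN E r (m + n) := by
    simpa using hE.integral_logN_shift r (m + n) 0
  have e2 : ∫ x in (0:ℝ)..1, logN E r n x = meanN E r n := by
    simpa using hE.integral_logN_shift r n 0
  rw [← e0, ← e2, ← hE.integral_logN_shift r m (n * r), ← intervalIntegral.integral_add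
    (Continuous.intervalIntegrable (by fun_prop) _ _)
    (Continuous.intervalIntegrable (by fun_prop) _ _)]
  refine intervalIntegral.integral_mono_on zero_le_one
    (Continuous.intervalIntegrable (by fun_prop) _ _)
    (Continuous.intervalIntegrable (by fun_prop) _ _) fun x _ => ?_
  unfold logN
  rw [← Real.log_mul (hE.norm_pos r _ _).ne' (hE.norm_pos r _ _).ne']
  refine Real.log_le_log (hE.norm_pos r _ _) ?_
  rw [cIter_add]
  push_cast
  exact frob_mul_le _ _

lemma meanDet_eq (hE : Win η Λ E) (r : ℝ) (n : ℕ) :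
    meanDet E r n = n * lineAvg (fun z => Real.log ‖(E z).det‖) 0 := by
  have c1 : Continuous fun z => Real.log ‖(E z).det‖ := by
    have e : (fun z => Real.log ‖(E z).det‖) = logDet E r 1 := by
      ext z; rw [logDet, cIter_one]
    rw [e]; exact hE.continuous_logDet r 1
  induction n with
  | zero => simp [meanDet, logDet, lineAvg, cIter]
  | succ n ih =>
    have c2 := hE.continuous_logDet r n
    have e0 : ∫ x in (0:ℝ)..1, logDet E r n ((x + r : ℝ) : ℂ) = meanDet E r n := by
      rw [integral_translate_eq (real_line_periodic (hE.logDet_per r n))]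
      simp [meanDet, lineAvg]
    have c3 : Continuous fun x : ℝ => Real.log ‖(E x).det‖ := c1.comp continuous_ofReal
    push_cast
    rw [add_mul, ← ih, one_mul, ← e0]
    simp only [meanDet, lineAvg, ofReal_zero, zero_mul, add_zero]
    rw [← intervalIntegral.integral_add (Continuous.intervalIntegrable (by fun_prop) _ _)
      (Continuous.intervalIntegrable c3 _ _)]
    congr 1
    ext x
    have hp : 0 < ‖(E x).det‖ := (Real.exp_pos _).trans_le (hE.low _)
    simp only [logDet]
    rw [cIter_succ, Matrix.det_mul, norm_mul, Real.log_mul (hE.det_pos r _ _).ne' hp.ne']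
    push_cast; rfl

lemma step_of_window (hΛ : 0 ≤ Λ) (hE : Win η Λ E) {r κ : ℝ} {N : ℕ} (hN : 0 < N)
    (hκN : 1 ≤ κ * N) (hab : uN E r N - uN E r (2 * N) ≤ κ)
    (had : 20 * κ ≤ uN E r N - lineAvg (fun z => Real.log ‖(E z).det‖) 0 / 2) {m : ℕ} (hm : 4 ≤ m)
    {W : ℝ → ℝ} (hW : Continuous W) (hW0 : ∀ x, 0 ≤ W x)
    (hg : ∀ x, W x < 1 → ∀ i < 2 * m, Good E r κ N (x + i * (N * r))) {e : ℝ}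
    (he : 1 / N + 4 * Λ * ∫ x in (0:ℝ)..1, W x ≤ e) :
    uN E r (m * N) - uN E r (2 * (m * N)) ≤ (uN E r N - uN E r (2 * N)) / 4 + 2 * e ∧
    uN E r N - 2 * (uN E r N - uN E r (2 * N)) - e ≤ uN E r (m * N) := by
  have hN' : (0:ℝ) < N := by exact_mod_cast hN
  have hm' : (4:ℝ) ≤ m := by exact_mod_cast hm
  have ea : meanN E r N = N * uN E r N := by unfold uN; field_simp
  have eb : meanN E r (2 * N) = 2 * N * uN E r (2 * N) := by unfold uN; push_cast; field_simp
  set a := uN E r N with ha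
  set b := uN E r (2 * N) with hb
  have hγ : b ≤ a := by
    have := hE.meanN_add_le r N N
    rw [← two_mul, ← two_mul, ea, eb, mul_assoc] at this
    nlinarith
  have hab' : 2 * meanN E r N - meanN E r (2 * N) ≤ 2 * κ * N := by
    rw [ea, eb]; nlinarith
  have had' : 40 * κ * N ≤ 2 * meanN E r N - meanDet E r N := by
    rw [ea, hE.meanDet_eq]; nlinarith
  have key : ∀ k : ℕ, 4 ≤ k → k ≤ 2 * m →
      |uN E r (k * N) - (2 * b - a + 2 / k * (a - b))| ≤ e := by
    intro k hk hkm
    have hk' : (4:ℝ) ≤ k := by exact_mod_cast hk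
    obtain ⟨n, rfl⟩ : ∃ n, k = n + 2 := ⟨k - 2, by omega⟩
    have h := hE.mean_avalanche hΛ hN hκN hab' had' n hW hW0
      (fun x hx i hi => hg x hx i (by omega))
    have hkN : (0:ℝ) < ((n + 2 : ℕ) : ℝ) * N := by positivity
    have e1 : uN E r ((n + 2) * N) - (2 * b - a + 2 / (n + 2 : ℕ) * (a - b)) =
        (meanN E r ((n + 2) * N) - ((n + 1) * meanN E r (2 * N) - n * meanN E r N)) /
          (((n + 2 : ℕ) : ℝ) * N) := by
      rw [ea, eb]; unfold uN; push_cast; field_simp; ring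
    rw [e1, abs_div, abs_of_pos hkN, div_le_iff₀ hkN]
    refine h.trans ?_
    refine le_trans ?_ (mul_le_mul_of_nonneg_right he hkN.le)
    push_cast
    have : (1 / N + 4 * Λ * ∫ x in (0:ℝ)..1, W x) * ((n + 2) * N) =
      (n + 2) + 4 * Λ * (n + 2) * N * ∫ x in (0:ℝ)..1, W x := by field_simp
    rw [this]; linarith
  have k1 := abs_le.1 (key m hm (by omega))
  have k2 := abs_le.1 (key (2 * m) (by omega) le_rfl)
  rw [show 2 * m * N = 2 * (m * N) by ring] at k2
  push_cast at k2
  have hg0 : 0 ≤ a - b := by linarith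
  have e2 : 2 / (2 * m : ℝ) * (a - b) = (a - b) / m := by field_simp
  have e3 : 2 / (m : ℝ) * (a - b) = 2 * ((a - b) / m) := by ring
  have h4 : (a - b) / m ≤ (a - b) / 4 := by gcongr
  have h5 : 0 ≤ (a - b) / m := by positivity
  rw [e2] at k2; rw [e3] at k1
  constructor <;> linarith [k1.1, k1.2, k2.1, k2.2]

/-- The constant in front of the small-divisor cost in the inductive step. -/
def costConst (η Λ κ : ℝ) : ℝ :=
  32 * Λ * (153600 * Λ ^ 2 / (κ ^ 2 * η ^ 2)) * (κ / (16 * Λ) / 2)⁻¹ ^ 2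

theorem step (hη : 0 < η) (hΛ : 0 < Λ) (hE : Win η Λ E) {r κ : ℝ} (hκ : 0 < κ) {N : ℕ}
    (hκN : 1 ≤ κ * N) (hσ : κ / (16 * Λ) ≤ 1) (hσN : 1 ≤ κ / (16 * Λ) * N)
    (hNl : 4 / η * Real.exp (-(Λ * N)) ≤ κ * N / 4)
    (hab : uN E r N - uN E r (2 * N) ≤ κ)
    (had : 20 * κ ≤ uN E r N - lineAvg (fun z => Real.log ‖(E z).det‖) 0 / 2) {m : ℕ}
    (hm : Jump (5 * Λ) (κ / (16 * Λ)) r N m) :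
    uN E r (m * N) - uN E r (2 * (m * N)) ≤ (uN E r N - uN E r (2 * N)) / 4 +
      2 * (1 / N + costConst η Λ κ * cost r N) ∧
    uN E r N - 2 * (uN E r N - uN E r (2 * N)) - (1 / N + costConst η Λ κ * cost r N) ≤
      uN E r (m * N) := by
  set σ := κ / (16 * Λ) with hσdef
  have hσ0 : 0 < σ := by positivity
  have hN : 0 < N := by
    rcases Nat.eq_zero_or_pos N with h | h
    · subst h; norm_num at hκN
    · exact h
  have hN' : (0:ℝ) < N := by exact_mod_cast hN
  set R := ⌊σ * N⌋₊ with hR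
  have hR0 : 0 < R := Nat.floor_pos.2 hσN
  have hR1 : (R : ℝ) ≤ σ * N := Nat.floor_le (by positivity)
  have hR2 : σ / 2 * N ≤ R := by
    have h1 := Nat.lt_floor_add_one (σ * N)
    have h2 : (1:ℝ) ≤ R := by exact_mod_cast hR0
    rw [← hR] at h1
    linarith
  have hσΛ : ∀ y : ℝ, y ≤ σ * N → 4 * Λ * y ≤ κ * N / 4 := by
    intro y hy
    have : 4 * Λ * (σ * N) = κ * N / 4 := by rw [hσdef]; field_simp; norm_num
    rw [← this]; gcongr
  have hRN := hσΛ R hR1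
  set Z := devSq E r κ N R with hZ
  have cZ : Continuous Z := hE.continuous_devSq r κ N R
  have hgood : ∀ x, Z x < 1 → Good E r (κ / 2) N x := fun x hx =>
    hE.good_of_devSq_lt hκ hN hR0 hRN hx
  have hIZ := hE.integral_devSq_le hη (r := r) hκ hN hR0
  rw [← hZ] at hIZ
  have hcost := cost_mul_le (r := r) (M := N) (M' := R) (s := σ / 2) (by positivity)
    (by linarith) hR2
  set H := 153600 * Λ ^ 2 / (κ ^ 2 * η ^ 2) with hH
  have hH0 : 0 ≤ H := by positivity
  have hI0 : 0 ≤ ∫ x in (0:ℝ)..1, Z x :=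
    intervalIntegral.integral_nonneg zero_le_one fun x _ => devSq_nonneg _ _ _ _ _ _
  have hI : ∫ x in (0:ℝ)..1, Z x ≤ H * ((σ / 2)⁻¹ ^ 2 * cost r N) :=
    hIZ.trans (mul_le_mul_of_nonneg_left hcost hH0)
  have hbound : ∀ I : ℝ, I ≤ 8 * ∫ x in (0:ℝ)..1, Z x →
      1 / N + 4 * Λ * I ≤ 1 / N + costConst η Λ κ * cost r N := by
    intro I hI'
    have : 4 * Λ * I ≤ 4 * Λ * (8 * (H * ((σ / 2)⁻¹ ^ 2 * cost r N))) := by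
      gcongr; linarith
    have e : costConst η Λ κ * cost r N = 4 * Λ * (8 * (H * ((σ / 2)⁻¹ ^ 2 * cost r N))) := by
      unfold costConst; rw [← hH, ← hσdef]; ring
    linarith
  obtain ⟨hm4, rfl | ⟨q, hq, hqN, hqm⟩⟩ := hm
  · have hper : Function.Periodic Z 1 := by
      intro x
      have hb : ∀ f : ℂ → ℝ, (∀ z, f (z + 1) = f z) →
          birkAvg f r R (x + 1) = birkAvg f r R x := by
        intro f hf
        unfold birkAvg
        congr 1
        refine Finset.sum_congr rfl fun j _ => ?_
        rw [← hf ((x + j * r : ℝ) : ℂ)]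
        congr 1; push_cast; ring
      simp only [hZ, devSq, hb _ (hE.logN_per r N), hb _ (hE.logN_per r (2 * N)),
        hb _ (hE.logDet_per r N)]
    refine hE.step_of_window hΛ.le hN hκN hab had hm4
      (W := fun x => ∑ i ∈ Finset.range 8, Z (x + i * (N * r))) (by fun_prop)
      (fun x => Finset.sum_nonneg fun i _ => devSq_nonneg _ _ _ _ _ _) (fun x hx i hi => ?_)
      (hbound _ (le_of_eq ?_))
    · refine good_mono (hgood _ (lt_of_le_of_lt ?_ hx)) (by linarith)
      exact Finset.single_le_sum (f := fun i : ℕ => Z (x + i * (N * r)))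
        (fun i _ => devSq_nonneg _ _ _ _ _ _) (Finset.mem_range.2 (by omega))
    · rw [intervalIntegral.integral_finsetSum
        (fun j _ => Continuous.intervalIntegrable (by fun_prop) _ _)]
      simp only [integral_translate_eq hper]
      simp
  · refine hE.step_of_window hΛ.le hN hκN hab had hm4 (W := Z) cZ
      (fun x => devSq_nonneg _ _ _ _ _ _) (fun x hx i hi => ?_) (hbound _ (by linarith))
    have := hE.good_of_near_period hη hΛ.le (r := r) (κ := κ) hN (M := 2 * m * N) hq
      (hσΛ q hqN) (by push_cast; exact hqm) hNl (hgood x hx) (n := i * N)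
      (Nat.mul_le_mul_right N hi.le)
    convert this using 1
    push_cast; ring

/-- Lower bound for the finite-scale exponents along a chain of admissible scales. -/
theorem chain (hη : 0 < η) (hΛ : 0 < Λ) (hE : Win η Λ E) {r κ : ℝ} (hκ : 0 < κ)
    (hσ : κ / (16 * Λ) ≤ 1) {N m : ℕ → ℕ} (hNm : ∀ i, N (i + 1) = m i * N i)
    (hm : ∀ i, Jump (5 * Λ) (κ / (16 * Λ)) r (N i) (m i))
    (hκN : ∀ i, 1 ≤ κ * N i) (hσN : ∀ i, 1 ≤ κ / (16 * Λ) * N i)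
    (hNl : ∀ i, 4 / η * Real.exp (-(Λ * N i)) ≤ κ * N i / 4)
    (had : 21 * κ ≤ uN E r (N 0) - lineAvg (fun z => Real.log ‖(E z).det‖) 0 / 2)
    {S : ℝ} (hS : ∀ n, ∑ i ∈ Finset.range n, (1 / N i + costConst η Λ κ * cost r (N i)) ≤ S)
    (hγ : 3 * (uN E r (N 0) - uN E r (2 * N 0)) + 7 * S ≤ κ) (n : ℕ) :
    uN E r (N 0) - κ ≤ uN E r (N n) := by
  set e : ℕ → ℝ := fun i => 1 / N i + costConst η Λ κ * cost r (N i) with he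
  have hQ : 0 ≤ costConst η Λ κ := by unfold costConst; positivity
  have he0 : ∀ i, 0 ≤ e i := fun i => by
    have := cost_nonneg r (N i)
    simp only [he]; positivity
  have hγ0 : ∀ k, 0 < k → 0 ≤ uN E r k - uN E r (2 * k) := by
    intro k hk
    have hk' : (0:ℝ) < k := by exact_mod_cast hk
    have := hE.meanN_add_le r k k
    rw [← two_mul] at this
    unfold uN
    push_cast
    rw [div_sub_div _ _ hk'.ne' (by positivity)]
    apply div_nonneg _ (by positivity)
    nlinarith
  have hNpos : ∀ i, 0 < N i := fun i => by
    rcases Nat.eq_zero_or_pos (N i) with h | h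
    · have := hκN i; rw [h] at this; norm_num at this
    · exact h
  have hS0 : 0 ≤ S := by simpa using hS 0
  have heS : ∀ i, e i ≤ S := fun i =>
    (Finset.single_le_sum (f := e) (fun j _ => he0 j) (Finset.self_mem_range_succ i)).trans (hS _)
  have main : ∀ n, uN E r (N 0) - 3 * (uN E r (N 0) - uN E r (2 * N 0)) -
      7 * ∑ i ∈ Finset.range n, e i ≤ uN E r (N n) - 3 * (uN E r (N n) - uN E r (2 * N n)) ∧
      uN E r (N n) - uN E r (2 * N n) ≤ κ := by
    intro n
    induction n with
    | zero =>
      refine ⟨by simp, ?_⟩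
      linarith [hγ0 _ (hNpos 0)]
    | succ n ih =>
      obtain ⟨h1, h2⟩ := ih
      have h3 := hS n
      have h4 := hγ0 _ (hNpos n)
      obtain ⟨s1, s2⟩ := hE.step hη hΛ hκ (hκN n) hσ (hσN n) (hNl n) h2 (by linarith) (hm n)
      rw [← hNm] at s1 s2
      have h5 := heS n
      simp only [he] at h5
      rw [Finset.sum_range_succ]
      have h6 : e n = 1 / N n + costConst η Λ κ * cost r (N n) := rfl
      have h7 := hγ0 _ (hNpos 0)
      constructor <;> linarith
  have h1 := (main n).1
  have h3 := hS n
  have h4 := hγ0 _ (hNpos n)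
  linarith

end Win

lemma dn_eq_of_lt {x : ℝ} {p : ℤ} (h : |x - p| < 1 / 2) : dn x = |x - p| := by
  have h2 := abs_sub_round x
  have h3 : |((p - round x : ℤ) : ℝ)| < 1 := by
    have e : ((p - round x : ℤ) : ℝ) = (x - round x) - (x - p) := by push_cast; ring
    have hle : dn x ≤ |x - p| := dn_le_abs_sub x p
    rw [e]
    unfold dn at hle
    calc _ ≤ |x - round x| + |x - p| := abs_sub _ _
      _ < 1 := by linarith
  have h4 : |p - round x| < 1 := by exact_mod_cast h3
  rw [Int.abs_lt_one_iff] at h4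
  unfold dn
  rw [show p = round x by omega]

lemma dn_pos_of_irrational {r : ℝ} (hr : Irrational r) {k : ℕ} (hk : 0 < k) : 0 < dn (k * r) := by
  unfold dn
  rw [abs_pos, sub_ne_zero]
  exact (hr.natCast_mul hk.ne').ne_int _

/-- `q` is the denominator, in lowest terms, of the closest fraction to `r` with denominator `q`. -/
def Prim (r : ℝ) (q : ℕ) : Prop := ∃ p : ℤ, IsCoprime (q : ℤ) p ∧ |q * r - p| = dn (q * r)

/-- Two close denominators cannot both approximate too well. -/
lemma Prim.dvd_of_lt {r : ℝ} {q q' : ℕ} (h : Prim r q)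
    (hlt : q * dn (q' * r) + q' * dn (q * r) < 1) : q ∣ q' := by
  obtain ⟨p, hp, hpd⟩ := h
  set p' := round (q' * r) with hp'
  have e : (((q : ℤ) * p' - q' * p : ℤ) : ℝ) = q' * (q * r - p) - q * (q' * r - p') := by
    push_cast; ring
  have h1 : |(((q : ℤ) * p' - q' * p : ℤ) : ℝ)| < 1 := by
    rw [e]
    refine (abs_sub _ _).trans_lt ?_
    rw [abs_mul, abs_mul, hpd, Nat.abs_cast, Nat.abs_cast]
    unfold dn at hlt ⊢
    rw [← hp'] at hlt
    linarith
  have h2 : |(q : ℤ) * p' - q' * p| < 1 := by exact_mod_cast h1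
  rw [Int.abs_lt_one_iff] at h2
  have h3 : (q : ℤ) ∣ q' * p := ⟨p', by linarith⟩
  exact Int.natCast_dvd_natCast.1 (hp.dvd_of_dvd_mul_right h3)

/-- Reduction of `k` to a primitive divisor. -/
lemma exists_prim {r : ℝ} {k : ℕ} (hk : 0 < k) (hd : dn (k * r) < 1 / 2) :
    ∃ g q : ℕ, k = g * q ∧ 0 < g ∧ 0 < q ∧ Prim r q ∧ dn (q * r) ≤ dn (k * r) := by
  set P := round (k * r) with hP
  set g := Int.gcd k P with hg
  have hg0 : 0 < g := Int.gcd_pos_of_ne_zero_left _ (by exact_mod_cast hk.ne')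
  obtain ⟨q, hq⟩ : g ∣ k := by
    have := Int.gcd_dvd_left (k : ℤ) P
    exact Int.natCast_dvd_natCast.1 this
  obtain ⟨p, hp⟩ : (g : ℤ) ∣ P := Int.gcd_dvd_right (k : ℤ) P
  have hq0 : 0 < q := Nat.pos_of_ne_zero fun h => by simp [h] at hq; omega
  have hgR : (1:ℝ) ≤ g := by exact_mod_cast hg0
  have hle : |q * r - p| ≤ dn (k * r) := by
    have : dn (k * r) = g * |q * r - p| := by
      unfold dn
      have e : (k:ℝ) * r - (P : ℝ) = g * (q * r - p) := by
        rw [hp, hq]; push_cast; ring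
      rw [← hP, e, abs_mul, Nat.abs_cast]
    rw [this]
    nlinarith [abs_nonneg (q * r - p)]
  have heq := dn_eq_of_lt (hle.trans_lt hd)
  refine ⟨g, q, hq, hg0, hq0, ⟨p, ?_, heq.symm⟩, heq ▸ hle⟩
  rw [Int.isCoprime_iff_gcd_eq_one]
  have h5 : Int.gcd ((g : ℤ) * q) (g * p) = g := by
    rw [← hp, ← Nat.cast_mul, ← hq]
  rw [Int.gcd_mul_left, Int.natAbs_natCast] at h5
  exact Nat.eq_of_mul_eq_mul_left hg0 (by omega)

lemma exists_jump {C σ r : ℝ} (hr : Irrational r) {N : ℕ} (hN : 1 ≤ σ * N) (hσ : 0 < σ) :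
    ∃ m : ℕ, Jump C σ r N m ∧
      ∀ q : ℕ, 0 < q → q ≤ σ * N → Real.exp (-(C * N)) ≤ 4 * (m * N) * dn (q * r) := by
  have hN0 : (0:ℝ) < N := by
    by_contra h
    nlinarith
  obtain ⟨q₀, hq₀, hmin⟩ := Finset.exists_min_image (Finset.Icc 1 ⌊σ * N⌋₊)
    (fun q : ℕ => dn (q * r)) ⟨1, by simp [Nat.le_floor_iff (by linarith : 0 ≤ σ * N), hN]⟩
  rw [Finset.mem_Icc, Nat.le_floor_iff (by linarith)] at hq₀
  have ht := dn_pos_of_irrational hr (k := q₀) (by omega)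
  set t := dn (q₀ * r)
  set x := Real.exp (-(C * N)) / (2 * N * t) with hx
  have hx0 : 0 ≤ x := by positivity
  have hxe : x * (2 * N * t) = Real.exp (-(C * N)) := by
    rw [hx]; field_simp
  refine ⟨max 4 ⌊x⌋₊, ⟨le_max_left _ _, ?_⟩, fun q hq hqN => ?_⟩
  · rcases le_total ⌊x⌋₊ 4 with h | h
    · left; exact max_eq_left h
    · right
      refine ⟨q₀, by omega, hq₀.2, ?_⟩
      rw [max_eq_right h, ← hxe]
      have := Nat.floor_le hx0
      have h2 : 0 ≤ 2 * N * t := by positivity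
      nlinarith
  · have hqt : t ≤ dn (q * r) := hmin q (by
      rw [Finset.mem_Icc, Nat.le_floor_iff (by linarith)]; exact ⟨hq, hqN⟩)
    have h1 : x ≤ 2 * ((max 4 ⌊x⌋₊ : ℕ) : ℝ) := by
      have h2 := Nat.lt_floor_add_one x
      have h3 : ((4:ℕ):ℝ) ≤ ((max 4 ⌊x⌋₊ : ℕ) : ℝ) := Nat.cast_le.2 (le_max_left _ _)
      have h4 : ((⌊x⌋₊:ℕ):ℝ) ≤ ((max 4 ⌊x⌋₊ : ℕ) : ℝ) := Nat.cast_le.2 (le_max_right _ _)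
      rw [Nat.cast_ofNat] at h3
      linarith
    generalize ((max 4 ⌊x⌋₊ : ℕ) : ℝ) = M at h1 ⊢
    have hM : 0 ≤ M := by linarith
    calc Real.exp (-(C * N)) = x * (2 * N * t) := hxe.symm
      _ ≤ (2 * M) * (2 * N * t) := by gcongr
      _ = 4 * (M * N) * t := by ring
      _ ≤ _ := by gcongr

/-- A sequence of scales built from admissible multipliers which jump as far as possible. -/
structure Scales (C σ r : ℝ) (N m : ℕ → ℕ) : Prop where
  step : ∀ i, N (i + 1) = m i * N i
  jump : ∀ i, Jump C σ r (N i) (m i)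
  far : ∀ i, ∀ q : ℕ, 0 < q → q ≤ σ * N i →
    Real.exp (-(C * N i)) ≤ 4 * N (i + 1) * dn (q * r)
  pos : 0 < N 0

lemma exists_scales {C σ r : ℝ} (hr : Irrational r) (hσ : 0 < σ) {N₀ : ℕ} (hN : 1 ≤ σ * N₀) :
    ∃ N m : ℕ → ℕ, N 0 = N₀ ∧ Scales C σ r N m := by
  have H : ∀ n : ℕ, ∃ m : ℕ, 4 ≤ m ∧ (1 ≤ σ * n → Jump C σ r n m ∧
      ∀ q : ℕ, 0 < q → q ≤ σ * n → Real.exp (-(C * n)) ≤ 4 * (m * n) * dn (q * r)) := by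
    intro n
    by_cases h : 1 ≤ σ * n
    · obtain ⟨m, hm, hm'⟩ := exists_jump (C := C) hr h hσ
      exact ⟨m, hm.1, fun _ => ⟨hm, hm'⟩⟩
    · exact ⟨4, le_rfl, fun h' => absurd h' h⟩
  choose f hf4 hf using H
  set N : ℕ → ℕ := fun i => Nat.rec N₀ (fun _ x => f x * x) i with hNdef
  have hs : ∀ i, N (i + 1) = f (N i) * N i := fun i => rfl
  have hge : ∀ i, 1 ≤ σ * N i := by
    intro i
    induction i with
    | zero => exact hN
    | succ i ih =>
      have h4 : (1:ℝ) ≤ f (N i) := by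
        have := hf4 (N i)
        exact_mod_cast (by omega : 1 ≤ f (N i))
      rw [hs]; push_cast
      nlinarith
  refine ⟨N, fun i => f (N i), rfl, hs, fun i => (hf _ (hge i)).1, fun i q hq hqN => ?_, ?_⟩
  · rw [hs]; push_cast
    exact (hf _ (hge i)).2 q hq hqN
  · by_contra h
    have : N 0 = 0 := by omega
    have := hge 0
    simp_all
    linarith

/-- Number of indices `i < n` with `a i ≤ 1`. -/
def cnt (a : ℕ → ℝ) (n : ℕ) : ℝ := ∑ i ∈ Finset.range n, if a i ≤ 1 then 1 else 0

lemma cnt_le {a : ℕ → ℝ} {B : ℝ} (hB : ∀ i : ℕ, B ≤ i → 1 < a i) (n : ℕ) (hB0 : 0 ≤ B) :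
    cnt a n ≤ B + 1 := by
  unfold cnt
  rw [Finset.sum_boole]
  have h : (Finset.range n).filter (fun i => a i ≤ 1) ⊆ Finset.range ⌈B⌉₊ := by
    intro i hi
    rw [Finset.mem_filter] at hi
    rw [Finset.mem_range]
    by_contra hc
    have := hB i ((Nat.le_ceil B).trans (by exact_mod_cast not_lt.1 hc))
    linarith [hi.2]
  have h2 := Finset.card_le_card h
  rw [Finset.card_range] at h2
  have h3 := Nat.ceil_lt_add_one hB0
  have h4 : (((Finset.range n).filter (fun i => a i ≤ 1)).card : ℝ) ≤ ⌈B⌉₊ := by exact_mod_cast h2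
  linarith

lemma cnt_anti {a b : ℕ → ℝ} (h : ∀ i, a i ≤ b i) (n : ℕ) : cnt b n ≤ cnt a n := by
  refine Finset.sum_le_sum fun i _ => ?_
  by_cases hb : b i ≤ 1
  · rw [if_pos hb, if_pos ((h i).trans hb)]
  · rw [if_neg hb]; split_ifs <;> norm_num

lemma geom_growth {a : ℕ → ℝ} (ha : ∀ i, 4 * a i ≤ a (i + 1)) (i j : ℕ) :
    4 ^ j * a i ≤ a (i + j) := by
  induction j with
  | zero => simp
  | succ j ih =>
    have := ha (i + j)
    rw [← add_assoc]
    rw [pow_succ]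
    linarith

lemma sum_inv_sq_le {a : ℕ → ℝ} (ha : ∀ i, 4 * a i ≤ a (i + 1)) (h0 : 0 < a 0) (n : ℕ) :
    ∑ i ∈ Finset.range n, (max 1 (a i))⁻¹ ^ 2 ≤ 2 * (a 0)⁻¹ ^ 2 := by
  have h1 : ∀ i, (max 1 (a i))⁻¹ ^ 2 ≤ (a 0)⁻¹ ^ 2 * (1 / 16 : ℝ) ^ i := by
    intro i
    have hg := geom_growth ha 0 i
    rw [zero_add] at hg
    have e : (a 0)⁻¹ ^ 2 * (1 / 16 : ℝ) ^ i = (4 ^ i * a 0)⁻¹ ^ 2 := by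
      rw [mul_inv, mul_pow, mul_comm]
      congr 1
      rw [← inv_pow, ← pow_mul, mul_comm i 2, pow_mul]
      norm_num
    rw [e]
    have hp : 0 < 4 ^ i * a 0 := by positivity
    refine pow_le_pow_left₀ (by positivity) (inv_anti₀ hp (hg.trans (le_max_right _ _))) 2
  calc _ ≤ ∑ i ∈ Finset.range n, (a 0)⁻¹ ^ 2 * (1 / 16 : ℝ) ^ i := Finset.sum_le_sum fun i _ => h1 i
    _ = (a 0)⁻¹ ^ 2 * ∑ i ∈ Finset.range n, (1 / 16 : ℝ) ^ i := by rw [Finset.mul_sum]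
    _ ≤ (a 0)⁻¹ ^ 2 * 2 := by
      refine mul_le_mul_of_nonneg_left ?_ (by positivity)
      have := (summable_geometric_of_lt_one (by norm_num : (0:ℝ) ≤ 1 / 16) (by norm_num)).sum_le_tsum
        (Finset.range n) (fun i _ => by positivity)
      rw [tsum_geometric_of_lt_one (by norm_num) (by norm_num)] at this
      refine this.trans (by norm_num)
    _ = _ := by ring

lemma sum_inv_sq_le_cnt (n : ℕ) : ∀ {a : ℕ → ℝ} (_ : ∀ i, 4 * a i ≤ a (i + 1)) (_ : 0 < a 0),
    ∑ i ∈ Finset.range n, (max 1 (a i))⁻¹ ^ 2 ≤ cnt a n + 2 := by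
  induction n with
  | zero => intro a _ _; simp [cnt]
  | succ n ih =>
    intro a ha h0
    by_cases h : a 0 ≤ 1
    · rw [Finset.sum_range_succ', cnt, Finset.sum_range_succ', if_pos h, max_eq_left h]
      have := ih (a := fun i => a (i + 1)) (fun i => ha (i + 1)) (by have := ha 0; simp; linarith)
      unfold cnt at this
      rw [inv_one, one_pow]
      linarith
    · refine (sum_inv_sq_le ha h0 _).trans ?_
      have h1 : 0 ≤ cnt a (n + 1) := Finset.sum_nonneg fun i _ => by split_ifs <;> norm_num
      have h2 : (a 0)⁻¹ ≤ 1 := inv_le_one_of_one_le₀ (by linarith)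
      have h3 : (a 0)⁻¹ ^ 2 ≤ 1 := pow_le_one₀ (by positivity) h2
      linarith

lemma sum_inv_le_of_sparse (K : ℕ) (hK : 0 < K) (n : ℕ) : ∀ (S : Finset ℕ), S.card = n →
    (∀ q ∈ S, K ≤ q) → (∀ q ∈ S, ∀ q' ∈ S, q < q' → 2 * q ≤ q') →
    ∑ q ∈ S, (q : ℝ)⁻¹ ≤ 2 * (K : ℝ)⁻¹ := by
  induction n generalizing K with
  | zero => intro S hS _ _; rw [Finset.card_eq_zero.1 hS]; simp
  | succ n ih =>
    intro S hS hK' hsp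
    have hne : S.Nonempty := Finset.card_pos.1 (by omega)
    set q₀ := S.min' hne
    have hq₀ : q₀ ∈ S := S.min'_mem hne
    rw [← Finset.add_sum_erase S _ hq₀]
    have h1 := ih (2 * q₀) (by have := hK' q₀ hq₀; omega) (S.erase q₀)
      (by rw [Finset.card_erase_of_mem hq₀]; omega)
      (fun q hq => hsp q₀ hq₀ q (Finset.mem_of_mem_erase hq)
        (lt_of_le_of_ne (S.min'_le _ (Finset.mem_of_mem_erase hq)) (Finset.ne_of_mem_erase hq).symm))
      (fun q hq q' hq' => hsp q (Finset.mem_of_mem_erase hq) q' (Finset.mem_of_mem_erase hq'))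
    have h2 : (q₀ : ℝ)⁻¹ ≤ (K : ℝ)⁻¹ :=
      inv_anti₀ (by exact_mod_cast hK) (by exact_mod_cast hK' q₀ hq₀)
    push_cast at h1
    rw [mul_inv] at h1
    linarith

namespace Scales

variable {C σ r : ℝ} {N m : ℕ → ℕ}

lemma four_mul_le (h : Scales C σ r N m) (i : ℕ) : 4 * (N i : ℝ) ≤ N (i + 1) := by
  rw [h.step]
  push_cast
  have : (4:ℝ) ≤ m i := by exact_mod_cast (h.jump i).1
  gcongr

lemma growth (h : Scales C σ r N m) {t : ℝ} (ht : 0 ≤ t) (i : ℕ) :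
    4 * (N i * t) ≤ N (i + 1) * t := by
  have := h.four_mul_le i
  nlinarith

lemma pow_le (h : Scales C σ r N m) (i j : ℕ) : 4 ^ j * (N i : ℝ) ≤ N (i + j) :=
  geom_growth (a := fun i => (N i : ℝ)) h.four_mul_le i j

lemma one_le (h : Scales C σ r N m) (i : ℕ) : (1:ℝ) ≤ N i := by
  have h1 := h.pow_le 0 i
  rw [zero_add] at h1
  have h2 : (1:ℝ) ≤ N 0 := by exact_mod_cast h.pos
  have h3 : (1:ℝ) ≤ 4 ^ i := one_le_pow₀ (by norm_num)
  nlinarith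

lemma mono (h : Scales C σ r N m) {i j : ℕ} (hij : i ≤ j) : (N i : ℝ) ≤ N j := by
  obtain ⟨k, rfl⟩ := Nat.exists_eq_add_of_le hij
  have h1 := h.pow_le i k
  have h3 : (1:ℝ) ≤ 4 ^ k := one_le_pow₀ (by norm_num)
  have := h.one_le i
  nlinarith

lemma exp_le_four_pow {x : ℝ} {j : ℕ} (hj : x ≤ j) : Real.exp x ≤ 4 ^ j := by
  calc Real.exp x ≤ Real.exp j := Real.exp_le_exp.2 hj
    _ = Real.exp 1 ^ j := by rw [← Real.exp_nat_mul, mul_one]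
    _ ≤ 4 ^ j := by
      gcongr
      linarith [Real.exp_one_lt_d9]

lemma cnt_le_of_exp (h : Scales C σ r N m) {t x : ℝ} (hx : 0 ≤ x) (ht : Real.exp (-x) ≤ t) (n : ℕ) :
    cnt (fun i => N i * t) n ≤ x + 2 := by
  have := cnt_le (a := fun i => N i * t) (B := x + 1) ?_ n (by linarith)
  · linarith
  intro i hi
  have h1 := h.pow_le 0 i
  rw [zero_add] at h1
  have h2 : (1:ℝ) ≤ N 0 := by exact_mod_cast h.pos
  have h3 : Real.exp (x + 1) ≤ 4 ^ i := exp_le_four_pow hi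
  have h4 : Real.exp (x + 1) ≤ N i := by
    have : (4:ℝ) ^ i ≤ 4 ^ i * N 0 := le_mul_of_one_le_right (by positivity) h2
    linarith
  show 1 < N i * t
  calc 1 < Real.exp 1 := by linarith [Real.add_one_lt_exp (one_ne_zero)]
    _ = Real.exp (x + 1) * Real.exp (-x) := by rw [← Real.exp_add]; ring_nf
    _ ≤ N i * t := by gcongr

lemma cnt_le_of_prim (h : Scales C σ r N m) (hr : Irrational r) (hC : 0 ≤ C) (hσ : 0 < σ)
    (hσ1 : σ ≤ 1) {q : ℕ} (hq : 0 < q) (hp : Prim r q) {L : ℝ} (hL : N 0 ≤ L * q) (n : ℕ) :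
    cnt (fun i => N i * dn (q * r)) n ≤ (σ⁻¹ + C * (L + 4 * σ⁻¹) + 5) * q := by
  have hq1 : (1:ℝ) ≤ q := by exact_mod_cast hq
  have ht := dn_pos_of_irrational hr hq
  set t := dn (q * r) with htd
  have hex : ∃ i, (q:ℝ) ≤ σ * N i := by
    obtain ⟨i, hi⟩ := pow_unbounded_of_one_lt (q * σ⁻¹) (by norm_num : (1:ℝ) < 4)
    refine ⟨i, ?_⟩
    have h1 := h.pow_le 0 i
    rw [zero_add] at h1
    have h2 : (1:ℝ) ≤ N 0 := by exact_mod_cast h.pos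
    have h3 : (4:ℝ) ^ i ≤ 4 ^ i * N 0 := le_mul_of_one_le_right (by positivity) h2
    have h4 : q * σ⁻¹ ≤ N i := by linarith
    rwa [← div_eq_mul_inv, div_le_iff₀' hσ] at h4
  classical
  set i₁ := Nat.find hex with hi₁
  have hi₁s : (q:ℝ) ≤ σ * N i₁ := Nat.find_spec hex
  have hi₁m : ∀ j < i₁, σ * N j < q := fun j hj => not_le.1 (Nat.find_min hex hj)
  have hi₁b : (i₁ : ℝ) ≤ q * σ⁻¹ + 1 := by
    rcases Nat.eq_zero_or_pos i₁ with h0 | h0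
    · rw [h0]; simp; positivity
    · obtain ⟨j, hj⟩ : ∃ j, i₁ = j + 1 := ⟨i₁ - 1, by omega⟩
      have h1 := hi₁m j (by omega)
      have h2 := h.pow_le 0 j
      rw [zero_add] at h2
      have h3 : (1:ℝ) ≤ N 0 := by exact_mod_cast h.pos
      have h4 : (j:ℝ) ≤ 4 ^ j := by exact_mod_cast (Nat.lt_pow_self (by norm_num : 1 < 4)).le
      have h5 : (4:ℝ) ^ j ≤ 4 ^ j * N 0 := le_mul_of_one_le_right (by positivity) h3
      have h6 : (N j : ℝ) ≤ q * σ⁻¹ := by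
        rw [← div_eq_mul_inv, le_div_iff₀' hσ]; exact h1.le
      rw [hj]; push_cast; linarith
  have hLL : 0 ≤ L := by
    by_contra hc
    have : (1:ℝ) ≤ N 0 := h.one_le 0
    nlinarith
  have hσi : 0 < σ⁻¹ := by positivity
  by_cases hbig : 1 < N i₁ * t
  · have := cnt_le (a := fun i => N i * t) (B := i₁) (fun i hi => ?_) n (by positivity)
    · have h7 : 0 ≤ C * (L + 4 * σ⁻¹) := by positivity
      nlinarith
    · have := h.mono (Nat.cast_le.1 hi)
      show 1 < N i * t
      nlinarith
  rw [not_lt] at hbig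
  have hNb : (N i₁ : ℝ) ≤ (L + 4 * σ⁻¹) * q := by
    rcases Nat.eq_zero_or_pos i₁ with h0 | h0
    · rw [h0]
      have : 0 ≤ 4 * σ⁻¹ * q := by positivity
      linarith
    · obtain ⟨j, hj⟩ : ∃ j, i₁ = j + 1 := ⟨i₁ - 1, by omega⟩
      have h1 := hi₁m j (by omega)
      have hst := h.step j
      rw [hj] at hbig hi₁s ⊢
      rcases (h.jump j).2 with h4 | ⟨q', hq'0, hq', hq't⟩
      · rw [hst, h4]
        push_cast
        have h6 : (N j : ℝ) ≤ q * σ⁻¹ := by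
          rw [← div_eq_mul_inv, le_div_iff₀' hσ]; exact h1.le
        have : 0 ≤ L * q := by positivity
        linarith
      · exfalso
        have hlt : q' < q := by exact_mod_cast hq'.trans_lt h1
        have e1 : Real.exp (-(C * N j)) ≤ 1 := Real.exp_le_one_iff.2 (by
          have := h.one_le j
          nlinarith)
        have e2 : 2 * (N (j + 1) * dn (q' * r)) ≤ 1 := by
          rw [hst]; push_cast; linarith
        have e3 : (q:ℝ) ≤ N (j + 1) := by
          have := h.one_le (j + 1)
          nlinarith
        have e4 : 4 * (q':ℝ) ≤ N (j + 1) := by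
          have := h.four_mul_le j
          have := h.one_le j
          nlinarith
        have hdv := hp.dvd_of_lt (q' := q') (by
          have := dn_nonneg (q' * r)
          nlinarith)
        have := Nat.le_of_dvd hq'0 hdv
        omega
  have hfar := h.far i₁ q hq hi₁s
  rw [← htd] at hfar
  set B : ℝ := i₁ + 2 + (C * N i₁ + 1) with hB
  have hN1 := h.one_le i₁
  have hCN : 0 ≤ C * N i₁ := by positivity
  have hcnt := cnt_le (a := fun i => N i * t) (B := B) (fun i hi => ?_) n (by positivity)
  · have : C * N i₁ ≤ C * ((L + 4 * σ⁻¹) * q) := by gcongr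
    rw [hB] at hcnt
    nlinarith
  · have hi' : i₁ + 2 ≤ i := by
      have : ((i₁ + 2 : ℕ):ℝ) ≤ i := by push_cast; linarith
      exact_mod_cast this
    obtain ⟨j, hj⟩ := Nat.exists_eq_add_of_le hi'
    have hj1 : C * N i₁ + 1 ≤ j := by
      rw [hj] at hi; push_cast at hi; linarith
    have h1 := exp_le_four_pow hj1
    have h2 := h.pow_le (i₁ + 1) (j + 1)
    rw [show i₁ + 1 + (j + 1) = i by omega] at h2
    show 1 < N i * t
    calc 1 < Real.exp 1 := by linarith [Real.add_one_lt_exp (one_ne_zero)]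
      _ = Real.exp (C * N i₁ + 1) * Real.exp (-(C * N i₁)) := by rw [← Real.exp_add]; ring_nf
      _ ≤ 4 ^ j * (4 * N (i₁ + 1) * t) := by gcongr
      _ = (4 ^ (j + 1) * N (i₁ + 1)) * t := by ring
      _ ≤ N i * t := by gcongr

end Scales

/-- The tail terms in the bound for the total cost. -/
def tailTerm (k : ℕ) : ℝ := ((k : ℝ) + 1)⁻¹ ^ 2 * (√((k : ℝ) + 1) + 4)

lemma tailTerm_nonneg (k : ℕ) : 0 ≤ tailTerm k := by unfold tailTerm; positivity

lemma summable_tailTerm : Summable tailTerm := by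
  have h1 : Summable (fun n : ℕ => 5 * (1 / ((n + 1 : ℕ) : ℝ) ^ (3 / 2 : ℝ))) :=
    (((summable_nat_add_iff 1).2 (Real.summable_one_div_nat_rpow.2 (by norm_num : (1:ℝ) < 3 / 2)))).mul_left 5
  refine Summable.of_nonneg_of_le tailTerm_nonneg (fun k => ?_) h1
  unfold tailTerm
  push_cast
  set x : ℝ := (k:ℝ) + 1 with hx
  have hx1 : 1 ≤ x := by rw [hx]; linarith [(Nat.cast_nonneg k : (0:ℝ) ≤ k)]
  have hs : 1 ≤ √x := Real.one_le_sqrt.2 hx1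
  have e : x ^ (3 / 2 : ℝ) = x * √x := by
    rw [show (3 / 2 : ℝ) = 1 + 1 / 2 by norm_num, Real.rpow_add (by linarith), Real.rpow_one,
      Real.sqrt_eq_rpow]
  rw [e]
  have hsq : √x * √x = x := Real.mul_self_sqrt (by linarith)
  rw [inv_pow, ← div_eq_inv_mul, ← mul_div_assoc, mul_one, div_le_div_iff₀ (by positivity) (by positivity)]
  have h5 : (√x + 4) * (x * √x) ≤ (5 * √x) * (x * √x) := by gcongr; linarith
  nlinarith

lemma sparse_of_prim {r : ℝ} {K : ℕ} (hK : ∀ q : ℕ, K ≤ q → 3 * q * Real.exp (-√q) < 1)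
    {q q' : ℕ} (hq : Prim r q) (hKq : K ≤ q) (h : dn (q * r) < Real.exp (-√q))
    (h' : dn (q' * r) < Real.exp (-√q')) (hlt : q < q') : 2 * q ≤ q' := by
  by_contra hc
  have h1 : Real.exp (-√q') ≤ Real.exp (-√q) :=
    Real.exp_le_exp.2 (neg_le_neg (Real.sqrt_le_sqrt (by exact_mod_cast hlt.le)))
  have h2 : (q':ℝ) ≤ 2 * q := by exact_mod_cast (by omega : q' ≤ 2 * q)
  have h3 := hK q hKq
  have hdv := hq.dvd_of_lt (q' := q') (by
    have e1 : (q:ℝ) * dn (q' * r) ≤ q * Real.exp (-√q) := by gcongr; linarith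
    have e2 : (q':ℝ) * dn (q * r) ≤ (2 * q) * Real.exp (-√q) := by
      have := dn_nonneg (q * r)
      gcongr
    linarith)
  obtain ⟨c, rfl⟩ := hdv
  have : c < 2 := by
    by_contra hc2
    have := Nat.mul_le_mul_left q (not_lt.1 hc2)
    omega
  interval_cases c <;> omega

namespace Scales

variable {C σ r : ℝ} {N m : ℕ → ℕ}

set_option maxHeartbeats 1000000 in
lemma sum_cost_le (h : Scales C σ r N m) (hr : Irrational r) (hC : 0 ≤ C) (hσ : 0 < σ)
    (hσ1 : σ ≤ 1) {K : ℕ} (hK0 : 0 < K) (hK : ∀ q : ℕ, K ≤ q → 3 * q * Real.exp (-√q) < 1)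
    {L l τ : ℝ} (hL : N 0 ≤ L * K) (hl : 1 < l) (hd : ∀ k : ℕ, 0 < k → k < K → l ≤ N 0 * dn (k * r))
    (hτ : ∀ F : Finset ℕ, (∀ k ∈ F, K ≤ k + 1) → ∑ k ∈ F, tailTerm k ≤ τ) (n : ℕ) :
    ∑ i ∈ Finset.range n, cost r (N i) ≤ 2 * l⁻¹ ^ 2 * (∑' k : ℕ, ((k:ℝ) + 1)⁻¹ ^ 2) + τ +
      (σ⁻¹ + C * (L + 4 * σ⁻¹) + 5) * ((∑' k : ℕ, ((k:ℝ) + 1)⁻¹ ^ 2) * (2 * (K:ℝ)⁻¹)) := by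
  classical
  set A := ∑' k : ℕ, ((k:ℝ) + 1)⁻¹ ^ 2 with hA
  set C₁ := σ⁻¹ + C * (L + 4 * σ⁻¹) + 5 with hC₁
  have hLL : 0 ≤ L := by
    by_contra hc
    have h1 : (1:ℝ) ≤ N 0 := h.one_le 0
    have h2 : (0:ℝ) < K := by exact_mod_cast hK0
    nlinarith
  have hC₁0 : 0 ≤ C₁ := by positivity
  unfold cost
  rw [← Summable.tsum_finsetSum (fun i _ => summable_cost r (N i))]
  refine Real.tsum_le_of_sum_range_le (fun k => Finset.sum_nonneg fun i _ => by positivity)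
    fun n' => ?_
  set Q : ℕ → Prop := fun q => Prim r q ∧ K ≤ q ∧ dn (q * r) < Real.exp (-√q) with hQ
  set Bs := (Finset.range n').filter (fun k => ∃ g q : ℕ, k + 1 = g * q ∧ 0 < g ∧ Q q ∧
    dn (q * r) ≤ dn ((k + 1 : ℕ) * r)) with hBs
  have hex : ∀ k, k ∈ Bs → ∃ g q : ℕ, k + 1 = g * q ∧ 0 < g ∧ Q q ∧
      dn (q * r) ≤ dn ((k + 1 : ℕ) * r) := fun k hk => (Finset.mem_filter.1 hk).2
  choose! g q hgq hg0 hQq hdq using hex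
  set T : ℕ → ℝ := fun k => ∑ i ∈ Finset.range n, (max 1 (N i * dn ((k + 1 : ℕ) * r)))⁻¹ ^ 2 with hT
  have htpos : ∀ k : ℕ, 0 < dn ((k + 1 : ℕ) * r) := fun k => dn_pos_of_irrational hr (by omega)
  have hN0 : (1:ℝ) ≤ N 0 := h.one_le 0
  have hTcnt : ∀ k, T k ≤ cnt (fun i => N i * dn ((k + 1 : ℕ) * r)) n + 2 := fun k =>
    sum_inv_sq_le_cnt n (fun i => h.growth (htpos k).le i) (by have := htpos k; positivity)
  have key : ∀ k ∈ Finset.range n', ((k:ℝ) + 1)⁻¹ ^ 2 * T k ≤ ((k:ℝ) + 1)⁻¹ ^ 2 * (2 * l⁻¹ ^ 2) +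
      (if K ≤ k + 1 then tailTerm k else 0) +
      (if k ∈ Bs then ((k:ℝ) + 1)⁻¹ ^ 2 * (C₁ * q k) else 0) := by
    intro k hk
    have hthird : 0 ≤ (if k ∈ Bs then ((k:ℝ) + 1)⁻¹ ^ 2 * (C₁ * q k) else 0) := by
      split_ifs <;> positivity
    have hsecond : 0 ≤ (if K ≤ k + 1 then tailTerm k else 0) := by
      split_ifs
      · exact tailTerm_nonneg k
      · exact le_rfl
    have hfirst : 0 ≤ ((k:ℝ) + 1)⁻¹ ^ 2 * (2 * l⁻¹ ^ 2) := by positivity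
    by_cases hkK : K ≤ k + 1
    · rw [if_pos hkK]
      have hcast : ((k + 1 : ℕ) : ℝ) = (k:ℝ) + 1 := by push_cast; ring
      have hle : ∀ {B : ℝ}, cnt (fun i => N i * dn ((k + 1 : ℕ) * r)) n ≤ B →
          ((k:ℝ) + 1)⁻¹ ^ 2 * T k ≤ ((k:ℝ) + 1)⁻¹ ^ 2 * (B + 2) := fun hB =>
        mul_le_mul_of_nonneg_left (by linarith [hTcnt k]) (by positivity)
      have hs0 := Real.sqrt_nonneg ((k:ℝ) + 1)
      by_cases hsm : Real.exp (-√((k + 1 : ℕ) : ℝ)) ≤ dn ((k + 1 : ℕ) * r)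
      · have := hle (h.cnt_le_of_exp (Real.sqrt_nonneg _) hsm n)
        rw [hcast] at this
        have e : tailTerm k = ((k:ℝ) + 1)⁻¹ ^ 2 * (√((k:ℝ) + 1) + 2 + 2) := by
          unfold tailTerm; ring
        linarith
      · rw [not_le] at hsm
        have hhalf : Real.exp (-√((k + 1 : ℕ) : ℝ)) ≤ 1 / 2 := by
          have h1 : (1:ℝ) ≤ √((k + 1 : ℕ) : ℝ) := Real.one_le_sqrt.2 (by push_cast; linarith [(Nat.cast_nonneg k : (0:ℝ) ≤ k)])
          rw [Real.exp_neg, inv_eq_one_div]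
          refine one_div_le_one_div_of_le (by norm_num) ?_
          linarith [Real.add_one_le_exp (√((k + 1 : ℕ) : ℝ))]
        obtain ⟨g', q', hk', hg', hq', hp', hd'⟩ := exists_prim (by omega) (hsm.trans_le hhalf)
        have htail : ((k:ℝ) + 1)⁻¹ ^ 2 * 2 ≤ tailTerm k := by
          unfold tailTerm
          exact mul_le_mul_of_nonneg_left (by linarith) (by positivity)
        by_cases hqK : K ≤ q'
        · have hkB : k ∈ Bs := by
            refine Finset.mem_filter.2 ⟨hk, g', q', hk', hg', ⟨hp', hqK, ?_⟩, hd'⟩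
            refine hd'.trans_lt (hsm.trans_le (Real.exp_le_exp.2 (neg_le_neg (Real.sqrt_le_sqrt ?_))))
            rw [hk']
            exact_mod_cast Nat.le_mul_of_pos_left q' hg'
          rw [if_pos hkB]
          have hQ := hQq k hkB
          have hqpos : 0 < q k := by have := hQ.2.1; omega
          have hb : cnt (fun i => N i * dn ((k + 1 : ℕ) * r)) n ≤ C₁ * q k := by
            refine (cnt_anti (fun i => ?_) n).trans
              (h.cnt_le_of_prim hr hC hσ hσ1 hqpos hQ.1 (L := L) ?_ n)
            · exact mul_le_mul_of_nonneg_left (hdq k hkB) (by positivity)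
            · refine hL.trans ?_
              have : (K:ℝ) ≤ q k := by exact_mod_cast hQ.2.1
              gcongr
          have := hle hb
          rw [mul_add] at this
          linarith
        · have h1 := hd q' hq' (by omega)
          have hb : cnt (fun i => N i * dn ((k + 1 : ℕ) * r)) n ≤ 0 := by
            refine (Finset.sum_eq_zero fun i _ => if_neg ?_).le
            rw [not_le]
            have h2 := h.mono (Nat.zero_le i)
            have h3 : N 0 * dn (q' * r) ≤ N i * dn ((k + 1 : ℕ) * r) := by
              have := dn_nonneg (q' * r)
              gcongr
            linarith
          have := hle hb
          rw [zero_add] at this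
          linarith
    · have h1 := hd (k + 1) (by omega) (by omega)
      have h2 : T k ≤ 2 * l⁻¹ ^ 2 := by
        refine (sum_inv_sq_le (a := fun i => N i * dn ((k + 1 : ℕ) * r))
          (fun i => h.growth (htpos k).le i) (by have := htpos k; positivity) n).trans ?_
        have : (N 0 * dn ((k + 1 : ℕ) * r))⁻¹ ≤ l⁻¹ := inv_anti₀ (by linarith) h1
        have h3 := htpos k
        gcongr
      have := mul_le_mul_of_nonneg_left h2 (by positivity : 0 ≤ ((k:ℝ) + 1)⁻¹ ^ 2)
      linarith
  have hsA : ∀ F : Finset ℕ, ∑ k ∈ F, ((k:ℝ) + 1)⁻¹ ^ 2 ≤ A := fun F =>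
    summable_inv_succ_sq.sum_le_tsum F fun k _ => by positivity
  calc _ = ∑ k ∈ Finset.range n', ((k:ℝ) + 1)⁻¹ ^ 2 * T k := by
        refine Finset.sum_congr rfl fun k _ => ?_
        rw [hT, Finset.mul_sum]
    _ ≤ _ := Finset.sum_le_sum key
    _ = (∑ k ∈ Finset.range n', ((k:ℝ) + 1)⁻¹ ^ 2) * (2 * l⁻¹ ^ 2) +
        ∑ k ∈ (Finset.range n').filter (fun k => K ≤ k + 1), tailTerm k +
        ∑ k ∈ Bs, ((k:ℝ) + 1)⁻¹ ^ 2 * (C₁ * q k) := by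
        rw [Finset.sum_add_distrib, Finset.sum_add_distrib, ← Finset.sum_mul, ← Finset.sum_filter,
          ← Finset.sum_filter]
        congr 1
        refine Finset.sum_congr ?_ fun _ _ => rfl
        ext k
        simp only [Finset.mem_filter, hBs]
        tauto
    _ ≤ A * (2 * l⁻¹ ^ 2) + τ + C₁ * (A * (2 * (K:ℝ)⁻¹)) := by
        refine add_le_add (add_le_add (mul_le_mul_of_nonneg_right (hsA _) (by positivity))
          (hτ _ fun k hk => (Finset.mem_filter.1 hk).2)) ?_
        set S := (Finset.range (n' + 1)).filter Q with hS
        have e1 : ∀ k ∈ Bs, ((k:ℝ) + 1)⁻¹ ^ 2 * (C₁ * q k) =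
            C₁ * ((fun p : ℕ × ℕ => ((p.1:ℝ) + 1)⁻¹ ^ 2 * (p.2:ℝ)⁻¹) (g k - 1, q k)) := by
          intro k hk
          have hq0 : (0:ℝ) < q k := by
            have := (hQq k hk).2.1
            exact_mod_cast (by omega : 0 < q k)
          have hgc : ((g k - 1 : ℕ) : ℝ) + 1 = g k := by
            have := hg0 k hk
            exact_mod_cast (by omega : g k - 1 + 1 = g k)
          have hkc : (k:ℝ) + 1 = g k * q k := by exact_mod_cast hgq k hk
          simp only [hgc, hkc]
          field_simp
        have hinj : Set.InjOn (fun k => (g k - 1, q k)) Bs := by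
          intro k hk k' hk' he
          simp only [Prod.mk.injEq] at he
          have h1 := hgq k hk
          have h2 := hgq k' hk'
          have h3 := hg0 k hk
          have h4 := hg0 k' hk'
          have h5 : g k = g k' := by omega
          rw [h5, he.2, ← h2] at h1
          omega
        rw [Finset.sum_congr rfl e1, ← Finset.mul_sum]
        refine mul_le_mul_of_nonneg_left ?_ hC₁0
        rw [← Finset.sum_image (f := fun p : ℕ × ℕ => ((p.1:ℝ) + 1)⁻¹ ^ 2 * (p.2:ℝ)⁻¹) hinj]
        calc _ ≤ ∑ p ∈ Finset.range n' ×ˢ S, ((p.1:ℝ) + 1)⁻¹ ^ 2 * (p.2:ℝ)⁻¹ := by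
              refine Finset.sum_le_sum_of_subset_of_nonneg ?_ fun p _ _ => by positivity
              intro p hp
              obtain ⟨k, hk, rfl⟩ := Finset.mem_image.1 hp
              have h1 := hgq k hk
              have h2 := hg0 k hk
              have h3 : k < n' := Finset.mem_range.1 (Finset.mem_filter.1 hk).1
              have h4 : 0 < q k := by have := (hQq k hk).2.1; omega
              have h5 : g k ≤ g k * q k := Nat.le_mul_of_pos_right _ h4
              have h6 : q k ≤ g k * q k := Nat.le_mul_of_pos_left _ h2
              simp only [Finset.mem_product, Finset.mem_range, hS, Finset.mem_filter]
              exact ⟨by omega, by omega, hQq k hk⟩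
          _ = (∑ a ∈ Finset.range n', ((a:ℝ) + 1)⁻¹ ^ 2) * ∑ b ∈ S, (b:ℝ)⁻¹ := by
              rw [Finset.sum_product, Finset.sum_mul_sum]
          _ ≤ A * (2 * (K:ℝ)⁻¹) := by
              have hSsum : ∑ b ∈ S, (b:ℝ)⁻¹ ≤ 2 * (K:ℝ)⁻¹ := by
                refine sum_inv_le_of_sparse K hK0 _ S rfl (fun b hb => (Finset.mem_filter.1 hb).2.2.1)
                  fun b hb b' hb' hlt => ?_
                have h1 := (Finset.mem_filter.1 hb).2
                have h2 := (Finset.mem_filter.1 hb').2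
                exact sparse_of_prim hK h1.1 h1.2.1 h1.2.2 h2.2.2 hlt
              refine mul_le_mul (hsA _) hSsum (Finset.sum_nonneg fun b _ => by positivity)
                (tsum_nonneg fun k => by positivity)
    _ = _ := by ring

end Scales

lemma dn_le_dn_add (x y : ℝ) : dn x ≤ dn y + |x - y| := by
  refine (dn_le_abs_sub x (round y)).trans ?_
  unfold dn
  calc |x - round y| = |(x - y) + (y - round y)| := by ring_nf
    _ ≤ |x - y| + |y - round y| := abs_add_le _ _
    _ = _ := add_comm _ _

lemma exists_badly_approximated {β : ℝ} (hβ : Irrational β) (M : ℕ) :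
    ∃ K : ℕ, M ≤ K ∧ 0 < K ∧ ∀ k : ℕ, 0 < k → k < K → 1 / (4 * (K:ℝ)) ≤ dn (k * β) := by
  obtain ⟨q₀, hq₀, hmin⟩ := Finset.exists_min_image (Finset.Icc 1 (2 * M + 1))
    (fun q : ℕ => dn (q * β)) ⟨1, by simp⟩
  have hμ := dn_pos_of_irrational hβ (k := q₀) (by have := (Finset.mem_Icc.1 hq₀).1; omega)
  obtain ⟨n, hn⟩ := exists_nat_gt (dn (q₀ * β))⁻¹
  have hn0 : 0 < n := by
    have : (0:ℝ) < n := (inv_pos.2 hμ).trans hn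
    exact_mod_cast this
  obtain ⟨q, hq1, hq2⟩ := Real.exists_rat_abs_sub_le_and_den_le β hn0
  set d := q.den with hd
  have hd0 : 0 < d := q.den_pos
  have hdR : (0:ℝ) < d := by exact_mod_cast hd0
  have hqe : (q:ℝ) = q.num / d := by
    rw [hd]; exact_mod_cast (Rat.num_div_den q).symm
  have habs : |d * β - q.num| ≤ 1 / (n + 1) := by
    have e : d * β - q.num = d * (β - q) := by rw [hqe]; field_simp
    rw [e, abs_mul, Nat.abs_cast]
    calc d * |β - q| ≤ d * (1 / ((n + 1) * d)) := by gcongr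
      _ = _ := by field_simp
  have hdM : 2 * M + 1 < d := by
    by_contra hc
    have h1 := hmin d (Finset.mem_Icc.2 ⟨hd0, by omega⟩)
    have h2 := dn_le_abs_sub (d * β) q.num
    have h3 : dn (q₀ * β) ≤ 1 / (n + 1) := h1.trans (h2.trans habs)
    have h4 : 1 / (n + 1 : ℝ) < dn (q₀ * β) := by
      rw [div_lt_iff₀ (by positivity)]
      have : 1 < dn (q₀ * β) * n := by
        rw [inv_eq_one_div, div_lt_iff₀ hμ] at hn; linarith
      nlinarith
    linarith
  refine ⟨(d + 1) / 2, by omega, by omega, fun k hk hkK => ?_⟩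
  have hk2 : 2 * k < d := by omega
  have hkR : 2 * (k:ℝ) ≤ d := by exact_mod_cast hk2.le
  set j := round (k * β) with hj
  have hndvd : (k:ℤ) * q.num - d * j ≠ 0 := by
    intro h0
    have h1 : (d:ℤ) ∣ k * q.num := ⟨j, by linarith⟩
    have hco : IsCoprime (d:ℤ) q.num := by
      rw [Int.isCoprime_iff_gcd_eq_one]
      have := q.reduced
      rw [Nat.coprime_comm] at this
      simpa [Int.gcd] using this
    have h2 := Int.natCast_dvd_natCast.1 (hco.dvd_of_dvd_mul_right h1)
    have := Nat.le_of_dvd hk h2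
    omega
  have h1 : (1:ℝ) ≤ |(k:ℝ) * q.num - d * j| := by
    have := Int.one_le_abs hndvd
    exact_mod_cast this
  have e : (k:ℝ) * q.num - d * j = d * (k * β - j) - k * (d * β - q.num) := by ring
  have h2 : (1:ℝ) ≤ d * dn (k * β) + k * (1 / (n + 1)) := by
    calc (1:ℝ) ≤ _ := h1
      _ = |d * (k * β - j) - k * (d * β - q.num)| := by rw [e]
      _ ≤ |d * (k * β - j)| + |k * (d * β - q.num)| := abs_sub _ _
      _ ≤ _ := by
        rw [abs_mul, abs_mul, Nat.abs_cast, Nat.abs_cast]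
        unfold dn
        gcongr
  have h3 : (k:ℝ) * (1 / (n + 1)) ≤ 1 / 2 := by
    rw [mul_one_div, div_le_iff₀ (by positivity)]
    have : (d:ℝ) ≤ n := by exact_mod_cast hq2
    linarith
  have hK : (d:ℝ) ≤ 2 * (((d + 1) / 2 : ℕ) : ℝ) := by exact_mod_cast (by omega : d ≤ 2 * ((d + 1) / 2))
  rw [div_le_iff₀ (by linarith)]
  have := dn_nonneg (k * β)
  nlinarith

lemma exists_tail_bound {τ : ℝ} (hτ : 0 < τ) :
    ∃ K : ℕ, ∀ F : Finset ℕ, (∀ k ∈ F, K ≤ k) → ∑ k ∈ F, tailTerm k ≤ τ := by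
  obtain ⟨s, hs⟩ := summable_iff_vanishing_norm.1 summable_tailTerm τ hτ
  refine ⟨s.sup id + 1, fun F hF => ?_⟩
  have := hs F (Finset.disjoint_left.2 fun k hk hks => by
    have h1 := hF k hk
    have h2 : k ≤ s.sup id := Finset.le_sup (f := id) hks
    omega)
  exact (le_abs_self _).trans this.le

/-- Scales with small total cost exist, uniformly for frequencies close to an irrational one. -/
theorem exists_uniform_scales {C σ ε β : ℝ} (hC : 0 ≤ C) (hσ : 0 < σ) (hσ1 : σ ≤ 1) (hε : 0 < ε)
    (hβ : Irrational β) (Nmin : ℕ) : ∃ N₀ : ℕ, Nmin ≤ N₀ ∧ ∀ᶠ r in nhds β, Irrational r →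
      ∃ N m : ℕ → ℕ, N 0 = N₀ ∧ Scales C σ r N m ∧
        ∀ n, ∑ i ∈ Finset.range n, cost r (N i) ≤ ε := by
  set A := ∑' k : ℕ, ((k:ℝ) + 1)⁻¹ ^ 2 with hA
  have hA0 : 0 ≤ A := tsum_nonneg fun k => by positivity
  obtain ⟨l₀, hl₀⟩ := exists_nat_gt (6 * A / ε)
  set l : ℕ := l₀ + 2 with hl
  have hlR : (2:ℝ) ≤ l := by rw [hl]; push_cast; linarith [(Nat.cast_nonneg l₀ : (0:ℝ) ≤ l₀)]
  have hlA : 2 * (l:ℝ)⁻¹ ^ 2 * A ≤ ε / 3 := by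
    have h1 : 6 * A < l * ε := by
      rw [div_lt_iff₀ hε] at hl₀
      have : (l₀:ℝ) ≤ l := by rw [hl]; push_cast; linarith
      nlinarith
    have h2 : (l:ℝ)⁻¹ ^ 2 ≤ (l:ℝ)⁻¹ := by
      rw [sq]
      exact mul_le_of_le_one_left (by positivity) (inv_le_one_of_one_le₀ (by linarith))
    have h3 : (l:ℝ)⁻¹ * A ≤ ε / 6 := by
      rw [← div_eq_inv_mul, div_le_iff₀ (by linarith)]
      linarith
    nlinarith
  obtain ⟨K₁, hK₁⟩ := exists_tail_bound (show 0 < ε / 3 by linarith)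
  obtain ⟨K₂, hK₂⟩ : ∃ K₂ : ℕ, ∀ q : ℕ, K₂ ≤ q → 3 * q * Real.exp (-√q) < 1 := by
    have h1 : Tendsto (fun x : ℝ => x ^ 2 * Real.exp (-x)) atTop (nhds 0) :=
      Real.tendsto_pow_mul_exp_neg_atTop_nhds_zero 2
    have h2 := (h1.comp (Real.tendsto_sqrt_atTop.comp tendsto_natCast_atTop_atTop)).eventually
      (gt_mem_nhds (show (0:ℝ) < 1 / 3 by norm_num))
    obtain ⟨K₂, hK₂⟩ := eventually_atTop.1 h2
    refine ⟨K₂, fun q hq => ?_⟩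
    have := hK₂ q hq
    simp only [Function.comp_apply, Real.sq_sqrt (Nat.cast_nonneg q)] at this
    linarith
  set C₁ := σ⁻¹ + C * ((8 * l : ℕ) + 4 * σ⁻¹) + 5 with hC₁
  have hC₁0 : 0 ≤ C₁ := by positivity
  obtain ⟨K₃, hK₃⟩ := exists_nat_gt (6 * (C₁ * A) / ε)
  obtain ⟨K₄, hK₄⟩ := exists_nat_gt σ⁻¹
  obtain ⟨K, hKM, hK0, hKd⟩ := exists_badly_approximated hβ (K₁ + 1 + K₂ + K₃ + K₄ + Nmin)
  have hKR : (0:ℝ) < K := by exact_mod_cast hK0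
  have hKle : K ≤ 8 * l * K := by
    rw [hl]; nlinarith
  refine ⟨8 * l * K, by omega, ?_⟩
  have hnear : ∀ᶠ r in nhds β, |r - β| < 1 / (8 * (K:ℝ) ^ 2) := by
    have h0 : Tendsto (fun r : ℝ => |r - β|) (nhds β) (nhds 0) := by
      have : Continuous (fun r : ℝ => |r - β|) := by fun_prop
      simpa using this.tendsto β
    exact h0.eventually (gt_mem_nhds (by positivity))
  filter_upwards [hnear] with r hr hirr
  obtain ⟨N, m, hN0, hNm⟩ := exists_scales (C := C) hirr hσ (N₀ := 8 * l * K) (by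
    have h1 : (K₄:ℝ) ≤ ((8 * l * K : ℕ) : ℝ) := by exact_mod_cast (by omega : K₄ ≤ 8 * l * K)
    have h2 : σ⁻¹ ≤ ((8 * l * K : ℕ) : ℝ) := by linarith
    rwa [inv_eq_one_div, div_le_iff₀' hσ] at h2)
  refine ⟨N, m, hN0, hNm, fun n => ?_⟩
  have := hNm.sum_cost_le hirr hC hσ hσ1 hK0 (fun q hq => hK₂ q (by omega)) (L := (8 * l : ℕ)) (l := l)
    (τ := ε / 3) ?_ (by linarith) ?_ (fun F hF => hK₁ F fun k hk => by have := hF k hk; omega) n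
  · refine this.trans ?_
    have h5 : C₁ * (A * (2 * (K:ℝ)⁻¹)) ≤ ε / 3 := by
      have h6 : (K₃:ℝ) ≤ K := by exact_mod_cast (by omega : K₃ ≤ K)
      rw [div_lt_iff₀ hε] at hK₃
      rw [show C₁ * (A * (2 * (K:ℝ)⁻¹)) = 2 * (C₁ * A) / K by field_simp, div_le_iff₀ hKR]
      nlinarith
    linarith
  · rw [hN0]; push_cast; exact le_rfl
  · intro k hk hkK
    have h1 := hKd k hk hkK
    have h2 := dn_le_dn_add (k * β) (k * r)
    have h3 : |k * β - k * r| ≤ 1 / (8 * (K:ℝ)) := by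
      rw [← mul_sub, abs_mul, Nat.abs_cast, abs_sub_comm]
      have h4 : (k:ℝ) ≤ K := by exact_mod_cast hkK.le
      calc (k:ℝ) * |r - β| ≤ K * (1 / (8 * (K:ℝ) ^ 2)) := by gcongr
        _ = _ := by field_simp
    have h5 : 1 / (8 * (K:ℝ)) ≤ dn (k * r) := by
      have e : 1 / (4 * (K:ℝ)) = 1 / (8 * (K:ℝ)) + 1 / (8 * (K:ℝ)) := by field_simp; norm_num
      linarith
    rw [hN0]
    calc (l:ℝ) = ((8 * l * K : ℕ):ℝ) * (1 / (8 * (K:ℝ))) := by push_cast; field_simp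
      _ ≤ _ := by gcongr

section LogIntegral

variable {g : ℝ → ℝ}

/-- The integral of `log g` truncated from below at `-s`. -/
def truncInt (g : ℝ → ℝ) (s : ℝ) : ℝ := ∫ x in (0:ℝ)..1, Real.log (max (g x) (Real.exp (-s)))

lemma continuous_log_max (hg : Continuous g) (s : ℝ) :
    Continuous (fun x => Real.log (max (g x) (Real.exp (-s)))) :=
  (hg.max continuous_const).log fun _ => (lt_max_of_lt_right (Real.exp_pos _)).ne'

lemma truncInt_eq (hg : Continuous g) (s : ℝ) : truncInt g s =
    (∫⁻ x in Set.Ioc (0:ℝ) 1, ENNReal.ofReal (Real.log (max (g x) (Real.exp (-s))))).toReal -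
    (∫⁻ x in Set.Ioc (0:ℝ) 1, ENNReal.ofReal (-Real.log (max (g x) (Real.exp (-s))))).toReal := by
  unfold truncInt
  rw [intervalIntegral.integral_of_le zero_le_one, integral_eq_lintegral_pos_part_sub_lintegral_neg_part]
  exact ((continuous_log_max hg s).integrableOn_Icc).mono_set Set.Ioc_subset_Icc_self

lemma lintegral_ofReal_ne_top {f : ℝ → ℝ} (hf : Continuous f) :
    ∫⁻ x in Set.Ioc (0:ℝ) 1, ENNReal.ofReal (f x) ≠ ⊤ := by
  have h : IntegrableOn f (Set.Ioc 0 1) := (hf.integrableOn_Icc).mono_set Set.Ioc_subset_Icc_self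
  exact ((lintegral_mono fun x => Real.ofReal_le_enorm (f x)).trans_lt h.2).ne

lemma ofReal_log_le (h0 : ∀ x, 0 ≤ g x) (s x : ℝ) : ENNReal.ofReal (Real.log (g x)) ≤
    ENNReal.ofReal (Real.log (max (g x) (Real.exp (-s)))) := by
  rcases (h0 x).eq_or_lt with h | h
  · rw [← h]; simp
  · exact ENNReal.ofReal_le_ofReal (Real.log_le_log h (le_max_left _ _))

lemma ofReal_neg_log_le (h0 : ∀ x, 0 ≤ g x) (s x : ℝ) :
    ENNReal.ofReal (-Real.log (max (g x) (Real.exp (-s)))) ≤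
    if g x = 0 then (⊤ : ℝ≥0∞) else ENNReal.ofReal (-Real.log (g x)) := by
  split_ifs with h
  · exact le_top
  · refine ENNReal.ofReal_le_ofReal (neg_le_neg (Real.log_le_log ?_ (le_max_left _ _)))
    exact lt_of_le_of_ne (h0 x) (Ne.symm h)

lemma logIntegral_le (hg : Continuous g) (h0 : ∀ x, 0 ≤ g x) (s : ℝ) :
    logIntegral g ≤ (truncInt g s : EReal) := by
  have hc := continuous_log_max hg s
  have hn : Continuous (fun x => -Real.log (max (g x) (Real.exp (-s)))) := hc.neg
  rw [truncInt_eq hg, EReal.coe_sub, EReal.coe_ennreal_toReal (lintegral_ofReal_ne_top hc),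
    EReal.coe_ennreal_toReal (lintegral_ofReal_ne_top hn)]
  unfold logIntegral
  refine EReal.sub_le_sub ?_ ?_
  · exact EReal.coe_ennreal_le_coe_ennreal_iff.2 (lintegral_mono fun x => ofReal_log_le h0 s x)
  · exact EReal.coe_ennreal_le_coe_ennreal_iff.2 (lintegral_mono fun x => ofReal_neg_log_le h0 s x)

lemma iSup_ofReal_neg_log (h0 : ∀ x, 0 ≤ g x) {a : ℝ} (ha : 0 < a) (x : ℝ) :
    ⨆ j : ℕ, ENNReal.ofReal (-Real.log (max (g x) (Real.exp (-(j * a))))) =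
    if g x = 0 then (⊤ : ℝ≥0∞) else ENNReal.ofReal (-Real.log (g x)) := by
  refine le_antisymm (iSup_le fun j => ofReal_neg_log_le h0 _ x) ?_
  split_ifs with h
  · rw [h, top_le_iff, iSup_eq_top]
    intro b hb
    obtain ⟨j, hj⟩ := exists_nat_gt (b.toReal / a)
    refine ⟨j, ?_⟩
    rw [max_eq_right (Real.exp_pos _).le, Real.log_exp, neg_neg]
    rw [div_lt_iff₀ ha] at hj
    rw [← ENNReal.ofReal_toReal hb.ne]
    exact (ENNReal.ofReal_lt_ofReal_iff_of_nonneg ENNReal.toReal_nonneg).2 hj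
  · have hpos : 0 < g x := lt_of_le_of_ne (h0 x) (Ne.symm h)
    obtain ⟨j, hj⟩ := exists_nat_gt (-Real.log (g x) / a)
    refine le_trans (le_of_eq ?_) (le_iSup _ j)
    rw [div_lt_iff₀ ha] at hj
    rw [max_eq_left]
    rw [← Real.exp_log hpos]
    exact Real.exp_le_exp.2 (by linarith)

lemma le_logIntegral (hg : Continuous g) (h0 : ∀ x, 0 ≤ g x) {a c : ℝ} (ha : 0 < a)
    (hc : ∀ j : ℕ, c ≤ truncInt g (j * a)) : (c : EReal) ≤ logIntegral g := by
  set P := ∫⁻ x in Set.Ioc (0:ℝ) 1, ENNReal.ofReal (Real.log (g x)) with hP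
  set Q : ℕ → ℝ≥0∞ := fun j => ∫⁻ x in Set.Ioc (0:ℝ) 1,
    ENNReal.ofReal (-Real.log (max (g x) (Real.exp (-(j * a))))) with hQ
  have hPj : ∀ j : ℕ, ∫⁻ x in Set.Ioc (0:ℝ) 1,
      ENNReal.ofReal (Real.log (max (g x) (Real.exp (-(j * a))))) = P := by
    intro j
    refine lintegral_congr fun x => ?_
    refine le_antisymm ?_ (ofReal_log_le h0 _ x)
    rcases le_total (g x) (Real.exp (-(j * a))) with h | h
    · rw [max_eq_right h, Real.log_exp, ENNReal.ofReal_of_nonpos]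
      · exact zero_le
      · have : 0 ≤ j * a := by positivity
        linarith
    · rw [max_eq_left h]
  have hPt : P ≠ ⊤ := by
    rw [← hPj 0]
    exact lintegral_ofReal_ne_top (continuous_log_max hg _)
  have hQt : ∀ j, Q j ≠ ⊤ := fun j => lintegral_ofReal_ne_top (continuous_log_max hg _).neg
  have hQle : ∀ j, Q j ≤ ENNReal.ofReal (P.toReal - c) := by
    intro j
    have := hc j
    rw [truncInt_eq hg, hPj j] at this
    rw [← ENNReal.ofReal_toReal (hQt j)]
    exact ENNReal.ofReal_le_ofReal (by linarith)
  have hnn : 0 ≤ P.toReal - c := by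
    have := hc 0
    rw [truncInt_eq hg, hPj 0] at this
    have h2 : 0 ≤ (∫⁻ x in Set.Ioc (0:ℝ) 1,
      ENNReal.ofReal (-Real.log (max (g x) (Real.exp (-(((0:ℕ):ℝ) * a)))))).toReal :=
      ENNReal.toReal_nonneg
    linarith
  have hsup : ∫⁻ x in Set.Ioc (0:ℝ) 1,
      (if g x = 0 then (⊤ : ℝ≥0∞) else ENNReal.ofReal (-Real.log (g x))) ≤
      ENNReal.ofReal (P.toReal - c) := by
    simp_rw [← iSup_ofReal_neg_log h0 ha]
    rw [lintegral_iSup]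
    · exact iSup_le hQle
    · intro j
      exact ((continuous_log_max hg _).neg.measurable).ennreal_ofReal
    · intro i j hij x
      refine ENNReal.ofReal_le_ofReal (neg_le_neg (Real.log_le_log
        (lt_max_of_lt_right (Real.exp_pos _)) (max_le_max le_rfl (Real.exp_le_exp.2 ?_))))
      have : (i:ℝ) ≤ j := by exact_mod_cast hij
      nlinarith
  have e : (c : EReal) = (P : EReal) - ((ENNReal.ofReal (P.toReal - c) : ℝ≥0∞) : EReal) := by
    rw [← EReal.coe_ennreal_toReal hPt, EReal.coe_ennreal_ofReal, max_eq_left hnn, ← EReal.coe_sub]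
    congr 1; ring
  rw [e]
  unfold logIntegral
  exact EReal.sub_le_sub le_rfl (EReal.coe_ennreal_le_coe_ennreal_iff.2 hsup)

end LogIntegral

/-- The mean over the line `Im z = y` of `log ‖A_N‖`, truncated from below at `-jN`. -/
def trunc (E : ℂ → M2) (r : ℝ) (N : ℕ) (j : ℕ) (y : ℝ) : ℝ :=
  lineAvg (fun z => Real.log (max ‖cIter E r N z‖ (Real.exp (-(j * N : ℝ))))) y

lemma trunc_eq_truncInt (E : ℂ → M2) (r : ℝ) (N j : ℕ) (y : ℝ) : trunc E r N j y =
    truncInt (fun x => ‖cocycleIter (fun x : ℝ => E (x + y * I)) r N x‖) (j * N) := by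
  simp only [trunc, truncInt, lineAvg, cocycleIter_eq_cIter]

lemma lyapunov_lt_iff {η : ℝ} {E : ℂ → M2} (hE : Hol η E) (r y c : ℝ) :
    lyapunov r (fun x : ℝ => E (x + y * I)) < c ↔ ∃ N j : ℕ, 0 < N ∧ trunc E r N j y < c * N := by
  have hcont : ∀ N, Continuous (fun x => ‖cocycleIter (fun x : ℝ => E (x + y * I)) r N x‖) := by
    intro N
    simp only [cocycleIter_eq_cIter]
    exact (hE.cIter r N).continuous_norm.comp (by fun_prop)
  constructor
  · intro h
    by_contra hc
    push Not at hc
    refine absurd h (not_lt.2 (le_iInf fun n => ?_))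
    have h1 : ((c * (n + 1) : ℝ) : EReal) ≤
        logIntegral fun x => ‖cocycleIter (fun x : ℝ => E (x + y * I)) r (n + 1) x‖ := by
      refine le_logIntegral (hcont _) (fun x => norm_nonneg _) (a := ((n + 1 : ℕ) : ℝ))
        (by positivity) fun j => ?_
      rw [← trunc_eq_truncInt]
      have := hc (n + 1) j (by omega)
      push_cast at this ⊢
      exact this
    have h2 : (c : EReal) = ((((n : ℝ) + 1)⁻¹ : ℝ) : EReal) * ((c * (n + 1) : ℝ) : EReal) := by
      rw [← EReal.coe_mul]
      congr 1
      have : (n:ℝ) + 1 ≠ 0 := by positivity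
      field_simp
    rw [h2]
    exact mul_le_mul_of_nonneg_left h1 (by exact_mod_cast (by positivity : (0:ℝ) ≤ ((n : ℝ) + 1)⁻¹))
  · rintro ⟨N, j, hN, h⟩
    obtain ⟨n, rfl⟩ : ∃ n, N = n + 1 := ⟨N - 1, by omega⟩
    refine (iInf_le _ n).trans_lt ?_
    have h1 := logIntegral_le (hcont (n + 1)) (fun x => norm_nonneg _) (j * (n + 1 : ℕ))
    rw [← trunc_eq_truncInt] at h1
    refine (mul_le_mul_of_nonneg_left h1
      (by exact_mod_cast (by positivity : (0:ℝ) ≤ ((n : ℝ) + 1)⁻¹))).trans_lt ?_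
    rw [← EReal.coe_mul, EReal.coe_lt_coe_iff]
    rw [inv_mul_lt_iff₀ (by positivity)]
    push_cast at h
    linarith

/-- Bounded analytic periodic cocycle on a strip. -/
structure Cyl (η Λ : ℝ) (E : ℂ → M2) : Prop where
  hol : Hol η E
  up : ∀ z, ‖E z‖ ≤ Real.exp Λ
  nonneg : 0 ≤ Λ

/-- The integrand in `trunc`. -/
def logT (E : ℂ → M2) (r : ℝ) (N j : ℕ) (z : ℂ) : ℝ :=
  Real.log (max ‖cIter E r N z‖ (Real.exp (-(j * N : ℝ))))

lemma trunc_eq (E : ℂ → M2) (r : ℝ) (N j : ℕ) (y : ℝ) :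
    trunc E r N j y = ∫ x in (0:ℝ)..1, logT E r N j (x + y * I) := rfl

lemma neg_le_logT (E : ℂ → M2) (r : ℝ) (N j : ℕ) (z : ℂ) : -(j * N : ℝ) ≤ logT E r N j z := by
  unfold logT
  rw [← Real.log_exp (-(j * N : ℝ)), Real.exp_log (Real.exp_pos _)]
  exact Real.log_le_log (Real.exp_pos _) (le_max_right _ _)

lemma logT_le {E : ℂ → M2} {Λ : ℝ} (hup : ∀ z, ‖E z‖ ≤ Real.exp Λ) (hΛ : 0 ≤ Λ) (r : ℝ) {N : ℕ}
    (hN : 0 < N) (j : ℕ) (z : ℂ) : logT E r N j z ≤ Λ * N := by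
  unfold logT
  rw [← Real.log_exp (Λ * N)]
  refine Real.log_le_log (lt_max_of_lt_right (Real.exp_pos _)) (max_le ?_ (Real.exp_le_exp.2 ?_))
  · obtain ⟨n, rfl⟩ := Nat.exists_eq_succ_of_ne_zero hN.ne'
    exact norm_cIter_le hup r n z
  · have : (0:ℝ) ≤ j * N := by positivity
    have : (0:ℝ) ≤ Λ * N := by positivity
    linarith

lemma abs_logT_le {E : ℂ → M2} {Λ : ℝ} (hup : ∀ z, ‖E z‖ ≤ Real.exp Λ) (hΛ : 0 ≤ Λ) (r : ℝ) {N : ℕ}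
    (hN : 0 < N) (j : ℕ) (z : ℂ) : |logT E r N j z| ≤ Λ * N + j * N := by
  have h1 := neg_le_logT E r N j z
  have h2 := logT_le hup hΛ r hN j z
  have : (0:ℝ) ≤ j * N := by positivity
  have : (0:ℝ) ≤ Λ * N := by positivity
  rw [abs_le]; constructor <;> linarith

lemma Hol.continuous_logT {η : ℝ} {E : ℂ → M2} (hE : Hol η E) (r : ℝ) (N j : ℕ) :
    Continuous (logT E r N j) :=
  ((hE.cIter r N).continuous_norm.max continuous_const).log
    fun _ => (lt_max_of_lt_right (Real.exp_pos _)).ne'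

lemma Hol.logT_per {η : ℝ} {E : ℂ → M2} (hE : Hol η E) (r : ℝ) (N j : ℕ) (z : ℂ) :
    logT E r N j (z + 1) = logT E r N j z := by
  unfold logT; rw [(hE.cIter r N).per]

lemma Hol.intervalIntegrable_logT {η : ℝ} {E : ℂ → M2} (hE : Hol η E) (r : ℝ) (N j : ℕ) (w : ℂ) :
    IntervalIntegrable (fun x : ℝ => logT E r N j (x + w)) volume 0 1 :=
  ((hE.continuous_logT r N j).comp (by fun_prop)).intervalIntegrable _ _

lemma logT_anti (E : ℂ → M2) (r : ℝ) (N : ℕ) {j j' : ℕ} (h : j ≤ j') (z : ℂ) :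
    logT E r N j' z ≤ logT E r N j z := by
  unfold logT
  refine Real.log_le_log (lt_max_of_lt_right (Real.exp_pos _))
    (max_le_max le_rfl (Real.exp_le_exp.2 ?_))
  have : (j:ℝ) ≤ j' := by exact_mod_cast h
  have : (j:ℝ) * N ≤ j' * N := by gcongr
  linarith

lemma Hol.trunc_anti {η : ℝ} {E : ℂ → M2} (hE : Hol η E) (r : ℝ) (N : ℕ) {j j' : ℕ} (h : j ≤ j')
    (y : ℝ) : trunc E r N j' y ≤ trunc E r N j y :=
  intervalIntegral.integral_mono_on zero_le_one (hE.intervalIntegrable_logT r N j' _)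
    (hE.intervalIntegrable_logT r N j _) fun _ _ => logT_anti E r N h _

lemma logT_add_le (E : ℂ → M2) (r : ℝ) (M N j : ℕ) (z : ℂ) :
    logT E r (M + N) j z ≤ logT E r M j (z + N * r) + logT E r N j z := by
  unfold logT
  rw [← Real.log_mul (lt_max_of_lt_right (Real.exp_pos _)).ne'
    (lt_max_of_lt_right (Real.exp_pos _)).ne']
  refine Real.log_le_log (lt_max_of_lt_right (Real.exp_pos _)) (max_le ?_ ?_)
  · rw [cIter_add]
    exact (frob_mul_le _ _).trans (mul_le_mul (le_max_left _ _) (le_max_left _ _) (norm_nonneg _)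
      ((norm_nonneg _).trans (le_max_left _ _)))
  · rw [show -(j * ((M + N : ℕ):ℝ)) = -(j * M : ℝ) + -(j * N : ℝ) by push_cast; ring, Real.exp_add]
    exact mul_le_mul (le_max_right _ _) (le_max_right _ _) (Real.exp_pos _).le
      ((norm_nonneg _).trans (le_max_left _ _))

lemma Hol.trunc_shift {η : ℝ} {E : ℂ → M2} (hE : Hol η E) (r : ℝ) (N j : ℕ) (y s : ℝ) :
    ∫ x in (0:ℝ)..1, logT E r N j (x + y * I + s) = trunc E r N j y := by
  have := integral_translate_eq (g := fun x : ℝ => logT E r N j (x + y * I)) (fun x => by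
    have := hE.logT_per r N j (x + y * I)
    simp only [ofReal_add, ofReal_one]
    rw [← this]; congr 1; ring) s
  rw [trunc_eq, ← this]
  refine intervalIntegral.integral_congr fun x _ => ?_
  congr 1; push_cast; ring

lemma Hol.trunc_add_le {η : ℝ} {E : ℂ → M2} (hE : Hol η E) (r : ℝ) (M N j : ℕ) (y : ℝ) :
    trunc E r (M + N) j y ≤ trunc E r M j y + trunc E r N j y := by
  rw [← hE.trunc_shift r M j y (N * r), trunc_eq, trunc_eq E r N]
  have hi : IntervalIntegrable (fun x : ℝ => logT E r M j (x + y * I + ((N * r : ℝ) : ℂ))) volume 0 1 := by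
    have := hE.intervalIntegrable_logT r M j (y * I + ((N * r : ℝ) : ℂ))
    simpa only [add_assoc] using this
  rw [← intervalIntegral.integral_add hi (hE.intervalIntegrable_logT r N j _)]
  refine intervalIntegral.integral_mono_on zero_le_one (hE.intervalIntegrable_logT r _ j _)
    (hi.add (hE.intervalIntegrable_logT r N j _)) fun x _ => ?_
  have := logT_add_le E r M N j (x + y * I)
  push_cast at this ⊢
  exact this

lemma Hol.trunc_mul_le {η : ℝ} {E : ℂ → M2} (hE : Hol η E) (r : ℝ) {m : ℕ} (hm : 0 < m) (N j : ℕ)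
    (y : ℝ) : trunc E r (m * N) j y ≤ m * trunc E r N j y := by
  induction m with
  | zero => omega
  | succ m ih =>
    rcases Nat.eq_zero_or_pos m with h | h
    · subst h; simp
    · rw [Nat.succ_mul]
      refine (hE.trunc_add_le r _ _ j y).trans ?_
      have := ih h
      push_cast
      linarith

lemma Hol.trunc_convex {η η' : ℝ} (h : η' < η) {E : ℂ → M2} (hE : Hol η E) (r : ℝ) (N j : ℕ) :
    ConvexOn ℝ (Set.Icc (-η') η') (trunc E r N j) :=
  ((hE.cIter r N).subStrip_log_max h (Real.exp_pos _)).lineAvg_convex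

lemma Cyl.abs_trunc_le {η Λ : ℝ} {E : ℂ → M2} (hE : Cyl η Λ E) (r : ℝ) {N : ℕ} (hN : 0 < N) (j : ℕ)
    (y : ℝ) : |trunc E r N j y| ≤ Λ * N + j * N :=
  abs_lineAvg_le (fun z => abs_logT_le hE.up hE.nonneg r hN j z) y

/-- Uniform convergence on the whole plane. -/
def UConv {ι : Type*} (l : Filter ι) (F : ι → ℂ → M2) (E : ℂ → M2) : Prop :=
  ∀ ε > (0:ℝ), ∀ᶠ n in l, ∀ z, ‖F n z - E z‖ ≤ ε

lemma frob_mul_sub_le (X Y X' Y' : M2) :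
    ‖X * Y - X' * Y'‖ ≤ ‖X - X'‖ * ‖Y - Y'‖ + ‖X - X'‖ * ‖Y'‖ + ‖X'‖ * ‖Y - Y'‖ := by
  have e : X * Y - X' * Y' = (X - X') * (Y - Y') + (X - X') * Y' + X' * (Y - Y') := by
    noncomm_ring
  rw [e]
  refine (norm_add_le _ _).trans (add_le_add ((norm_add_le _ _).trans (add_le_add ?_ ?_)) ?_) <;>
  exact frob_mul_le _ _

lemma Hol.tendsto_norm_sub {η : ℝ} {E : ℂ → M2} (hE : Hol η E) (w : ℂ) :
    Tendsto (fun z => ‖E z - E w‖) (nhds w) (nhds 0) := by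
  have h : Hol η (fun z => E z - E w) := fun i j => (hE i j).sub (holS_const η (E w i j))
  have := h.continuous_norm.tendsto w
  simpa using this

section Convergence

variable {ι : Type*} {l : Filter ι} {F : ι → ℂ → M2} {E : ℂ → M2} {η : ℝ}

lemma UConv.tendsto_norm_sub (h : UConv l F E) (hE : Hol η E) {w : ι → ℂ} {w₀ : ℂ}
    (hw : Tendsto w l (nhds w₀)) : Tendsto (fun n => ‖F n (w n) - E w₀‖) l (nhds 0) := by
  have h1 := (hE.tendsto_norm_sub w₀).comp hw
  rw [Metric.tendsto_nhds] at h1 ⊢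
  intro ε hε
  filter_upwards [h1 (ε / 2) (by linarith), h (ε / 4) (by linarith)] with n hn1 hn2
  simp only [Function.comp_apply, Real.dist_eq, sub_zero, abs_norm] at hn1 ⊢
  have : ‖F n (w n) - E w₀‖ ≤ ‖F n (w n) - E (w n)‖ + ‖E (w n) - E w₀‖ := norm_sub_le_norm_sub_add_norm_sub _ _ _
  have := hn2 (w n)
  linarith

lemma UConv.tendsto_cIter (h : UConv l F E) (hE : Hol η E) {r : ι → ℝ} {r₀ : ℝ}
    (hr : Tendsto r l (nhds r₀)) (N : ℕ) : ∀ {w : ι → ℂ} {w₀ : ℂ}, Tendsto w l (nhds w₀) →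
    Tendsto (fun n => ‖cIter (F n) (r n) N (w n) - cIter E r₀ N w₀‖) l (nhds 0) := by
  induction N with
  | zero => intro w w₀ _; simp only [cIter, sub_self, norm_zero]; exact tendsto_const_nhds
  | succ N ih =>
    intro w w₀ hw
    have hr' : Tendsto (fun n => (r n : ℂ)) l (nhds (r₀ : ℂ)) :=
      (Complex.continuous_ofReal.tendsto r₀).comp hr
    have h1 := ih (hw.add hr')
    have h2 := h.tendsto_norm_sub hE hw
    have h3 := ((h1.mul h2).add (h1.mul_const ‖E w₀‖)).add
      (h2.const_mul ‖cIter E r₀ N (w₀ + r₀)‖)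
    simp only [mul_zero, zero_mul, add_zero] at h3
    exact squeeze_zero (fun n => norm_nonneg _) (fun n => frob_mul_sub_le _ _ _ _) h3

lemma UConv.tendsto_trunc [l.IsCountablyGenerated] (h : UConv l F E) (hE : Hol η E)
    {Λ : ℝ} (hF : ∀ᶠ n in l, Cyl η Λ (F n)) {r : ι → ℝ} {r₀ : ℝ}
    (hr : Tendsto r l (nhds r₀)) {N : ℕ} (hN : 0 < N) (j : ℕ) (y : ℝ) :
    Tendsto (fun n => trunc (F n) (r n) N j y) l (nhds (trunc E r₀ N j y)) := by
  refine intervalIntegral.tendsto_integral_filter_of_dominated_convergence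
    (fun _ => Λ * N + j * N) ?_ ?_ intervalIntegrable_const ?_
  · filter_upwards [hF] with n hn
    exact (hn.hol.intervalIntegrable_logT (r n) N j (y * I)).aestronglyMeasurable_restrict_uIoc
  · filter_upwards [hF] with n hn
    exact Eventually.of_forall fun x _ => abs_logT_le hn.up hn.nonneg _ hN j _
  · refine Eventually.of_forall fun x _ => ?_
    have h1 := h.tendsto_cIter hE hr N (tendsto_const_nhds (x := (x + y * I : ℂ)))
    have h2 : Tendsto (fun n => ‖cIter (F n) (r n) N (x + y * I)‖) l
        (nhds ‖cIter E r₀ N (x + y * I)‖) := by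
      rw [tendsto_iff_dist_tendsto_zero]
      refine squeeze_zero (fun n => dist_nonneg) (fun n => ?_) h1
      rw [Real.dist_eq]
      exact abs_norm_sub_norm_le _ _
    exact (h2.max tendsto_const_nhds).log (lt_max_of_lt_right (Real.exp_pos _)).ne'

end Convergence

namespace Win

variable {η Λ : ℝ} {E : ℂ → M2}

lemma cyl (hE : Win η Λ E) (hΛ : 0 ≤ Λ) : Cyl η Λ E := ⟨hE.hol, hE.up, hΛ⟩

lemma trunc_eq_meanN (hE : Win η Λ E) (r : ℝ) (N : ℕ) {j : ℕ} (hj : Λ ≤ j) :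
    trunc E r N j 0 = meanN E r N := by
  have : (fun z => Real.log (max ‖cIter E r N z‖ (Real.exp (-(j * N : ℝ))))) = logN E r N := by
    ext z
    rw [logN, max_eq_left]
    refine le_trans (Real.exp_le_exp.2 ?_) (hE.low_norm r N z)
    have : (0:ℝ) ≤ N := by positivity
    nlinarith
  rw [trunc, meanN, this]

lemma subadditive (hE : Win η Λ E) (r : ℝ) : Subadditive (meanN E r) := hE.meanN_add_le r

lemma le_meanN (hE : Win η Λ E) (hΛ : 0 ≤ Λ) (r : ℝ) {N : ℕ} (hN : 0 < N) :
    |meanN E r N| ≤ (Λ + (⌈Λ⌉₊ : ℕ)) * N := by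
  rw [← hE.trunc_eq_meanN r N (Nat.le_ceil Λ), add_mul]
  exact (hE.cyl hΛ).abs_trunc_le r hN _ _

lemma bddBelow (hE : Win η Λ E) (hΛ : 0 ≤ Λ) (r : ℝ) :
    BddBelow (Set.range fun n : ℕ => meanN E r n / n) := by
  refine ⟨-(Λ + (⌈Λ⌉₊ : ℕ)), ?_⟩
  rintro _ ⟨n, rfl⟩
  have h0 : (0:ℝ) ≤ Λ + (⌈Λ⌉₊ : ℕ) := by positivity
  rcases n.eq_zero_or_pos with rfl | hn
  · simp; linarith [(Nat.cast_nonneg ⌈Λ⌉₊ : (0:ℝ) ≤ _)]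
  · have hn' : (0:ℝ) < n := by exact_mod_cast hn
    simp only
    rw [le_div_iff₀ hn']
    have := (abs_le.1 (hE.le_meanN hΛ r hn)).1
    linarith

lemma tendsto_uN (hE : Win η Λ E) (hΛ : 0 ≤ Λ) (r : ℝ) :
    Tendsto (uN E r) atTop (nhds (hE.subadditive r).lim) :=
  (hE.subadditive r).tendsto_lim (hE.bddBelow hΛ r)

lemma le_uN_of_subseq (hE : Win η Λ E) (hΛ : 0 ≤ Λ) (r : ℝ) {c : ℝ} {n : ℕ → ℕ}
    (hn : Tendsto n atTop atTop) (hc : ∀ i, c ≤ uN E r (n i)) {N : ℕ} (hN : 0 < N) :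
    c ≤ uN E r N :=
  (ge_of_tendsto' ((hE.tendsto_uN hΛ r).comp hn) hc).trans
    ((hE.subadditive r).lim_le_div (hE.bddBelow hΛ r) hN.ne')

/-- The Lyapunov exponent dominates half the mean of `log |det|`. -/
lemma half_logDet_le_uN (hE : Win η Λ E) (r : ℝ) {N : ℕ} (hN : 0 < N) :
    lineAvg (fun z => Real.log ‖(E z).det‖) 0 / 2 ≤ uN E r N := by
  have hN' : (0:ℝ) < N := by exact_mod_cast hN
  rw [uN, le_div_iff₀ hN']
  have h1 : meanDet E r N ≤ 2 * meanN E r N := by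
    unfold meanDet meanN lineAvg
    rw [← intervalIntegral.integral_const_mul]
    have c1 : Continuous fun x : ℝ => logDet E r N (x + (0:ℝ) * I) :=
      (hE.continuous_logDet r N).comp (by fun_prop)
    have c2 : Continuous fun x : ℝ => logN E r N (x + (0:ℝ) * I) :=
      (hE.continuous_logN r N).comp (by fun_prop)
    refine intervalIntegral.integral_mono_on zero_le_one (c1.intervalIntegrable _ _)
      ((c2.const_mul 2).intervalIntegrable _ _) fun x _ => ?_
    unfold logDet logN
    rw [show (2:ℝ) * Real.log ‖cIter E r N (x + (0:ℝ) * I)‖ =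
      Real.log (‖cIter E r N (x + (0:ℝ) * I)‖ ^ 2) by rw [Real.log_pow]; norm_num]
    refine Real.log_le_log (hE.det_pos r N _) ?_
    have := two_mul_norm_det_le (cIter E r N (x + (0:ℝ) * I))
    linarith [norm_nonneg (cIter E r N (x + (0:ℝ) * I)).det]
  rw [hE.meanDet_eq] at h1
  linarith

lemma log_det_mem (hE : Win η Λ E) (z : ℂ) : |Real.log ‖(E z).det‖| ≤ 2 * Λ := by
  have h0 := hE.low z
  have hp : 0 < ‖(E z).det‖ := (Real.exp_pos _).trans_le h0
  rw [abs_le]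
  constructor
  · rwa [Real.le_log_iff_exp_le hp]
  · rw [Real.log_le_iff_le_exp hp, two_mul, Real.exp_add]
    have := two_mul_norm_det_le (E z)
    have h3 := hE.up z
    nlinarith [norm_nonneg (E z), Real.exp_pos Λ]

end Win

lemma UConv.tendsto_entry {ι : Type*} {l : Filter ι} {F : ι → ℂ → M2} {E : ℂ → M2} 
    (h : UConv l F E) (z : ℂ) (i j : Fin 2) :
    Tendsto (fun n => F n z i j) l (nhds (E z i j)) := by
  rw [tendsto_iff_norm_sub_tendsto_zero, Metric.tendsto_nhds]
  intro ε hε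
  filter_upwards [h (ε / 2) (by linarith)] with n hn
  have h1 := norm_entry_le (F n z - E z) i j
  have := hn z
  rw [Real.dist_eq, sub_zero, abs_norm]
  rw [Matrix.sub_apply] at h1
  linarith

section Convergence

variable {ι : Type*} {l : Filter ι} [l.IsCountablyGenerated] {F : ι → ℂ → M2} {E : ℂ → M2}
  {η Λ β : ℝ} {r : ι → ℝ}

lemma UConv.tendsto_meanN (h : UConv l F E) (hE : Win η Λ E) (hΛ : 0 ≤ Λ)
    (hF : ∀ᶠ n in l, Win η Λ (F n)) (hr : Tendsto r l (nhds β)) {N : ℕ} (hN : 0 < N) :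
    Tendsto (fun n => meanN (F n) (r n) N) l (nhds (meanN E β N)) := by
  rw [← hE.trunc_eq_meanN β N (Nat.le_ceil Λ)]
  refine (h.tendsto_trunc hE.hol (hF.mono fun n hn => hn.cyl hΛ) hr hN ⌈Λ⌉₊ 0).congr' ?_
  exact hF.mono fun n hn => hn.trunc_eq_meanN _ N (Nat.le_ceil Λ)

lemma UConv.tendsto_uN (h : UConv l F E) (hE : Win η Λ E) (hΛ : 0 ≤ Λ)
    (hF : ∀ᶠ n in l, Win η Λ (F n)) (hr : Tendsto r l (nhds β)) {N : ℕ} (hN : 0 < N) :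
    Tendsto (fun n => uN (F n) (r n) N) l (nhds (uN E β N)) :=
  (h.tendsto_meanN hE hΛ hF hr hN).div_const _

lemma UConv.tendsto_logDet (h : UConv l F E) (hE : Win η Λ E)
    (hF : ∀ᶠ n in l, Win η Λ (F n)) :
    Tendsto (fun n => lineAvg (fun z => Real.log ‖(F n z).det‖) 0) l
      (nhds (lineAvg (fun z => Real.log ‖(E z).det‖) 0)) := by
  refine intervalIntegral.tendsto_integral_filter_of_dominated_convergence
    (fun _ => 2 * Λ) ?_ ?_ intervalIntegrable_const ?_
  · filter_upwards [hF] with n hn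
    have c : Continuous fun z => Real.log ‖(F n z).det‖ :=
      hn.hol.det.cont.norm.log fun z => ((Real.exp_pos _).trans_le (hn.low z)).ne'
    exact (c.comp (by fun_prop : Continuous fun x : ℝ => (x + (0:ℝ) * I : ℂ))).aestronglyMeasurable
  · filter_upwards [hF] with n hn
    exact Eventually.of_forall fun x _ => hn.log_det_mem _
  · refine Eventually.of_forall fun x _ => ?_
    simp only [Matrix.det_fin_two]
    refine Tendsto.log (Tendsto.norm (((h.tendsto_entry _ _ _).mul (h.tendsto_entry _ _ _)).sub
      ((h.tendsto_entry _ _ _).mul (h.tendsto_entry _ _ _)))) ?_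
    rw [← Matrix.det_fin_two]
    exact ((Real.exp_pos _).trans_le (hE.low _)).ne'

end Convergence

lemma Scales.sum_inv_le {C σ r : ℝ} {N m : ℕ → ℕ} (h : Scales C σ r N m) (n : ℕ) :
    ∑ i ∈ Finset.range n, (1 / N i : ℝ) ≤ 2 / N 0 := by
  have h0 : (0:ℝ) < N 0 := by exact_mod_cast h.pos
  have key : ∑ i ∈ Finset.range n, (1 / N i : ℝ) ≤ (4 / 3 - 4 / 3 * (1 / 4) ^ n) / N 0 := by
    induction n with
    | zero => simp
    | succ n ih =>
      rw [Finset.sum_range_succ]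
      have h1 := h.pow_le 0 n
      rw [zero_add] at h1
      have h2 : (1 / N n : ℝ) ≤ (1 / 4) ^ n / N 0 := by
        calc (1 / N n : ℝ) ≤ 1 / (4 ^ n * N 0) := one_div_le_one_div_of_le (by positivity) h1
          _ = _ := by rw [div_pow, one_pow, div_div]
      calc _ ≤ _ := add_le_add ih h2
        _ = _ := by rw [pow_succ]; ring
  refine key.trans ?_
  gcongr
  have : (0:ℝ) ≤ (1 / 4) ^ n := by positivity
  linarith

lemma Scales.tendsto {C σ r : ℝ} {N m : ℕ → ℕ} (h : Scales C σ r N m) :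
    Tendsto N atTop atTop := by
  refine tendsto_atTop_mono (f := fun n => n) (fun n => ?_) tendsto_id
  induction n with
  | zero => simp
  | succ n ih =>
    have h1 := h.four_mul_le n
    have h2 := h.one_le n
    have h3 : (n:ℝ) ≤ N n := by exact_mod_cast ih
    have : ((n + 1 : ℕ):ℝ) ≤ N (n + 1) := by push_cast; linarith
    exact_mod_cast this

section Convergence

variable {ι : Type*} {l : Filter ι} [l.IsCountablyGenerated] {F : ι → ℂ → M2} {E : ℂ → M2}
  {η Λ β : ℝ} {r : ι → ℝ}

lemma UConv.le_uN_of_irrational (hη : 0 < η) (hΛ : 0 < Λ) (h : UConv l F E) (hE : Win η Λ E)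
    (hF : ∀ᶠ n in l, Win η Λ (F n)) (hr : Tendsto r l (nhds β)) (hβ : Irrational β) {f : ℝ}
    (hf : ∀ N, 0 < N → f ≤ uN E β N) {ε : ℝ} (hε : 0 < ε) :
    ∀ᶠ n in l, Irrational (r n) → ∀ N, 0 < N → f - ε ≤ uN (F n) (r n) N := by
  set d := lineAvg (fun z => Real.log ‖(E z).det‖) 0 / 2 with hd
  have htd : Tendsto (fun n => lineAvg (fun z => Real.log ‖(F n z).det‖) 0 / 2) l (nhds d) :=
    (h.tendsto_logDet hE hF).div_const _
  rcases le_or_gt f (d + ε / 2) with hfd | hfd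
  · filter_upwards [hF, htd.eventually (lt_mem_nhds (show d - ε / 2 < d by linarith))]
      with n hn hdn _ N hN
    have := hn.half_logDet_le_uN (r n) hN
    linarith
  · set κ := min (ε / 100) Λ with hκdef
    have hκ : 0 < κ := lt_min (by linarith) hΛ
    have hκε : κ ≤ ε / 100 := min_le_left _ _
    have hκΛ : κ ≤ Λ := min_le_right _ _
    have hσ : 0 < κ / (16 * Λ) := by positivity
    have hσ1 : κ / (16 * Λ) ≤ 1 := by rw [div_le_one (by positivity)]; linarith
    have hK0 : 0 ≤ Win.costConst η Λ κ := by unfold Win.costConst; positivity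
    set K := Win.costConst η Λ κ with hK
    have hlim := hE.tendsto_uN hΛ.le β
    set L := (hE.subadditive β).lim
    have hnear := hlim.eventually (Metric.ball_mem_nhds L (show 0 < κ / 200 by positivity))
    obtain ⟨N₁, hN₁⟩ := eventually_atTop.1 hnear
    obtain ⟨N₂, hN₂⟩ := exists_nat_ge (100 / κ + 16 * Λ / κ + 16 / (η * κ))
    obtain ⟨N₀, hN₀, hev⟩ := exists_uniform_scales (C := 5 * Λ) (by positivity) hσ hσ1
      (show 0 < κ / (40 * (K + 1)) by positivity) hβ (N₁ + N₂ + 1)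
    have hN₀' : (100 / κ + 16 * Λ / κ + 16 / (η * κ)) ≤ N₀ :=
      hN₂.trans (by exact_mod_cast (by omega : N₂ ≤ N₀))
    have hN₀pos : 0 < N₀ := by omega
    have hA : (0:ℝ) ≤ 100 / κ := by positivity
    have hB : (0:ℝ) ≤ 16 * Λ / κ := by positivity
    have hC : (0:ℝ) ≤ 16 / (η * κ) := by positivity
    have hN0A : 100 ≤ κ * N₀ := by
      have : 100 / κ ≤ N₀ := by linarith
      rwa [div_le_iff₀' hκ] at this
    have hN0B : 1 ≤ κ / (16 * Λ) * N₀ := by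
      have : 16 * Λ / κ ≤ N₀ := by linarith
      rw [div_le_iff₀' hκ] at this
      rw [div_mul_eq_mul_div, le_div_iff₀ (by positivity)]; linarith
    have hN0C : 4 / η ≤ κ * N₀ / 4 := by
      have : 16 / (η * κ) ≤ N₀ := by linarith
      rw [div_le_iff₀' (by positivity)] at this
      rw [div_le_iff₀' hη]; linarith
    have t1 := (h.tendsto_uN hE hΛ.le hF hr hN₀pos).eventually
      (Metric.ball_mem_nhds _ (show 0 < κ / 200 by positivity))
    have t2 := (h.tendsto_uN hE hΛ.le hF hr (show 0 < 2 * N₀ by omega)).eventually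
      (Metric.ball_mem_nhds _ (show 0 < κ / 200 by positivity))
    filter_upwards [hF, t1, t2, hr.eventually hev,
      htd.eventually (gt_mem_nhds (show d < d + κ by linarith))] with n hn h1 h2 h3 h4 hirr N hN
    obtain ⟨M, m, hM0, hM, hsum⟩ := h3 hirr
    have b1 := hN₁ N₀ (by omega)
    have b2 := hN₁ (2 * N₀) (by omega)
    simp only [Real.dist_eq, abs_lt] at h1 h2 b1 b2
    have hfN := hf N₀ hN₀pos
    have hge : ∀ i, (N₀:ℝ) ≤ M i := fun i => by
      rw [← hM0]; exact_mod_cast hM.mono (Nat.zero_le i)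
    have hch := hn.chain hη hΛ hκ hσ1 hM.step hM.jump
      (fun i => by nlinarith [hge i]) (fun i => by nlinarith [hge i])
      (fun i => by
        have e1 : Real.exp (-(Λ * M i)) ≤ 1 := Real.exp_le_one_iff.2 (by
          have : (0:ℝ) ≤ Λ * M i := by positivity
          linarith)
        have e2 : 4 / η * Real.exp (-(Λ * M i)) ≤ 4 / η * 1 := by gcongr
        nlinarith [hge i])
      (by rw [hM0]; linarith)
      (S := κ / 20)
      (fun i => by
        rw [Finset.sum_add_distrib, ← Finset.mul_sum]
        have s1 := hM.sum_inv_le i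
        have s2 := hsum i
        have s3 : (2:ℝ) / M 0 ≤ κ / 40 := by
          rw [hM0, div_le_iff₀ (by positivity)]; linarith
        have s4 : K * ∑ i ∈ Finset.range i, cost (r n) (M i) ≤ κ / 40 := by
          calc _ ≤ K * (κ / (40 * (K + 1))) := by gcongr
            _ = κ / 40 * (K / (K + 1)) := by field_simp
            _ ≤ κ / 40 * 1 := by
              gcongr
              rw [div_le_one (by positivity)]; linarith
            _ = _ := mul_one _
        linarith)
      (by rw [hM0]; linarith)
    refine hn.le_uN_of_subseq hΛ.le (r n) hM.tendsto (fun i => ?_) hN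
    have := hch i
    rw [hM0] at this
    linarith

/-- Lower semicontinuity of the exponent of a cocycle invertible near the real line. -/
theorem UConv.le_uN (hη : 0 < η) (hΛ : 0 < Λ) (h : UConv l F E) (hE : Win η Λ E)
    (hF : ∀ᶠ n in l, Win η Λ (F n)) (hr : Tendsto r l (nhds β)) (hβ : Irrational β) {f : ℝ}
    (hf : ∀ N, 0 < N → f ≤ uN E β N) {ε : ℝ} (hε : 0 < ε) :
    ∀ᶠ n in l, ∀ N, 0 < N → f - ε ≤ uN (F n) (r n) N := by
  have h' : UConv (l ×ˢ nhds β) (fun p => F p.1) E := fun ε hε => (h ε hε).prod_inl _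
  have key := h'.le_uN_of_irrational (r := fun p => p.2) hη hΛ hE (hF.prod_inl _) tendsto_snd hβ hf hε
  obtain ⟨pa, hpa, pb, hpb, hab⟩ := eventually_prod_iff.1 key
  filter_upwards [hF, hpa, hr.eventually (eventually_eventually_nhds.2 hpb)] with n hn hna hnb N hN
  have hu : UConv (nhds (r n)) (fun _ : ℝ => F n) (F n) := fun ε hε =>
    Eventually.of_forall fun s z => by simpa using hε.le
  have hc := hu.tendsto_uN hn hΛ.le (Eventually.of_forall fun _ => hn) tendsto_id hN
  by_contra! hlt
  have h1 := hc.eventually (gt_mem_nhds hlt)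
  obtain ⟨s, hs, hs1, hs2⟩ := (dense_irrational.inter_nhds_nonempty (h1.and hnb))
  exact absurd (hab hna hs2 hs N hN) (not_le.2 hs1)

end Convergence

lemma cIter_succ_left (E : ℂ → M2) (r : ℝ) (n : ℕ) (z : ℂ) :
    cIter E r (n + 1) z = E (z + n * r) * cIter E r n z := by
  rw [add_comm, cIter_add, cIter_one]

lemma norm_one_le_two : ‖(1 : M2)‖ ≤ 2 := by
  refine le_of_sq_le_sq ?_ (by norm_num)
  rw [frob_sq]; norm_num

section NearSingular

variable {F : ℂ → M2} {r κ Λ η : ℝ} {w : ℝ → ℝ}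

/-- Multiplicative growth of the iterates of a cocycle with very small determinant. -/
lemma exp_mul_norm_cIter_le (hκ : 0 < κ) (hup : ∀ z, ‖F z‖ ≤ Real.exp Λ)
    (hbase : ∀ x : ℝ, 2 * κ ≤ ‖F x‖) (hw : ∀ x, κ ≤ Real.exp (w x))
    (hU : ∀ x : ℝ, Real.exp (w x) * ‖F x‖ + ‖(F x).det‖ * Real.exp Λ / κ ≤ ‖F (x + r) * F x‖)
    (k : ℕ) (x : ℝ) : κ * ‖cIter F r k x‖ ≤ ‖cIter F r (k + 1) x‖ ∧
      Real.exp (w (x + k * r)) * ‖cIter F r (k + 1) x‖ ≤ ‖cIter F r (k + 2) x‖ := by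
  have main : ∀ k : ℕ, κ * ‖cIter F r k x‖ ≤ ‖cIter F r (k + 1) x‖ →
      Real.exp (w (x + k * r)) * ‖cIter F r (k + 1) x‖ ≤ ‖cIter F r (k + 2) x‖ := by
    intro k hk
    set t : ℝ := x + k * r with ht
    have e1 : cIter F r (k + 1) x = F t * cIter F r k x := by
      rw [cIter_succ_left, ht]; push_cast; rfl
    have e2 : cIter F r (k + 2) x = F (t + r) * F t * cIter F r k x := by
      rw [cIter_succ_left, e1, ht, mul_assoc]
      congr 2; push_cast; ring
    set Y := cIter F r k x
    have h1 := (abs_le.1 (abs_norm_mul_sub_le (F (t + r)) (F t) Y)).1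
    rw [← e1, ← e2] at h1
    set y1 := ‖cIter F r (k + 1) x‖
    set y2 := ‖cIter F r (k + 2) x‖
    have hA : 0 < ‖F t‖ := by linarith [hbase t]
    have hY : ‖Y‖ ≤ y1 / κ := by rw [le_div_iff₀ hκ]; linarith
    have h2 : ‖(F t).det‖ * ‖F (t + r)‖ * ‖Y‖ ≤ ‖(F t).det‖ * Real.exp Λ * (y1 / κ) := by
      gcongr; exact hup _
    have h3 := mul_le_mul_of_nonneg_right (hU t) (norm_nonneg (cIter F r (k + 1) x))
    have h4 : ‖(F t).det‖ * Real.exp Λ * (y1 / κ) = ‖(F t).det‖ * Real.exp Λ / κ * y1 := by ring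
    rw [h4] at h2
    refine le_of_mul_le_mul_right ?_ hA
    change (_ + _) * y1 ≤ _ * y1 at h3
    rw [add_mul] at h3
    linarith
  have first : κ * ‖cIter F r k x‖ ≤ ‖cIter F r (k + 1) x‖ := by
    induction k with
    | zero =>
      rw [zero_add, cIter_one]
      have := norm_one_le_two
      have := hbase x
      simp only [cIter]
      nlinarith
    | succ k ih =>
      refine le_trans ?_ (main k ih)
      gcongr
      exact hw _
  exact ⟨first, main k first⟩

lemma exp_sum_le_norm_cIter (hκ : 0 < κ) (hup : ∀ z, ‖F z‖ ≤ Real.exp Λ)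
    (hbase : ∀ x : ℝ, 2 * κ ≤ ‖F x‖) (hw : ∀ x, κ ≤ Real.exp (w x))
    (hU : ∀ x : ℝ, Real.exp (w x) * ‖F x‖ + ‖(F x).det‖ * Real.exp Λ / κ ≤ ‖F (x + r) * F x‖)
    (k : ℕ) (x : ℝ) :
    κ * Real.exp (∑ i ∈ Finset.range k, w (x + i * r)) ≤ ‖cIter F r (k + 1) x‖ := by
  induction k with
  | zero => simpa [cIter_one] using (by linarith [hbase x] : κ ≤ ‖F x‖)
  | succ k ih =>
    rw [Finset.sum_range_succ, Real.exp_add]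
    have := (exp_mul_norm_cIter_le hκ hup hbase hw hU k x).2
    refine le_trans ?_ this
    rw [← mul_assoc, mul_comm _ (Real.exp (w _))]
    gcongr

lemma integral_birkhoff (hwc : Continuous w) (hwp : Function.Periodic w 1) (r c : ℝ) (N : ℕ) :
    ∫ x in (0:ℝ)..1, (c + ∑ i ∈ Finset.range N, w (x + i * r)) =
      c + N * ∫ x in (0:ℝ)..1, w x := by
  rw [intervalIntegral.integral_add intervalIntegrable_const
    (Continuous.intervalIntegrable (by fun_prop) _ _), intervalIntegral.integral_finsetSum
    fun i _ => Continuous.intervalIntegrable (by fun_prop) _ _]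
  simp only [fun i : ℕ => integral_translate_eq hwp (i * r)]
  simp

lemma le_trunc_of_nearSingular (hF : Hol η F) (hκ : 0 < κ) (hup : ∀ z, ‖F z‖ ≤ Real.exp Λ)
    (hbase : ∀ x : ℝ, 2 * κ ≤ ‖F x‖) (hw : ∀ x, κ ≤ Real.exp (w x))
    (hwc : Continuous w) (hwp : Function.Periodic w 1)
    (hU : ∀ x : ℝ, Real.exp (w x) * ‖F x‖ + ‖(F x).det‖ * Real.exp Λ / κ ≤ ‖F (x + r) * F x‖)
    (N j : ℕ) : Real.log κ + N * ∫ x in (0:ℝ)..1, w x ≤ trunc F r (N + 1) j 0 := by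
  rw [← integral_birkhoff hwc hwp r, trunc_eq]
  refine intervalIntegral.integral_mono_on zero_le_one
    (Continuous.intervalIntegrable (by fun_prop) _ _) (hF.intervalIntegrable_logT _ _ _ _)
    fun x _ => ?_
  rw [← Real.log_exp (∑ i ∈ Finset.range N, w (x + i * r)), ← Real.log_mul hκ.ne' (Real.exp_ne_zero _)]
  refine Real.log_le_log (by positivity) (le_max_of_le_left ?_)
  simpa using exp_sum_le_norm_cIter hκ hup hbase hw hU N x

lemma trunc_le_of_singular (hF : Hol η F) (hκ : 0 < κ) (hup : ∀ z, ‖F z‖ ≤ Real.exp Λ)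
    (hbase : ∀ x : ℝ, 2 * κ ≤ ‖F x‖) (hw : ∀ x, κ ≤ Real.exp (w x))
    (hwc : Continuous w) (hwp : Function.Periodic w 1) (hdet : ∀ x : ℝ, (F x).det = 0)
    (hU : ∀ x : ℝ, Real.exp (w x) * ‖F x‖ = ‖F (x + r) * F x‖)
    (N : ℕ) {j : ℕ} (hj : -Real.log κ ≤ j) :
    trunc F r (N + 1) j 0 ≤ Λ + N * ∫ x in (0:ℝ)..1, w x := by
  have hU' : ∀ x : ℝ, Real.exp (w x) * ‖F x‖ + ‖(F x).det‖ * Real.exp Λ / κ ≤ ‖F (x + r) * F x‖ := by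
    intro x; rw [hdet, norm_zero, zero_mul, zero_div, add_zero, hU]
  have upper : ∀ (k : ℕ) (x : ℝ), ‖cIter F r (k + 1) x‖ ≤
      Real.exp (Λ + ∑ i ∈ Finset.range k, w (x + i * r)) := by
    intro k x
    induction k with
    | zero => simpa [cIter_one] using hup x
    | succ k ih =>
      set t : ℝ := x + k * r with ht
      have e1 : cIter F r (k + 1) x = F t * cIter F r k x := by
        rw [cIter_succ_left, ht]; push_cast; rfl
      have e2 : cIter F r (k + 2) x = F (t + r) * F t * cIter F r k x := by
        rw [cIter_succ_left, e1, ht, mul_assoc]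
        congr 2; push_cast; ring
      have h1 := (abs_le.1 (abs_norm_mul_sub_le (F (t + r)) (F t) (cIter F r k x))).2
      rw [← e1, ← e2, hdet, norm_zero, zero_mul, zero_mul, ← hU] at h1
      have hA : 0 < ‖F t‖ := by linarith [hbase t]
      rw [Finset.sum_range_succ, ← add_assoc, Real.exp_add]
      have h2 : ‖cIter F r (k + 2) x‖ ≤ ‖cIter F r (k + 1) x‖ * Real.exp (w t) :=
        le_of_mul_le_mul_right (by linarith) hA
      refine h2.trans ?_
      gcongr
  rw [← integral_birkhoff hwc hwp r, trunc_eq]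
  refine intervalIntegral.integral_mono_on zero_le_one
    (hF.intervalIntegrable_logT _ _ _ _) (Continuous.intervalIntegrable (by fun_prop) _ _)
    fun x _ => ?_
  have low : κ ^ (N + 1) ≤ ‖cIter F r (N + 1) x‖ := by
    refine le_trans ?_ (exp_sum_le_norm_cIter hκ hup hbase hw hU' N x)
    rw [pow_succ', Real.exp_sum]
    gcongr
    calc κ ^ N = ∏ i ∈ Finset.range N, κ := by simp
      _ ≤ _ := Finset.prod_le_prod (fun _ _ => hκ.le) fun _ _ => hw _
  have hpos : 0 < ‖cIter F r (N + 1) x‖ := lt_of_lt_of_le (by positivity) low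
  have hz : (x + (0:ℝ) * I : ℂ) = x := by simp
  rw [logT, hz, max_eq_left]
  · rw [Real.log_le_iff_le_exp hpos]; exact upper N x
  · refine le_trans ?_ low
    rw [← Real.exp_log (pow_pos hκ (N + 1)), Real.log_pow]
    apply Real.exp_le_exp.2
    have : (0:ℝ) ≤ (N + 1 : ℕ) := by positivity
    nlinarith

end NearSingular

/-- An affine lower bound for the truncated means improves to a linear one. -/
lemma Hol.le_trunc_of_affine {η : ℝ} {F : ℂ → M2} (hF : Hol η F) {r c K y : ℝ} {j : ℕ}
    (h : ∀ N, 0 < N → c * N - K ≤ trunc F r N j y) {N : ℕ} (hN : 0 < N) :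
    c * N ≤ trunc F r N j y := by
  by_contra! hlt
  obtain ⟨p, hp⟩ := exists_nat_gt (K / (c * N - trunc F r N j y))
  rw [div_lt_iff₀ (by linarith)] at hp
  have h1 := h ((p + 1) * N) (by positivity)
  have h2 := hF.trunc_mul_le r (Nat.succ_pos p) N j y
  push_cast at h1 h2
  nlinarith

lemma norm_det_sub_det_le {A B : M2} {R : ℝ} (hA : ‖A‖ ≤ R) (hB : ‖B‖ ≤ R) :
    ‖A.det - B.det‖ ≤ 4 * ‖A - B‖ * R := by
  have hR : 0 ≤ R := (norm_nonneg _).trans hA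
  have e : A.det - B.det = (A - B) 0 0 * A 1 1 + B 0 0 * (A - B) 1 1 - (A - B) 0 1 * A 1 0 -
      B 0 1 * (A - B) 1 0 := by
    simp only [Matrix.det_fin_two, Matrix.sub_apply]; ring
  have k1 : ∀ i j k l, ‖(A - B) i j * A k l‖ ≤ ‖A - B‖ * R := fun i j k l => by
    rw [norm_mul]
    exact mul_le_mul (norm_entry_le _ _ _) ((norm_entry_le _ _ _).trans hA) (norm_nonneg _) (norm_nonneg _)
  have k2 : ∀ i j k l, ‖B i j * (A - B) k l‖ ≤ ‖A - B‖ * R := fun i j k l => by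
    rw [norm_mul, mul_comm]
    exact mul_le_mul (norm_entry_le _ _ _) ((norm_entry_le _ _ _).trans hB) (norm_nonneg _) (norm_nonneg _)
  rw [e]
  refine (norm_sub_le _ _).trans ?_
  refine (add_le_add ((norm_sub_le _ _).trans (add_le_add ((norm_add_le _ _).trans
    (add_le_add (k1 _ _ _ _) (k2 _ _ _ _))) (k1 _ _ _ _))) (k2 _ _ _ _)).trans ?_
  linarith

lemma exists_pos_le_of_periodic {g : ℝ → ℝ} (hg : Continuous g) (hp : Function.Periodic g 1)
    (h0 : ∀ x, 0 < g x) : ∃ m > 0, ∀ x, m ≤ g x := by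
  obtain ⟨x₀, _, hx₀⟩ := (isCompact_Icc (a := (0:ℝ)) (b := 1)).exists_isMinOn
    ⟨0, by simp⟩ hg.continuousOn
  refine ⟨g x₀, h0 _, fun x => ?_⟩
  obtain ⟨y, hy, hxy⟩ := hp.exists_mem_Ico₀ one_pos x
  rw [hxy]
  exact hx₀ (Set.Ico_subset_Icc_self hy)

section Convergence

variable {ι : Type*} {l : Filter ι} {F : ι → ℂ → M2} {E : ℂ → M2} {η Λ β : ℝ} {r : ι → ℝ}

/-- Lower semicontinuity of the exponent at a rank-one cocycle. -/
theorem UConv.le_trunc_of_singular (hη : 0 < η) (h : UConv l F E) (hE : Cyl η Λ E)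
    (hF : ∀ᶠ n in l, Cyl η Λ (F n)) (hr : Tendsto r l (nhds β))
    (hdet : ∀ x : ℝ, (E x).det = 0) (hM : ∀ x : ℝ, E (x + β) * E x ≠ 0) {f : ℝ}
    (hf : ∀ N j : ℕ, 0 < N → f * N ≤ trunc E β N j 0) {ε : ℝ} (hε : 0 < ε) :
    ∀ᶠ n in l, ∀ N j : ℕ, 0 < N → (f - ε) * N ≤ trunc (F n) (r n) N j 0 := by
  have hMhol : Hol η (fun z => E (z + β) * E z) := (hE.hol.translate β).mul hE.hol
  have hMc : Continuous fun x : ℝ => ‖E (x + β) * E x‖ :=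
    hMhol.continuous_norm.comp continuous_ofReal
  have hEc : Continuous fun x : ℝ => ‖E x‖ := hE.hol.continuous_norm.comp continuous_ofReal
  have hMp : Function.Periodic (fun x : ℝ => ‖E (x + β) * E x‖) 1 := fun x => by
    have := hMhol.per x
    simp only [ofReal_add, ofReal_one]
    rw [this]
  have hEp : Function.Periodic (fun x : ℝ => ‖E x‖) 1 := fun x => by
    simp only [ofReal_add, ofReal_one]
    rw [hE.hol.per]
  obtain ⟨m₀, hm₀, hm₀le⟩ := exists_pos_le_of_periodic hMc hMp fun x => norm_pos_iff.2 (hM x)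
  set R := Real.exp Λ with hR
  have hRpos : 0 < R := Real.exp_pos _
  set ρ := m₀ / R with hρdef
  have hρ : 0 < ρ := by positivity
  have hρR : ρ * R = m₀ := by rw [hρdef]; field_simp
  have hEρ : ∀ x : ℝ, ρ ≤ ‖E x‖ := fun x => by
    rw [hρdef, div_le_iff₀ hRpos]
    have h1 := frob_mul_le (E (x + β)) (E x)
    have h2 := hm₀le x
    have h3 := hE.up (x + β)
    nlinarith [norm_nonneg (E x)]
  have hEpos : ∀ x : ℝ, 0 < ‖E x‖ := fun x => hρ.trans_le (hEρ x)
  have hMpos : ∀ x : ℝ, 0 < ‖E (x + β) * E x‖ := fun x => hm₀.trans_le (hm₀le x)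
  set w : ℝ → ℝ := fun x => Real.log ‖E (x + β) * E x‖ - Real.log ‖E x‖ with hw
  have hwexp : ∀ x, Real.exp (w x) = ‖E (x + β) * E x‖ / ‖E x‖ := fun x => by
    rw [hw]
    simp only
    rw [Real.exp_sub, Real.exp_log (hMpos x), Real.exp_log (hEpos x)]
  have hwmul : ∀ x : ℝ, Real.exp (w x) * ‖E x‖ = ‖E (x + β) * E x‖ := fun x => by
    rw [hwexp, div_mul_cancel₀ _ (hEpos x).ne']
  have hwρ : ∀ x, ρ ≤ Real.exp (w x) := fun x => by
    rw [hwexp, le_div_iff₀ (hEpos x)]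
    have := hE.up x
    nlinarith [hm₀le x]
  have hwR : ∀ x, Real.exp (w x) ≤ R := fun x => by
    rw [hwexp, div_le_iff₀ (hEpos x)]
    refine (frob_mul_le _ _).trans ?_
    gcongr
    exact hE.up _
  have hwc : Continuous w := (hMc.log fun x => (hMpos x).ne').sub (hEc.log fun x => (hEpos x).ne')
  have hwp : Function.Periodic w 1 := fun x => by
    have h1 := hMp x
    have h2 := hEp x
    simp only at h1 h2
    rw [hw]; simp only; rw [h1, h2]
  set W := ∫ x in (0:ℝ)..1, w x with hW
  have hκ : 0 < ρ / 4 := by positivity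
  have hfW : f ≤ W := by
    by_contra! hlt
    obtain ⟨N, hN⟩ := exists_nat_gt ((Λ - f) / (f - W))
    rw [div_lt_iff₀ (by linarith)] at hN
    have h1 := hf (N + 1) ⌈-Real.log (ρ / 4)⌉₊ N.succ_pos
    have h2 := trunc_le_of_singular (r := β) hE.hol hκ hE.up (fun x => by linarith [hEρ x])
      (fun x => by linarith [hwρ x]) hwc hwp hdet hwmul N (Nat.le_ceil _)
    push_cast at h1
    linarith
  set τ := min ε 1 with hτ
  have hτ0 : 0 < τ := lt_min hε one_pos
  have hτ1 : τ ≤ 1 := min_le_right _ _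
  have hτε : τ ≤ ε := min_le_left _ _
  have hexp1 : Real.exp (-τ) < 1 := by rw [Real.exp_lt_one_iff]; linarith
  have hexp4 : 1 / 4 ≤ Real.exp (-τ) := by
    have := Real.add_one_le_exp (-τ)
    have h1 : Real.exp (-1) ≤ Real.exp (-τ) := Real.exp_le_exp.2 (by linarith)
    have h2 := Real.exp_one_lt_d9
    rw [Real.exp_neg] at h1
    have h3 : (1:ℝ) / 4 ≤ (Real.exp 1)⁻¹ := by
      rw [one_div]; exact inv_anti₀ (Real.exp_pos _) (by linarith)
    linarith
  set K := 1 + 3 * R + 4 * R ^ 2 / (ρ / 4) with hK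
  have hK0 : 0 < K := by positivity
  set t := min (min 1 (ρ / 2)) ((1 - Real.exp (-τ)) * m₀ / K) with ht
  have hgap : 0 < (1 - Real.exp (-τ)) * m₀ := mul_pos (by linarith) hm₀
  have ht0 : 0 < t := lt_min (lt_min one_pos (by positivity)) (by positivity)
  have ht1 : t ≤ 1 := (min_le_left _ _).trans (min_le_left _ _)
  have htρ : t ≤ ρ / 2 := (min_le_left _ _).trans (min_le_right _ _)
  have htK : t * K ≤ (1 - Real.exp (-τ)) * m₀ := by
    have : t ≤ (1 - Real.exp (-τ)) * m₀ / K := min_le_right _ _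
    rwa [le_div_iff₀ hK0] at this
  have hrt : ∀ᶠ n in l, 4 * R / η * |r n - β| < t / 2 := by
    have h1 : Tendsto (fun n => 4 * R / η * |r n - β|) l (nhds (4 * R / η * |β - β|)) :=
      ((hr.sub_const β).abs).const_mul _
    rw [sub_self, abs_zero, mul_zero] at h1
    exact h1.eventually (gt_mem_nhds (by linarith))
  filter_upwards [hF, h (t / 2) (by linarith), hrt] with n hn hnt hnr N j hN
  have hFE : ∀ z, ‖F n z - E z‖ ≤ t := fun z => (hnt z).trans (by linarith)
  have hFE' : ∀ x : ℝ, ‖F n (x + r n) - E (x + β)‖ ≤ t := fun x => by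
    have h1 := hnt (x + r n)
    have h2 := hE.hol.lipschitz hη hE.up (x + r n) (x + β)
    push_cast at h2
    rw [show x + r n - (x + β) = r n - β by ring] at h2
    have h3 := norm_sub_le_norm_sub_add_norm_sub (F n (x + r n)) (E (x + r n)) (E (x + β))
    linarith
  set w' : ℝ → ℝ := fun x => w x - τ with hw'
  have hw'exp : ∀ x, Real.exp (w' x) = Real.exp (w x) * Real.exp (-τ) := fun x => by
    rw [← Real.exp_add]; rfl
  have hint : ∫ x in (0:ℝ)..1, w' x = W - τ := by
    rw [hw', intervalIntegral.integral_sub (hwc.intervalIntegrable _ _) intervalIntegrable_const]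
    simp [hW]
  have hFlow : ∀ x : ℝ, ‖E x‖ - t ≤ ‖F n x‖ := fun x => by
    have h1 := norm_sub_norm_le (E x) (F n x)
    rw [norm_sub_rev] at h1
    linarith [hFE x]
  have key := le_trunc_of_nearSingular (r := r n) (w := w') hn.hol hκ hn.up
    (fun x => by linarith [hFlow x, hEρ x])
    (fun x => by rw [hw'exp]; nlinarith [hwρ x]) (hwc.sub continuous_const)
    (fun x => by rw [hw']; simp only; rw [hwp x])
    (fun x => by
      have a1 : ‖(F n x).det‖ ≤ 4 * t * R := by
        have := norm_det_sub_det_le (hn.up x) (hE.up x)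
        rw [hdet, sub_zero] at this
        refine this.trans ?_
        gcongr
        exact hFE x
      have a2 : ‖(F n x).det‖ * R / (ρ / 4) ≤ t * (4 * R ^ 2 / (ρ / 4)) := by
        calc _ ≤ 4 * t * R * R / (ρ / 4) := by gcongr
          _ = _ := by ring
      have a3 : ‖F n x‖ ≤ ‖E x‖ + t := by
        have h1 := norm_sub_norm_le (F n x) (E x)
        linarith [hFE x]
      have a4 : Real.exp (w' x) * ‖F n x‖ ≤ Real.exp (-τ) * ‖E (x + β) * E x‖ + R * t := by
        calc _ ≤ Real.exp (w' x) * (‖E x‖ + t) := by gcongr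
          _ = Real.exp (-τ) * (Real.exp (w x) * ‖E x‖) + Real.exp (w x) * Real.exp (-τ) * t := by
            rw [hw'exp]; ring
          _ ≤ _ := by
            rw [hwmul]
            gcongr
            calc _ ≤ R * 1 := mul_le_mul (hwR x) hexp1.le (Real.exp_pos _).le hRpos.le
              _ = R := mul_one R
      have a5 : ‖F n (x + r n) * F n x - E (x + β) * E x‖ ≤ t * 1 + t * R + R * t := by
        refine (frob_mul_sub_le _ _ _ _).trans ?_
        have := hFE' x
        have := hFE x
        have := hE.up x
        have := hE.up (x + β)
        gcongr
        · linarith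
      have a6 := norm_sub_norm_le (E (x + β) * E x) (F n (x + r n) * F n x)
      rw [norm_sub_rev] at a6
      have a7 : (1 - Real.exp (-τ)) * m₀ ≤ (1 - Real.exp (-τ)) * ‖E (x + β) * E x‖ :=
        mul_le_mul_of_nonneg_left (hm₀le x) (by linarith)
      rw [hK] at htK
      change _ + ‖(F n x).det‖ * R / (ρ / 4) ≤ _
      linarith)
  have fin := hn.hol.le_trunc_of_affine (r := r n) (c := W - τ) (K := W - τ - Real.log (ρ / 4))
    (y := 0) (j := j) (fun M hM => by
      obtain ⟨k, rfl⟩ := Nat.exists_eq_succ_of_ne_zero hM.ne'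
      have := key k j
      rw [hint] at this
      push_cast at this ⊢
      linarith) hN
  refine le_trans ?_ fin
  gcongr

end Convergence

section Transfer

variable {η : ℝ} {E : ℂ → M2}

lemma Hol.le_trunc_of_multiples (hE : Hol η E) {r c y : ℝ} {M i : ℕ} (hM : 0 < M)
    (h : ∀ p j : ℕ, 0 < p → i ≤ j → c * (M * p : ℕ) ≤ trunc E r (M * p) j y) {N : ℕ} (hN : 0 < N)
    (j : ℕ) : c * N ≤ trunc E r N j y := by
  have hM' : (0:ℝ) < M := by exact_mod_cast hM
  have h1 := h N (max i j) hN (le_max_left _ _)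
  have h2 := hE.trunc_mul_le r hM N (max i j) y
  have h3 := hE.trunc_anti r N (le_max_right i j) y
  refine le_of_mul_le_mul_left ?_ hM'
  push_cast at h1
  nlinarith

lemma Hol.trunc_multiples_le (hE : Hol η E) {r b y : ℝ} {M i : ℕ}
    (h : trunc E r M i y ≤ b * M) {p j : ℕ} (hp : 0 < p) (hj : i ≤ j) :
    trunc E r (M * p) j y ≤ b * (M * p : ℕ) := by
  have hp' : (0:ℝ) < p := by exact_mod_cast hp
  have h2 := hE.trunc_mul_le r hp M j y
  have h3 := hE.trunc_anti r M hj y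
  rw [mul_comm]
  push_cast
  nlinarith

lemma Hol.two_mul_trunc_le (hE : Hol η E) (r : ℝ) (N j : ℕ) {y s : ℝ} (h1 : |y - s| < η)
    (h2 : |y + s| < η) :
    2 * trunc E r N j y ≤ trunc E r N j (y - s) + trunc E r N j (y + s) := by
  have hm : max |y - s| |y + s| < η := max_lt h1 h2
  have hc := hE.trunc_convex hm r N j
  have := hc.2 (abs_le.1 (le_max_left |y - s| |y + s|)) (abs_le.1 (le_max_right |y - s| |y + s|))
    (show (0:ℝ) ≤ 1 / 2 by norm_num) (show (0:ℝ) ≤ 1 / 2 by norm_num) (by norm_num)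
  simp only [smul_eq_mul] at this
  rw [show 1 / 2 * (y - s) + 1 / 2 * (y + s) = y by ring] at this
  linarith

lemma Hol.continuousAt_trunc (hη : 0 < η) (hE : Hol η E) (r : ℝ) (N j : ℕ) :
    ContinuousAt (trunc E r N j) 0 := by
  have hc := hE.trunc_convex (show η / 2 < η by linarith) r N j
  have := hc.continuousOn_interior
  rw [interior_Icc] at this
  exact this.continuousAt (Ioo_mem_nhds (by linarith) (by linarith))

end Transfer

section Convergence

variable {ι : Type*} {l : Filter ι} [l.IsCountablyGenerated] {F : ι → ℂ → M2} {E : ℂ → M2}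
  {η Λ β : ℝ} {r : ι → ℝ}

/-- Lower semicontinuity of the exponent on the line `Im z = y`. -/
def LowerSemi (l : Filter ι) (F : ι → ℂ → M2) (r : ι → ℝ) (E : ℂ → M2) (β y : ℝ) : Prop :=
  ∀ f : ℝ, (∀ N j : ℕ, 0 < N → f * N ≤ trunc E β N j y) → ∀ ε > 0, ∀ᶠ n in l,
    ∀ N j : ℕ, 0 < N → (f - ε) * N ≤ trunc (F n) (r n) N j y

/-- Lower semicontinuity on lines arbitrarily close to the real axis passes to the real axis. -/
theorem UConv.lowerSemi_zero (hη : 0 < η) (h : UConv l F E) (hE : Cyl η Λ E)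
    (hF : ∀ᶠ n in l, Cyl η Λ (F n)) (hr : Tendsto r l (nhds β))
    (hline : (∃ c : ℝ, ∀ N j : ℕ, 0 < N → c * N ≤ trunc E β N j 0) →
      ∀ t > 0, ∃ y, 0 < y ∧ y < t ∧ LowerSemi l F r E β y) :
    LowerSemi l F r E β 0 := by
  intro c hc ε hε
  set S : Set ℝ := {a | ∃ N j : ℕ, 0 < N ∧ a = trunc E β N j 0 / N} with hS
  have hSne : S.Nonempty := ⟨_, 1, 0, one_pos, rfl⟩
  have hSb : c ∈ lowerBounds S := by
    rintro _ ⟨N, j, hN, rfl⟩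
    rw [le_div_iff₀ (by exact_mod_cast hN)]
    exact hc N j hN
  set f := sInf S with hf
  have hcf : c ≤ f := le_csInf hSne hSb
  have hfle : ∀ N j : ℕ, 0 < N → f * N ≤ trunc E β N j 0 := by
    intro N j hN
    rw [← le_div_iff₀ (by exact_mod_cast hN)]
    exact csInf_le ⟨c, hSb⟩ ⟨N, j, hN, rfl⟩
  set s := ε / 8 with hs
  have hs0 : 0 < s := by positivity
  obtain ⟨_, ⟨M, i, hM, rfl⟩, hMi⟩ := exists_lt_of_csInf_lt hSne (show sInf S < f + s by linarith)
  have hM' : (0:ℝ) < M := by exact_mod_cast hM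
  rw [div_lt_iff₀ hM'] at hMi
  have hcont := hE.hol.continuousAt_trunc hη β M i
  have hev := hcont.eventually (gt_mem_nhds (show trunc E β M i 0 < (f + 2 * s) * M by nlinarith))
  obtain ⟨t, ht, htb⟩ := Metric.eventually_nhds_iff.1 hev
  obtain ⟨y, hy0, hyt, hy⟩ := hline ⟨c, hc⟩ (min t η / 2) (by positivity)
  have hyt2 : 2 * y < t := by linarith [min_le_left t η]
  have hyη : 2 * y < η := by linarith [min_le_right t η]
  have b1 : trunc E β M i (-y) < (f + 2 * s) * M := htb (by
    rw [Real.dist_eq, sub_zero, abs_neg, abs_of_pos hy0]; linarith)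
  have b2 : trunc E β M i (2 * y) < (f + 2 * s) * M := htb (by
    rw [Real.dist_eq, sub_zero, abs_of_pos (by linarith)]; linarith)
  have hEy : ∀ N j : ℕ, 0 < N → (f - 2 * s) * N ≤ trunc E β N j y := by
    intro N j hN
    refine hE.hol.le_trunc_of_multiples hM (i := i) (fun p j hp hj => ?_) hN j
    have h1 := hE.hol.trunc_multiples_le b1.le hp hj
    have h2 := hE.hol.two_mul_trunc_le β (M * p) j (y := 0) (s := y)
      (by rw [zero_sub, abs_neg, abs_of_pos hy0]; linarith)
      (by rw [zero_add, abs_of_pos hy0]; linarith)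
    rw [zero_sub, zero_add] at h2
    have h3 := hfle (M * p) j (by positivity)
    linarith
  have ht2 := (h.tendsto_trunc hE.hol hF hr hM i (2 * y)).eventually (gt_mem_nhds b2)
  filter_upwards [hF, hy _ hEy s hs0, ht2] with n hn hny hn2 N j hN
  refine hn.hol.le_trunc_of_multiples hM (i := i) (fun p j hp hj => ?_) hN j
  have h1 := hn.hol.trunc_multiples_le hn2.le hp hj
  have h2 := hn.hol.two_mul_trunc_le (r n) (M * p) j (y := y) (s := y)
    (by rw [sub_self, abs_zero]; exact hη)
    (by rw [abs_of_pos (by linarith)]; linarith)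
  rw [sub_self, ← two_mul] at h2
  have h3 := hny (M * p) j (by positivity)
  have h4 : (c - ε) * (M * p : ℕ) ≤ (f - 8 * s) * (M * p : ℕ) := by
    apply mul_le_mul_of_nonneg_right _ (by positivity)
    linarith
  linarith

end Convergence

/-- A nonzero periodic holomorphic function has zero-free lines arbitrarily close to the real axis. -/
lemma HolS.exists_line_ne_zero {η : ℝ} (hη : 0 < η) {g : ℂ → ℂ} (hg : HolS η g) {z₀ : ℂ}
    (hz₀ : |z₀.im| < η) (hne : g z₀ ≠ 0) {t : ℝ} (ht : 0 < t) :
    ∃ y, 0 < y ∧ y < t ∧ ∀ x : ℝ, g (x + y * I) ≠ 0 := by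
  by_contra! hcon
  have hz : ∀ k : ℕ, ∃ z : ℂ, z.re ∈ Set.Icc (0:ℝ) 1 ∧ z.im = t / (k + 2) ∧ g z = 0 := by
    intro k
    have hk : (0:ℝ) < k + 2 := by positivity
    obtain ⟨x, hx⟩ := hcon (t / (k + 2)) (by positivity)
      (div_lt_self ht (by linarith [(Nat.cast_nonneg k : (0:ℝ) ≤ k)]))
    obtain ⟨w, hw1, hw2, hw3⟩ := exists_re_mem_Icc hg.per (x + (t / (k + 2) : ℝ) * I)
    refine ⟨w, hw1, ?_, by rw [hw3, hx]⟩
    rw [hw2, add_im, ofReal_im, im_ofReal_mul, I_im, mul_one, zero_add]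
  choose z hre him hgz using hz
  obtain ⟨a, -, φ, hφ, hlim⟩ := (isCompact_Icc (a := (0:ℝ)) (b := 1)).tendsto_subseq hre
  have him0 : Tendsto (fun k : ℕ => t / ((k:ℝ) + 2)) atTop (nhds 0) := by
    refine Tendsto.div_atTop tendsto_const_nhds ?_
    exact tendsto_atTop_add_const_right _ _ tendsto_natCast_atTop_atTop
  have hzlim : Tendsto (fun k => z (φ k)) atTop (nhds (a : ℂ)) := by
    have h1 : Tendsto (fun k => ((z (φ k)).re : ℂ) + ((t / ((φ k : ℝ) + 2) : ℝ) : ℂ) * I) atTop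
        (nhds ((a : ℂ) + ((0:ℝ) : ℂ) * I)) :=
      ((continuous_ofReal.tendsto a).comp hlim).add
        (((continuous_ofReal.tendsto 0).comp (him0.comp hφ.tendsto_atTop)).mul_const I)
    simp only [ofReal_zero, zero_mul, add_zero] at h1
    refine h1.congr fun k => ?_
    rw [← him, re_add_im]
  have hfreq : ∃ᶠ w in nhdsWithin (a : ℂ) {(a : ℂ)}ᶜ, g w = 0 := by
    have h2 : Tendsto (fun k => z (φ k)) atTop (nhdsWithin (a : ℂ) {(a : ℂ)}ᶜ) := by
      refine tendsto_nhdsWithin_iff.2 ⟨hzlim, Eventually.of_forall fun k hk => ?_⟩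
      have h3 : (z (φ k)).im = 0 := by rw [Set.mem_singleton_iff.1 hk, ofReal_im]
      rw [him] at h3
      have : (0:ℝ) < t / ((φ k : ℝ) + 2) := by positivity
      linarith
    exact h2.frequently (Eventually.of_forall fun k => hgz (φ k)).frequently
  have hconv : Convex ℝ {z : ℂ | |z.im| < η} := by
    have : {z : ℂ | |z.im| < η} = Complex.imLm ⁻¹' (Set.Ioo (-η) η) := by
      ext z; simp [abs_lt]
    rw [this]
    exact (convex_Ioo _ _).linear_preimage _
  have hopen : IsOpen {z : ℂ | |z.im| < η} := isOpen_lt (by fun_prop) continuous_const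
  exact hne ((hg.diff.analyticOnNhd hopen).eqOn_zero_of_preconnected_of_frequently_eq_zero
    hconv.isPreconnected (by simpa using hη) hfreq hz₀)

/-- Projection onto the closed strip of half-width `η`. -/
def clampIm (η : ℝ) (z : ℂ) : ℂ := z.re + (max (-η) (min z.im η) : ℝ) * I

lemma clampIm_im (η : ℝ) (z : ℂ) : (clampIm η z).im = max (-η) (min z.im η) := by simp [clampIm]

lemma abs_clampIm_im_le {η : ℝ} (hη : 0 ≤ η) (z : ℂ) : |(clampIm η z).im| ≤ η := by
  rw [clampIm_im, abs_le]
  exact ⟨le_max_left _ _, max_le (by linarith) (min_le_right _ _)⟩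

lemma clampIm_of_abs_le {η : ℝ} {z : ℂ} (h : |z.im| ≤ η) : clampIm η z = z := by
  obtain ⟨h1, h2⟩ := abs_le.1 h
  rw [clampIm, min_eq_left h2, max_eq_right h1, re_add_im]

lemma clampIm_add (η : ℝ) (z : ℂ) (r : ℝ) : clampIm η (z + r) = clampIm η z + r := by
  simp [clampIm]; ring

lemma continuous_clampIm (η : ℝ) : Continuous (clampIm η) := by unfold clampIm; fun_prop

/-- Horizontal line at height `y`, thickened to a strip of half-width `η`. -/
def thicken (η y : ℝ) (z : ℂ) : ℂ := clampIm η z + y * I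

lemma thicken_add (η y : ℝ) (z : ℂ) (r : ℝ) : thicken η y (z + r) = thicken η y z + r := by
  rw [thicken, thicken, clampIm_add]; ring

lemma thicken_ofReal {η : ℝ} (hη : 0 ≤ η) (y x : ℝ) : thicken η y x = x + y * I := by
  rw [thicken, clampIm_of_abs_le (by simpa using hη)]

lemma continuous_thicken (η y : ℝ) : Continuous (thicken η y) :=
  (continuous_clampIm η).add continuous_const

lemma abs_thicken_im_le {η : ℝ} (hη : 0 ≤ η) (y : ℝ) (z : ℂ) : |(thicken η y z).im| ≤ η + |y| := by
  have : (thicken η y z).im = (clampIm η z).im + y := by simp [thicken]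
  rw [this]
  exact (abs_add_le _ _).trans (by linarith [abs_clampIm_im_le hη z])

lemma cIter_comp {T : ℂ → ℂ} {r : ℝ} (hT : ∀ z, T (z + r) = T z + r) (E : ℂ → M2) (N : ℕ) (z : ℂ) :
    cIter (fun z => E (T z)) r N z = cIter E r N (T z) := by
  induction N generalizing z with
  | zero => rfl
  | succ N ih => rw [cIter_succ, cIter_succ, ih, hT]

lemma trunc_thicken {η : ℝ} (hη : 0 ≤ η) (y : ℝ) (E : ℂ → M2) (r : ℝ) (N j : ℕ) :
    trunc (fun z => E (thicken η y z)) r N j 0 = trunc E r N j y := by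
  unfold trunc lineAvg
  simp only [cIter_comp fun z => thicken_add η y z r]
  congr 1; ext x
  simp only [ofReal_zero, zero_mul, add_zero, thicken_ofReal hη]

/-- Restriction of a function on an open strip to a smaller closed strip, extended by clamping. -/
lemma HolS.of_thicken {η η' y : ℝ} (hη' : 0 < η') (hy : η' + |y| < η) {g : ℂ → ℂ}
    (hd : DifferentiableOn ℂ g {z | |z.im| < η}) (hp : ∀ z : ℂ, |z.im| < η → g (z + 1) = g z) :
    HolS η' (fun z => g (thicken η' y z)) := by
  have hmem : ∀ z, |(thicken η' y z).im| < η := fun z =>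
    (abs_thicken_im_le hη'.le y z).trans_lt hy
  have hopen : IsOpen {z : ℂ | |z.im| < η} := isOpen_lt (by fun_prop) continuous_const
  refine ⟨?_, fun z => ?_, ?_⟩
  · exact hd.continuousOn.comp_continuous (continuous_thicken _ _) hmem
  · have := thicken_add η' y z 1
    rw [ofReal_one] at this
    rw [this, hp _ (hmem z)]
  · have h1 : DifferentiableOn ℂ (fun z : ℂ => g (z + y * I)) {z | |z.im| < η'} := by
      refine hd.comp (by fun_prop) fun z hz => ?_
      have hz' : |z.im| < η' := hz
      have : (z + y * I).im = z.im + y := by simp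
      change |_| < η
      rw [this]
      linarith [abs_add_le z.im y]
    refine h1.congr fun z hz => ?_
    have hz' : |z.im| < η' := hz
    rw [thicken, clampIm_of_abs_le hz'.le]

lemma Hol.thicken {η η' y : ℝ} (hη' : 0 < η') (hy : η' + |y| < η) {E : ℂ → M2} (hE : Hol η E) :
    Hol η' (fun z => E (thicken η' y z)) := fun i j =>
  HolS.of_thicken hη' hy (hE i j).diff fun z _ => (hE i j).per z

/-- A periodic function without zeros on a horizontal line is bounded below on a thin strip
around that line. -/
lemma HolS.exists_thicken_lower {η y : ℝ} {g : ℂ → ℂ} (hg : HolS η g) (hy : |y| < η)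
    (hne : ∀ x : ℝ, g (x + y * I) ≠ 0) :
    ∃ η' c : ℝ, 0 < η' ∧ 0 < c ∧ η' + |y| < η ∧ ∀ z, c ≤ ‖g (thicken η' y z)‖ := by
  obtain ⟨c, hc, hcle⟩ := exists_pos_le_of_periodic (g := fun x : ℝ => ‖g (x + y * I)‖)
    (hg.cont.norm.comp (by fun_prop)) (fun x => by
      have := hg.per (x + y * I)
      simp only [ofReal_add, ofReal_one]
      rw [← this]; congr 2; ring) (fun x => norm_pos_iff.2 (hne x))
  have hK : IsCompact (Set.Icc (0:ℝ) 1 ×ℂ Set.Icc (y - 1) (y + 1)) :=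
    isCompact_Icc.reProdIm isCompact_Icc
  have huc := hK.uniformContinuousOn_of_continuous hg.cont.continuousOn
  obtain ⟨ρ, hρ, hρd⟩ := Metric.uniformContinuousOn_iff.1 huc (c / 2) (by linarith)
  refine ⟨min (min (ρ / 2) ((η - |y|) / 2)) 1, c / 2, ?_, by linarith, ?_, fun z => ?_⟩
  · exact lt_min (lt_min (by linarith) (by linarith)) one_pos
  · have := (min_le_left (min (ρ / 2) ((η - |y|) / 2)) 1).trans (min_le_right _ _)
    linarith
  · set η' := min (min (ρ / 2) ((η - |y|) / 2)) 1 with hη'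
    have h0 : 0 < η' := lt_min (lt_min (by linarith) (by linarith)) one_pos
    have h1 : η' ≤ 1 := min_le_right _ _
    have h2 : η' ≤ ρ / 2 := (min_le_left _ _).trans (min_le_left _ _)
    obtain ⟨w, hw1, hw2, hw3⟩ := exists_re_mem_Icc hg.per (thicken η' y z)
    have him : |w.im - y| ≤ η' := by
      rw [hw2]
      have : (thicken η' y z).im - y = (clampIm η' z).im := by simp [thicken]
      rw [this]
      exact abs_clampIm_im_le h0.le z
    rw [← hw3]
    obtain ⟨k1, k2⟩ := abs_le.1 him
    have hd := hρd w (by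
      rw [Complex.mem_reProdIm]; exact ⟨hw1, by constructor <;> linarith⟩) (w.re + y * I) (by
      rw [Complex.mem_reProdIm]
      refine ⟨by simpa using hw1, ?_⟩
      simp) (by
      have : w - (w.re + y * I) = ((w.im - y : ℝ) : ℂ) * I := by
        push_cast
        linear_combination -(1 : ℂ) * re_add_im w
      rw [dist_eq_norm, this, norm_mul, norm_I, mul_one, norm_real, Real.norm_eq_abs]
      linarith)
    rw [dist_eq_norm] at hd
    have h3 := norm_sub_norm_le (g (w.re + y * I)) (g w)
    rw [norm_sub_rev] at h3
    have := hcle w.re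
    linarith

section Convergence

variable {ι : Type*} {l : Filter ι} {F : ι → ℂ → M2} {E : ℂ → M2}
  {η Λ β y : ℝ} {r : ι → ℝ}

theorem UConv.lowerSemi_of_det_ne_zero [l.IsCountablyGenerated] (h : UConv l F E)
    (hE : Cyl η Λ E)
    (hF : ∀ᶠ n in l, Cyl η Λ (F n)) (hr : Tendsto r l (nhds β)) (hβ : Irrational β) (hy : |y| < η)
    (hdet : ∀ x : ℝ, (E (x + y * I)).det ≠ 0) : LowerSemi l F r E β y := by
  intro f hf ε hε
  obtain ⟨η', c, hη', hc, hyη, hcle⟩ := hE.hol.det.exists_thicken_lower hy hdet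
  set Λ' := Λ + 1 + |Real.log (c / 2)| with hΛ'
  have hΛΛ' : Λ ≤ Λ' := by linarith [abs_nonneg (Real.log (c / 2))]
  have hΛ'0 : 0 < Λ' := by linarith [abs_nonneg (Real.log (c / 2)), hE.nonneg]
  have hexp : Real.exp (-(2 * Λ')) ≤ c / 2 := by
    rw [← Real.le_log_iff_exp_le (by linarith)]
    linarith [neg_abs_le (Real.log (c / 2)), abs_nonneg (Real.log (c / 2)), hE.nonneg]
  have hEw : Win η' Λ' (fun z => E (thicken η' y z)) :=
    ⟨hE.hol.thicken hη' hyη, fun z => (hE.up _).trans (Real.exp_le_exp.2 hΛΛ'),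
      fun z => hexp.trans (by linarith [hcle z])⟩
  have hFw : ∀ᶠ n in l, Win η' Λ' (fun z => F n (thicken η' y z)) := by
    have hR := Real.exp_pos Λ
    filter_upwards [hF, h (c / (8 * Real.exp Λ)) (by positivity)] with n hn hnc
    refine ⟨hn.hol.thicken hη' hyη, fun z => (hn.up _).trans (Real.exp_le_exp.2 hΛΛ'),
      fun z => hexp.trans ?_⟩
    have h1 := norm_det_sub_det_le (hn.up (thicken η' y z)) (hE.up (thicken η' y z))
    have h2 : 4 * ‖F n (thicken η' y z) - E (thicken η' y z)‖ * Real.exp Λ ≤ c / 2 := by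
      calc _ ≤ 4 * (c / (8 * Real.exp Λ)) * Real.exp Λ := by gcongr; exact hnc _
        _ = c / 2 := by field_simp; norm_num
    have h3 := norm_sub_norm_le (E (thicken η' y z)).det (F n (thicken η' y z)).det
    rw [norm_sub_rev] at h3
    linarith [hcle z]
  have hu : UConv l (fun n z => F n (thicken η' y z)) (fun z => E (thicken η' y z)) :=
    fun ε hε => (h ε hε).mono fun n hn z => hn _
  have key := hu.le_uN hη' hΛ'0 hEw hFw hr hβ (f := f) (fun N hN => by
    rw [uN, le_div_iff₀ (by exact_mod_cast hN), ← hEw.trunc_eq_meanN β N (Nat.le_ceil Λ'),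
      trunc_thicken hη'.le]
    exact hf N _ hN) hε
  filter_upwards [key, hF, hFw] with n hn hnF hnw N j hN
  have h1 := hn N hN
  rw [uN, le_div_iff₀ (by exact_mod_cast hN), ← hnw.trunc_eq_meanN (r n) N
    ((Nat.le_ceil Λ').trans (by exact_mod_cast le_max_right j ⌈Λ'⌉₊)), trunc_thicken hη'.le] at h1
  exact h1.trans (hnF.hol.trunc_anti _ _ (le_max_left _ _) _)

theorem UConv.lowerSemi_of_det_eq_zero (h : UConv l F E) (hE : Cyl η Λ E)
    (hF : ∀ᶠ n in l, Cyl η Λ (F n)) (hr : Tendsto r l (nhds β)) (hy : |y| < η)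
    (hdet : ∀ x : ℝ, (E (x + y * I)).det = 0)
    (hM : ∀ x : ℝ, E (x + y * I + β) * E (x + y * I) ≠ 0) : LowerSemi l F r E β y := by
  intro f hf ε hε
  set η' := (η - |y|) / 2 with hη'def
  have hη' : 0 < η' := by rw [hη'def]; linarith
  have hyη : η' + |y| < η := by rw [hη'def]; linarith
  have hcyl : ∀ {G : ℂ → M2}, Cyl η Λ G → Cyl η' Λ (fun z => G (thicken η' y z)) := fun hG =>
    ⟨hG.hol.thicken hη' hyη, fun z => hG.up _, hG.nonneg⟩
  have hu : UConv l (fun n z => F n (thicken η' y z)) (fun z => E (thicken η' y z)) :=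
    fun ε hε => (h ε hε).mono fun n hn z => hn _
  have key := hu.le_trunc_of_singular hη' (hcyl hE) (hF.mono fun n hn => hcyl hn) hr
    (fun x => by rw [thicken_ofReal hη'.le]; exact hdet x)
    (fun x => by rw [thicken_add, thicken_ofReal hη'.le]; exact hM x) (f := f)
    (fun N j hN => by rw [trunc_thicken hη'.le]; exact hf N j hN) hε
  simpa only [trunc_thicken hη'.le] using key

/-- Lower semicontinuity of the exponent of an arbitrary bounded analytic cocycle. -/
theorem UConv.lowerSemi [l.IsCountablyGenerated] (hη : 0 < η) (h : UConv l F E) (hE : Cyl η Λ E)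
    (hF : ∀ᶠ n in l, Cyl η Λ (F n)) (hr : Tendsto r l (nhds β)) (hβ : Irrational β) :
    LowerSemi l F r E β 0 := by
  refine h.lowerSemi_zero hη hE hF hr fun ⟨c, hc⟩ t ht => ?_
  by_cases hdet : ∀ z : ℂ, |z.im| < η → (E z).det = 0
  · have hMhol : Hol η (fun z => E (z + β) * E z) := (hE.hol.translate β).mul hE.hol
    have hex : ∃ z : ℂ, |z.im| < η ∧ E (z + β) * E z ≠ 0 := by
      by_contra! hcon
      obtain ⟨j, hj⟩ := exists_nat_gt (-c)
      have h1 := hc 2 j two_pos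
      have h2 : trunc E β 2 j 0 = -(j * (2 : ℕ) : ℝ) := by
        rw [trunc_eq]
        have : ∀ x : ℝ, logT E β 2 j (x + (0:ℝ) * I) = -(j * (2 : ℕ) : ℝ) := fun x => by
          have h3 : cIter E β 2 (x + (0:ℝ) * I) = 0 := by
            rw [cIter_succ, cIter_one]
            exact hcon _ (by simpa using hη)
          rw [logT, h3, norm_zero, max_eq_right (Real.exp_pos _).le, Real.log_exp]
        simp only [this]
        simp
      rw [h2] at h1
      push_cast at h1
      linarith
    obtain ⟨z₀, hz₀, hne⟩ := hex
    obtain ⟨a, b, hab⟩ : ∃ a b, (E (z₀ + β) * E z₀) a b ≠ 0 := by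
      by_contra! hcon
      exact hne (Matrix.ext hcon)
    obtain ⟨y, hy0, hyt, hy⟩ := (hMhol a b).exists_line_ne_zero hη hz₀ hab (lt_min ht hη)
    have hyη : |y| < η := by rw [abs_of_pos hy0]; exact hyt.trans_le (min_le_right _ _)
    refine ⟨y, hy0, hyt.trans_le (min_le_left _ _),
      h.lowerSemi_of_det_eq_zero hE hF hr hyη (fun x => hdet _ (by simpa using hyη)) fun x h0 => ?_⟩
    exact hy x (by simp only [h0, Matrix.zero_apply])
  · push Not at hdet
    obtain ⟨z₀, hz₀, hne⟩ := hdet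
    obtain ⟨y, hy0, hyt, hy⟩ := hE.hol.det.exists_line_ne_zero hη hz₀ hne (lt_min ht hη)
    have hyη : |y| < η := by rw [abs_of_pos hy0]; exact hyt.trans_le (min_le_right _ _)
    exact ⟨y, hy0, hyt.trans_le (min_le_left _ _),
      h.lowerSemi_of_det_ne_zero hE hF hr hβ hyη hy⟩

end Convergence

/-- Evaluation of a matrix entry, as a continuous linear functional for the Frobenius norm. -/
def entryCLM (i j : Fin 2) : M2 →L[ℂ] ℂ :=
  LinearMap.mkContinuous
    { toFun := fun A => A i j
      map_add' := fun _ _ => rfl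
      map_smul' := fun _ _ => rfl } 1 fun A => by
    rw [one_mul]; exact norm_entry_le A i j

lemma hol_thicken_of_differentiableOn {δ η : ℝ} (hη : 0 < η) (hηδ : η < δ) {A : ℂ → M2}
    (hd : DifferentiableOn ℂ A {z : ℂ | |z.im| < δ})
    (hp : ∀ z : ℂ, |z.im| < δ → A (z + 1) = A z) : Hol η (fun z => A (thicken η 0 z)) :=
  fun i j => HolS.of_thicken (g := fun z => A z i j) hη (by simpa using hηδ)
    ((entryCLM i j).differentiable.comp_differentiableOn hd)
    (fun z hz => by simp only [hp z hz])

lemma exists_bound_thicken {η : ℝ} (hη : 0 ≤ η) {A : ℂ → M2}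
    (hA : Hol η (fun z => A (thicken η 0 z))) : ∃ B : ℝ, ∀ z, ‖A (thicken η 0 z)‖ ≤ B := by
  have hK : IsCompact (Set.Icc (0:ℝ) 1 ×ℂ Set.Icc (-η) η) := isCompact_Icc.reProdIm isCompact_Icc
  obtain ⟨B, hB⟩ := hK.exists_bound_of_continuousOn hA.continuous_norm.continuousOn
  have hid : ∀ z : ℂ, thicken η 0 (clampIm η z) = thicken η 0 z := fun z => by
    simp only [thicken, clampIm_of_abs_le (abs_clampIm_im_le hη z)]
  refine ⟨B, fun z => ?_⟩
  obtain ⟨w, hw1, hw2, hw3⟩ := exists_re_mem_Icc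
    (u := fun z => ‖A (thicken η 0 z)‖) (fun z => by simp only [hA.per]) (clampIm η z)
  have h1 := hB w (by
    rw [Complex.mem_reProdIm, hw2]
    exact ⟨hw1, abs_le.1 (abs_clampIm_im_le hη z)⟩)
  rw [norm_norm] at h1
  simp only [hid] at hw3
  rwa [hw3] at h1

/-- Continuity of the Lyapunov exponent along uniformly convergent cylinder cocycles. -/
theorem UConv.tendsto_lyapunov {ι : Type*} {l : Filter ι} [l.IsCountablyGenerated]
    {F : ι → ℂ → M2} {E : ℂ → M2} {η Λ β : ℝ} {r : ι → ℝ} (hη : 0 < η) (h : UConv l F E)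
    (hE : Cyl η Λ E) (hF : ∀ᶠ n in l, Cyl η Λ (F n)) (hr : Tendsto r l (nhds β))
    (hβ : Irrational β) :
    Tendsto (fun n => lyapunov (r n) (fun x : ℝ => F n (x + (0:ℝ) * I))) l
      (nhds (lyapunov β (fun x : ℝ => E (x + (0:ℝ) * I)))) := by
  refine tendsto_order.2 ⟨fun a ha => ?_, fun a ha => ?_⟩
  · obtain ⟨c, hac, hcL⟩ := EReal.lt_iff_exists_real_btwn.1 ha
    obtain ⟨c', hac', hcc'⟩ := EReal.lt_iff_exists_real_btwn.1 hac
    have hlt : c' < c := EReal.coe_lt_coe_iff.1 hcc'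
    have hf : ∀ N j : ℕ, 0 < N → c * N ≤ trunc E β N j 0 := fun N j hN => by
      by_contra hcon
      exact absurd hcL (not_lt.2 ((lyapunov_lt_iff hE.hol β 0 c).2
        ⟨N, j, hN, not_le.1 hcon⟩).le)
    filter_upwards [h.lowerSemi hη hE hF hr hβ c hf (c - c') (sub_pos.2 hlt), hF] with n hn hnF
    refine hac'.trans_le (not_lt.1 fun hcon => ?_)
    obtain ⟨N, j, hN, hNj⟩ := (lyapunov_lt_iff hnF.hol (r n) 0 c').1 hcon
    have := hn N j hN
    rw [sub_sub_cancel] at this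
    linarith
  · obtain ⟨c, hLc, hca⟩ := EReal.lt_iff_exists_real_btwn.1 ha
    obtain ⟨N, j, hN, hNj⟩ := (lyapunov_lt_iff hE.hol β 0 c).1 hLc
    filter_upwards [(h.tendsto_trunc hE.hol hF hr hN j 0).eventually_lt_const hNj, hF] with n hn hnF
    exact ((lyapunov_lt_iff hnF.hol (r n) 0 c).2 ⟨N, j, hN, hn⟩).trans hca

/-- Joint continuity of the Lyapunov exponent on analytic `M₂(ℂ)`-cocycles
(singular cocycles allowed) at an irrational frequency `β`: if `Dₙ → D` uniformly on the strip
`|Im z| ≤ δ/2` and `βₙ → β`, then `L(βₙ, Dₙ) → L(β, D)` in `ℝ ∪ {-∞}`. -/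
theorem lyapunov_jointly_continuous_analytic
    (β δ : ℝ) (hβ : Irrational β) (hδ : 0 < δ)
    (D : ℂ → Matrix (Fin 2) (Fin 2) ℂ) (Dseq : ℕ → ℂ → Matrix (Fin 2) (Fin 2) ℂ)
    (hD : DifferentiableOn ℂ D {z : ℂ | |z.im| < δ})
    (hDn : ∀ n, DifferentiableOn ℂ (Dseq n) {z : ℂ | |z.im| < δ})
    (hper : ∀ z : ℂ, |z.im| < δ → D (z + 1) = D z)
    (hpern : ∀ n, ∀ z : ℂ, |z.im| < δ → Dseq n (z + 1) = Dseq n z)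
    (hconv : ∀ ε > (0:ℝ), ∃ N : ℕ, ∀ n ≥ N, ∀ z : ℂ, |z.im| ≤ δ / 2 → ‖Dseq n z - D z‖ ≤ ε)
    (βseq : ℕ → ℝ) (hβseq : Tendsto βseq atTop (nhds β)) :
    Tendsto (fun n => lyapunov (βseq n) (fun x : ℝ => Dseq n (x : ℂ))) atTop
      (nhds (lyapunov β (fun x : ℝ => D (x : ℂ)))) := by
  have hη : 0 < δ / 2 := half_pos hδ
  have hηδ : δ / 2 < δ := half_lt_self hδ
  have hE := hol_thicken_of_differentiableOn hη hηδ hD hper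
  have hF := fun n => hol_thicken_of_differentiableOn hη hηδ (hDn n) (hpern n)
  obtain ⟨B, hB⟩ := exists_bound_thicken hη.le hE
  have hB0 : 0 ≤ B := (norm_nonneg _).trans (hB 0)
  have hexp : Real.exp (Real.log (B + 1)) = B + 1 := Real.exp_log (by linarith)
  have hu : UConv atTop (fun n z => Dseq n (thicken (δ / 2) 0 z))
      (fun z => D (thicken (δ / 2) 0 z)) := fun ε hε => by
    obtain ⟨N, hN⟩ := hconv ε hε
    filter_upwards [eventually_ge_atTop N] with n hn z
    exact hN n hn _ (by simpa using abs_thicken_im_le hη.le 0 z)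
  have hlog : 0 ≤ Real.log (B + 1) := Real.log_nonneg (by linarith)
  have key := hu.tendsto_lyapunov (Λ := Real.log (B + 1)) hη
    ⟨hE, fun z => by rw [hexp]; linarith [hB z], hlog⟩
    ((hu 1 one_pos).mono fun n hn => ⟨hF n, fun z => by
      rw [hexp]
      have := norm_le_norm_add_norm_sub (D (thicken (δ / 2) 0 z)) (Dseq n (thicken (δ / 2) 0 z))
      rw [norm_sub_rev] at this
      linarith [hn z, hB z], hlog⟩) hβseq hβ
  have hid : ∀ x : ℝ, thicken (δ / 2) 0 ((x : ℂ) + (0:ℝ) * I) = x := fun x => by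
    have := thicken_ofReal hη.le 0 x
    simpa using this
  simpa only [hid] using key
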